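/- There exists a constant κ₀ > 0 such that for every κ > κ₀ the upper global critical field equals the upper local critical field: H̄_{C3}(κ) = H̄^{loc}(κ). -/

import Mathlib

open MeasureTheory Filter Set Topology

noncomputable section

namespace SC

/-- The plane `ℝ²`. -/
abbrev Plane := ℝ × ℝ

/-- Squared Euclidean norm on the plane. -/
def esq (v : Plane) : ℝ := v.1 ^ 2 + v.2 ^ 2

/-- Euclidean dot product on the plane. -/
def dot2 (v w : Plane) : ℝ := v.1 * w.1 + v.2 * w.2

/-- The reference vector potential `F₀(x) = (-x₂/2, x₁/2)`, with `curl F₀ = 1`. -/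
def F0 : Plane → Plane := fun x => (-x.2 / 2, x.1 / 2)

/-- `u` is of class `Cⁿ` on a neighborhood of the closure of `Ω`. -/
def CNearCl {E : Type*} [NormedAddCommGroup E] [NormedSpace ℝ E]
    (n : ℕ) (Ω : Set Plane) (u : Plane → E) : Prop :=
  ∃ U : Set Plane, IsOpen U ∧ closure Ω ⊆ U ∧ ContDiffOn ℝ n u U

/-- The pointwise squared magnetic gradient `|(-i∇ - B·A)u|²`. -/
def magSq (B : ℝ) (A : Plane → Plane) (u : Plane → ℂ) (x : Plane) : ℝ :=
  ‖(-Complex.I) * fderiv ℝ u x ((1 : ℝ), (0 : ℝ)) - ((B * (A x).1 : ℝ) : ℂ) * u x‖ ^ 2 +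
  ‖(-Complex.I) * fderiv ℝ u x ((0 : ℝ), (1 : ℝ)) - ((B * (A x).2 : ℝ) : ℂ) * u x‖ ^ 2

/-- `curl A = ∂₁A₂ - ∂₂A₁`. -/
def curl2 (A : Plane → Plane) (x : Plane) : ℝ :=
  fderiv ℝ (fun y => (A y).2) x ((1 : ℝ), (0 : ℝ)) -
    fderiv ℝ (fun y => (A y).1) x ((0 : ℝ), (1 : ℝ))

/-- The variational ground state energy `λ₁(B·A)` of the magnetic Neumann Laplacian. -/
def lam1A (Ω : Set Plane) (B : ℝ) (A : Plane → Plane) : ℝ :=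
  sInf { r : ℝ | ∃ u : Plane → ℂ, CNearCl 1 Ω u ∧ (∫ x in Ω, ‖u x‖ ^ 2) ≠ 0 ∧
    r = (∫ x in Ω, magSq B A u x) / (∫ x in Ω, ‖u x‖ ^ 2) }

/-- `λ₁(B) = λ₁(B·F₀)`. -/
def lam1 (Ω : Set Plane) (B : ℝ) : ℝ := lam1A Ω B F0

/-- The Ginzburg–Landau energy functional. -/
def GLenergy (Ω : Set Plane) (κ H : ℝ) (ψ : Plane → ℂ) (A : Plane → Plane) : ℝ :=
  ∫ x in Ω, (magSq (κ * H) A ψ x - κ ^ 2 * ‖ψ x‖ ^ 2 + κ ^ 2 / 2 * ‖ψ x‖ ^ 4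
    + κ ^ 2 * H ^ 2 * (curl2 A x - 1) ^ 2)

/-- Admissible Ginzburg–Landau configurations. -/
def GLadm (Ω : Set Plane) (ψ : Plane → ℂ) (A : Plane → Plane) : Prop :=
  CNearCl 1 Ω ψ ∧ CNearCl 1 Ω A

/-- The normal state is a minimizer at `(κ, H)`. -/
def NormalMin (Ω : Set Plane) (κ H : ℝ) : Prop :=
  ∀ ψ A, GLadm Ω ψ A → 0 ≤ GLenergy Ω κ H ψ A

/-- The normal state is the unique minimizer at `(κ, H)`. -/
def NormalUnique (Ω : Set Plane) (κ H : ℝ) : Prop :=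
  NormalMin Ω κ H ∧
  ∀ ψ A, GLadm Ω ψ A → (∫ x in Ω, ‖ψ x‖ ^ 2) ≠ 0 → 0 < GLenergy Ω κ H ψ A

/-- `(ψ, A)` is a minimizer of the Ginzburg–Landau energy at `(κ, H)`. -/
def IsGLMin (Ω : Set Plane) (κ H : ℝ) (ψ : Plane → ℂ) (A : Plane → Plane) : Prop :=
  GLadm Ω ψ A ∧ ∀ ψ' A', GLadm Ω ψ' A' → GLenergy Ω κ H ψ A ≤ GLenergy Ω κ H ψ' A'

/-- Lower global critical field. -/
def HC3low (Ω : Set Plane) (κ : ℝ) : ℝ := sInf {H : ℝ | 0 < H ∧ NormalMin Ω κ H}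

/-- Upper global critical field. -/
def HC3up (Ω : Set Plane) (κ : ℝ) : ℝ :=
  sInf {H : ℝ | 0 < H ∧ ∀ H', H < H' → NormalUnique Ω κ H'}

/-- Lower local critical field. -/
def HlocLow (Ω : Set Plane) (κ : ℝ) : ℝ :=
  sInf {H : ℝ | 0 < H ∧ κ ^ 2 ≤ lam1 Ω (κ * H)}

/-- Upper local critical field. -/
def HlocUp (Ω : Set Plane) (κ : ℝ) : ℝ :=
  sInf {H : ℝ | 0 < H ∧ ∀ H', H < H' → κ ^ 2 ≤ lam1 Ω (κ * H')}

/-- The inward unit normal `ν(s) = (-γ₂'(s), γ₁'(s))`. -/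
def nuVec (γ : ℝ → Plane) (s : ℝ) : Plane := (-(deriv γ s).2, (deriv γ s).1)

/-- The curvature `k(s) = ⟨γ''(s), ν(s)⟩`. -/
def curvOf (γ : ℝ → Plane) (s : ℝ) : ℝ := dot2 (deriv (deriv γ) s) (nuVec γ s)

/-- The maximal curvature. -/
def kmaxOf (γ : ℝ → Plane) : ℝ := sSup (Set.range (curvOf γ))

/-- A smooth counterclockwise arclength parametrization of the boundary of `Ω`. -/
structure BoundaryParam (Ω : Set Plane) where
  γ : ℝ → Plane
  L : ℝ
  L_pos : 0 < L
  smooth : ContDiff ℝ (⊤ : ℕ∞) γ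
  periodic : Function.Periodic γ L
  unit_speed : ∀ s, esq (deriv γ s) = 1
  injOn : Set.InjOn γ (Set.Ico 0 L)
  range_eq : Set.range γ = frontier Ω
  inward : ∀ s, ∃ ε > 0, ∀ t ∈ Set.Ioo (0 : ℝ) ε, γ s + t • nuVec γ s ∈ Ω

/-- The non-degeneracy assumption: finitely many points of maximal curvature,
all of them non-degenerate maxima. -/
def NonDegen {Ω : Set Plane} (P : BoundaryParam Ω) : Prop :=
  ∃ (N : ℕ) (s : Fin N → ℝ), 0 < N ∧ (∀ j, s j ∈ Set.Ico 0 P.L) ∧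
    (∀ j, curvOf P.γ (s j) = kmaxOf P.γ) ∧
    (∀ t ∈ Set.Ico 0 P.L, (∀ j, t ≠ s j) → curvOf P.γ t < kmaxOf P.γ) ∧
    (∀ j, deriv (deriv (curvOf P.γ)) (s j) < 0)

/-- The ground state energy `μ(ζ)` of the de Gennes half-line model operator. -/
def muGen (ζ : ℝ) : ℝ :=
  sInf { r : ℝ | ∃ φ : ℝ → ℝ, ContDiff ℝ 1 φ ∧ HasCompactSupport φ ∧
    (∃ τ, 0 < τ ∧ φ τ ≠ 0) ∧
    r = (∫ τ in Set.Ioi (0 : ℝ), ((deriv φ τ) ^ 2 + (τ + ζ) ^ 2 * (φ τ) ^ 2)) /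
        (∫ τ in Set.Ioi (0 : ℝ), (φ τ) ^ 2) }

/-- The de Gennes constant `Θ₀`. -/
def Theta0 : ℝ := sInf (Set.range muGen)

/-- Standard facts about the de Gennes constant, taken as hypotheses. -/
structure DeGennes where
  ξ₀ : ℝ
  u₀ : ℝ → ℝ
  theta_lb : 1 / 2 < Theta0
  theta_ub : Theta0 < 1
  ξ₀_mem : ξ₀ ∈ Set.Ioo (-1 : ℝ) 0
  ξ₀_min : muGen ξ₀ = Theta0
  ξ₀_uniq : ∀ ζ, muGen ζ = Theta0 → ζ = ξ₀
  ξ₀_sq : ξ₀ ^ 2 = Theta0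
  u₀_pos : ∀ τ, 0 ≤ τ → 0 < u₀ τ
  u₀_smooth : ContDiffOn ℝ 2 u₀ (Set.Ici 0)
  u₀_sq_int : IntegrableOn (fun τ => (u₀ τ) ^ 2) (Set.Ioi 0)
  u₀_normalized : (∫ τ in Set.Ioi (0 : ℝ), (u₀ τ) ^ 2) = 1
  u₀_neumann : derivWithin u₀ (Set.Ici 0) 0 = 0
  u₀_ode : ∀ τ ∈ Set.Ioi (0 : ℝ),
    -(deriv (deriv u₀) τ) + (τ + ξ₀) ^ 2 * u₀ τ = Theta0 * u₀ τ

/-- The universal constant `C₁ = u₀(0)²/3`. -/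
def DeGennes.C1 (D : DeGennes) : ℝ := (D.u₀ 0) ^ 2 / 3

/-- Condition (★) on a vector field `A` at field strength `B` with constant `C₀`. -/
def StarCond (Ω : Set Plane) (C₀ B : ℝ) (A : Plane → Plane) : Prop :=
  CNearCl 2 Ω A ∧
  (∀ x ∈ closure Ω, ‖A x‖ ≤ C₀) ∧
  (∀ x ∈ closure Ω, ‖fderiv ℝ A x‖ ≤ C₀) ∧
  (∀ x ∈ closure Ω, ‖fderiv ℝ (fderiv ℝ A) x‖ ≤ C₀) ∧
  (∀ x ∈ closure Ω, |curl2 A x - 1| ≤ C₀ * B ^ (-(1 : ℝ) / 4)) ∧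
  (∀ x ∈ closure Ω, ‖fderiv ℝ (curl2 A) x‖ ≤ C₀ * B ^ (-(1 : ℝ) / 4)) ∧
  (∀ x ∈ frontier Ω, curl2 A x = 1)

/-- The open unit disc. -/
def unitDisc : Set Plane := {x : Plane | x.1 ^ 2 + x.2 ^ 2 < 1}

/-- `Δ_B`: distance from `B/2 + ξ₀√B + δ₀` to the nearest integer. -/
def DeltaB (ξ₀ δ₀ B : ℝ) : ℝ :=
  sInf (Set.range (fun m : ℤ => |(m : ℝ) - B / 2 - ξ₀ * Real.sqrt B - δ₀|))

/-- Euclidean distance to the boundary of `Ω`. -/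
def distBdry (Ω : Set Plane) (x : Plane) : ℝ :=
  sInf ((fun y => Real.sqrt (esq (x - y))) '' frontier Ω)

end SC

namespace SC

/-- A preconnected set that misses the frontier of an open set `Ω` and meets `Ω` lies in `Ω`. -/
theorem subset_of_isPreconnected_of_disjoint_frontier {X : Type*} [TopologicalSpace X]
    {Ω C : Set X} (hΩ : IsOpen Ω) (hC : IsPreconnected C) (hd : Disjoint C (frontier Ω))
    (hm : (C ∩ Ω).Nonempty) : C ⊆ Ω := by
  refine hC.subset_left_of_subset_union (v := (closure Ω)ᶜ) hΩ isClosed_closure.isOpen_compl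
    (Set.disjoint_left.2 fun x hx hx' => hx' (subset_closure hx)) ?_ hm
  intro x hx
  by_cases h : x ∈ Ω
  · exact Or.inl h
  · refine Or.inr fun hcl => Set.disjoint_left.1 hd hx ?_
    rw [hΩ.frontier_eq]
    exact ⟨hcl, h⟩

/-- The rotation sending the standard frame to the frame `(v, Jv)` for a unit vector `v`. -/
def frameEquiv (v : Plane) (hv : esq v = 1) : Plane ≃L[ℝ] Plane :=
  LinearEquiv.toContinuousLinearEquiv
    { toFun := fun x => (x.1 * v.1 - x.2 * v.2, x.1 * v.2 + x.2 * v.1)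
      invFun := fun y => (v.1 * y.1 + v.2 * y.2, -v.2 * y.1 + v.1 * y.2)
      map_add' := fun x y => by ext <;> simp <;> ring
      map_smul' := fun c x => by ext <;> simp <;> ring
      left_inv := fun x => by
        have h : v.1 ^ 2 + v.2 ^ 2 = 1 := hv
        ext
        · simp only
          linear_combination x.1 * h
        · simp only
          linear_combination x.2 * h
      right_inv := fun x => by
        have h : v.1 ^ 2 + v.2 ^ 2 = 1 := hv
        ext
        · simp only
          linear_combination x.1 * h
        · simp only
          linear_combination x.2 * h }

theorem frameEquiv_apply (v : Plane) (hv : esq v = 1) (x : Plane) :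
    frameEquiv v hv x = (x.1 * v.1 - x.2 * v.2, x.1 * v.2 + x.2 * v.1) := rfl

namespace BoundaryParam

variable {Ω : Set Plane} (P : BoundaryParam Ω)

/-- The map `(s, t) ↦ γ(s) + t ν(s₀)`. -/
def tube (s₀ : ℝ) (x : Plane) : Plane := P.γ x.1 + x.2 • nuVec P.γ s₀

theorem tube_zero (s₀ s : ℝ) : P.tube s₀ (s, 0) = P.γ s := by simp [tube]

theorem contDiff_tube (s₀ : ℝ) : ContDiff ℝ 1 (P.tube s₀) := by
  have h : ContDiff ℝ 1 P.γ := P.smooth.of_le (by exact_mod_cast le_top)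
  unfold tube
  fun_prop

theorem hasFDerivAt_tube (s₀ : ℝ) :
    HasFDerivAt (P.tube s₀) (frameEquiv (deriv P.γ s₀) (P.unit_speed s₀) : Plane →L[ℝ] Plane)
      (s₀, 0) := by
  have h : DifferentiableAt ℝ P.γ s₀ := (P.smooth.differentiable (by simp)).differentiableAt
  have h1 : HasFDerivAt (fun x : Plane => P.γ x.1)
      ((ContinuousLinearMap.toSpanSingleton ℝ (deriv P.γ s₀)).comp
        (ContinuousLinearMap.fst ℝ ℝ ℝ)) (s₀, (0 : ℝ)) :=
    HasFDerivAt.comp (g := P.γ) (f := Prod.fst) (s₀, (0 : ℝ)) h.hasDerivAt.hasFDerivAt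
      hasFDerivAt_fst
  have h2 : HasFDerivAt (fun x : Plane => x.2 • nuVec P.γ s₀)
      ((ContinuousLinearMap.snd ℝ ℝ ℝ).smulRight (nuVec P.γ s₀)) (s₀, (0 : ℝ)) :=
    hasFDerivAt_snd.smul_const _
  refine (h1.add h2).congr_fderiv ?_
  ext <;> simp [frameEquiv_apply, nuVec]

/-- The local homeomorphism given by `tube s₀` near `(s₀, 0)`. -/
def chart (s₀ : ℝ) : OpenPartialHomeomorph Plane Plane :=
  ContDiffAt.toOpenPartialHomeomorph (P.tube s₀) (P.contDiff_tube s₀).contDiffAt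
    (P.hasFDerivAt_tube s₀) one_ne_zero

theorem chart_apply (s₀ : ℝ) (x : Plane) : P.chart s₀ x = P.tube s₀ x := rfl

theorem mem_chart_source (s₀ : ℝ) : (s₀, (0 : ℝ)) ∈ (P.chart s₀).source :=
  ContDiffAt.mem_toOpenPartialHomeomorph_source _ _ _

theorem eq_of_eq (s₀ s : ℝ) (h : P.γ s = P.γ s₀) : ∃ n : ℤ, s = s₀ + n • P.L := by
  obtain ⟨m, hm, -⟩ := existsUnique_add_zsmul_mem_Ico P.L_pos s 0
  obtain ⟨n, hn, -⟩ := existsUnique_add_zsmul_mem_Ico P.L_pos s₀ 0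
  have hm' : s + m • P.L ∈ Set.Ico 0 P.L := by simpa using hm
  have hn' : s₀ + n • P.L ∈ Set.Ico 0 P.L := by simpa using hn
  have := P.injOn hm' hn' (by rw [P.periodic.zsmul m s, P.periodic.zsmul n s₀, h])
  refine ⟨n - m, ?_⟩
  rw [sub_smul]
  linarith

/-- Boundary points near `γ(s₀)` have parameters near `s₀`. -/
theorem eventually_frontier (s₀ : ℝ) {δ : ℝ} (hδ : 0 < δ) :
    ∀ᶠ x in 𝓝 (P.γ s₀), x ∈ frontier Ω → ∃ s ∈ Set.Ioo (s₀ - δ) (s₀ + δ), x = P.γ s := by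
  set δ' := min (δ / 2) (P.L / 2)
  have hδ' : 0 < δ' := lt_min (half_pos hδ) (half_pos P.L_pos)
  have h1 : δ' ≤ δ / 2 := min_le_left _ _
  have h2 : δ' ≤ P.L / 2 := min_le_right _ _
  have hcont : Continuous P.γ := P.smooth.continuous
  have hK : IsCompact (P.γ '' Set.Icc (s₀ + δ') (s₀ + P.L - δ')) := isCompact_Icc.image hcont
  have hp : P.γ s₀ ∉ P.γ '' Set.Icc (s₀ + δ') (s₀ + P.L - δ') := by
    rintro ⟨s, hs, hs'⟩
    obtain ⟨n, rfl⟩ := P.eq_of_eq s₀ s hs'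
    have hL := P.L_pos
    have ha : (0 : ℝ) < n := by
      have : 0 < (n : ℝ) * P.L := by have := hs.1; simp at this; linarith
      exact pos_of_mul_pos_left this hL.le
    have hb : (n : ℝ) < 1 := by
      have : (n : ℝ) * P.L < 1 * P.L := by have := hs.2; simp at this; linarith
      exact lt_of_mul_lt_mul_right this hL.le
    have ha' : 0 < n := by exact_mod_cast ha
    have hb' : n < 1 := by exact_mod_cast hb
    omega
  filter_upwards [hK.isClosed.isOpen_compl.mem_nhds hp] with x hx hxf
  rw [← P.range_eq] at hxf
  obtain ⟨s, rfl⟩ := hxf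
  obtain ⟨m, hm, -⟩ := existsUnique_add_zsmul_mem_Ico P.L_pos s (s₀ - δ')
  have hper : P.γ (s + m • P.L) = P.γ s := P.periodic.zsmul m s
  refine ⟨s + m • P.L, ⟨by linarith [hm.1], ?_⟩, hper.symm⟩
  by_contra hcon
  push Not at hcon
  exact hx ⟨s + m • P.L, ⟨by linarith, by linarith [hm.2]⟩, hper⟩

/-- The box of half-width `δ` around `(s₀, 0)`. -/
def box (s₀ δ : ℝ) : Set Plane := Set.Ioo (s₀ - δ) (s₀ + δ) ×ˢ Set.Ioo (-δ) δ

theorem exists_box_subset {s₀ : ℝ} {N : Set Plane} (hN : N ∈ 𝓝 (s₀, (0 : ℝ))) :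
    ∃ δ > 0, box s₀ δ ⊆ N := by
  obtain ⟨δ, hδ, h⟩ := Metric.mem_nhds_iff.1 hN
  refine ⟨δ, hδ, fun x hx => h ?_⟩
  rw [← ball_prod_same, Real.ball_eq_Ioo, Real.ball_eq_Ioo]
  simpa [box] using hx

theorem box_mem_nhds (s₀ : ℝ) {δ : ℝ} (hδ : 0 < δ) : box s₀ δ ∈ 𝓝 (s₀, (0 : ℝ)) :=
  prod_mem_nhds (Ioo_mem_nhds (by linarith) (by linarith)) (Ioo_mem_nhds (by linarith) hδ)

theorem box_subset_box (s₀ : ℝ) {δ δ' : ℝ} (h : δ ≤ δ') : box s₀ δ ⊆ box s₀ δ' :=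
  Set.prod_mono (Set.Ioo_subset_Ioo (by linarith) (by linarith))
    (Set.Ioo_subset_Ioo (by linarith) h)

/-- In a small box, the tube map meets the boundary only on the axis. -/
theorem exists_box_frontier (s₀ : ℝ) : ∃ δ > 0, box s₀ δ ⊆ (P.chart s₀).source ∧
    ∀ x ∈ box s₀ δ, P.tube s₀ x ∈ frontier Ω → x.2 = 0 := by
  obtain ⟨δ₁, hδ₁, h₁⟩ := exists_box_subset
    ((P.chart s₀).open_source.mem_nhds (P.mem_chart_source s₀))
  have hc : ContinuousAt (P.tube s₀) (s₀, 0) := (P.contDiff_tube s₀).continuous.continuousAt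
  have hev := hc.eventually (by rw [tube_zero]; exact P.eventually_frontier s₀ hδ₁)
  obtain ⟨δ₂, hδ₂, h₂⟩ := exists_box_subset hev
  refine ⟨min δ₁ δ₂, lt_min hδ₁ hδ₂, (box_subset_box _ (min_le_left _ _)).trans h₁, ?_⟩
  intro x hx hf
  obtain ⟨s, hs, hs'⟩ := h₂ (box_subset_box _ (min_le_right _ _) hx) hf
  rw [← P.tube_zero s₀, ← chart_apply, ← chart_apply] at hs'
  have := (P.chart s₀).injOn (h₁ (box_subset_box _ (min_le_left _ _) hx))
    (h₁ ⟨hs, by simpa using hδ₁⟩) hs'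
  rw [this]

/-- The upper half of a small box is mapped into `Ω`, the lower half is mapped into `Ω` or off
`Ω`. -/
theorem exists_box_sides (hΩ : IsOpen Ω) (s₀ : ℝ) : ∃ δ > 0, box s₀ δ ⊆ (P.chart s₀).source ∧
    (∀ x ∈ box s₀ δ, 0 < x.2 → P.tube s₀ x ∈ Ω) ∧
    ((∀ x ∈ box s₀ δ, x.2 < 0 → P.tube s₀ x ∈ Ω) ∨
      (∀ x ∈ box s₀ δ, x.2 < 0 → P.tube s₀ x ∉ Ω)) := by
  obtain ⟨δ, hδ, hs, hf⟩ := P.exists_box_frontier s₀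
  have hcont := (P.contDiff_tube s₀).continuous
  have key : ∀ S : Set ℝ, Convex ℝ S → S ⊆ Set.Ioo (-δ) δ → (0 : ℝ) ∉ S →
      ∀ x ∈ Set.Ioo (s₀ - δ) (s₀ + δ) ×ˢ S, P.tube s₀ x ∈ Ω →
      ∀ y ∈ Set.Ioo (s₀ - δ) (s₀ + δ) ×ˢ S, P.tube s₀ y ∈ Ω := by
    intro S hS hSδ h0 x hx hxΩ y hy
    have hpre : IsPreconnected (P.tube s₀ '' (Set.Ioo (s₀ - δ) (s₀ + δ) ×ˢ S)) :=
      (((convex_Ioo _ _).prod hS).isPreconnected).image _ hcont.continuousOn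
    refine subset_of_isPreconnected_of_disjoint_frontier hΩ hpre ?_
      ⟨_, Set.mem_image_of_mem _ hx, hxΩ⟩ (Set.mem_image_of_mem _ hy)
    rw [Set.disjoint_left]
    rintro _ ⟨z, hz, rfl⟩ hzf
    have : z.2 = 0 := hf z ⟨hz.1, hSδ hz.2⟩ hzf
    exact h0 (this ▸ hz.2)
  refine ⟨δ, hδ, hs, ?_, ?_⟩
  · obtain ⟨ε, hε, hin⟩ := P.inward s₀
    intro x hx hx0
    have hm : 0 < min ε δ := lt_min hε hδ
    refine key (Set.Ioo 0 δ) (convex_Ioo _ _) (Set.Ioo_subset_Ioo (by linarith) le_rfl) (by simp)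
      (s₀, min ε δ / 2) ⟨⟨by simp; linarith, by simp; linarith⟩, ⟨by simp only; linarith, ?_⟩⟩ ?_ x
      ⟨hx.1, hx0, hx.2.2⟩
    · have := min_le_right ε δ
      simp only; linarith
    · have := min_le_left ε δ
      exact hin _ ⟨by linarith, by linarith⟩
  · by_cases h : ∃ x ∈ box s₀ δ, x.2 < 0 ∧ P.tube s₀ x ∈ Ω
    · obtain ⟨x, hx, hx0, hxΩ⟩ := h
      left
      intro y hy hy0
      exact key (Set.Ioo (-δ) 0) (convex_Ioo _ _) (Set.Ioo_subset_Ioo le_rfl hδ.le) (by simp)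
        x ⟨hx.1, hx.2.1, hx0⟩ hxΩ y ⟨hy.1, hy.2.1, hy0⟩
    · push Not at h
      exact Or.inr h

theorem gamma_notMem_interior_closure (hΩ : IsOpen Ω) (hb : Bornology.IsBounded Ω) (s : ℝ) :
    P.γ s ∉ interior (closure Ω) := by
  have hcont : Continuous P.γ := P.smooth.continuous
  have hclopen : IsClopen {s | P.γ s ∈ interior (closure Ω)} := by
    refine ⟨⟨?_⟩, isOpen_interior.preimage hcont⟩
    rw [isOpen_iff_mem_nhds]
    intro s₀ hs₀
    obtain ⟨δ, hδ, hs, hp, hn⟩ := P.exists_box_sides hΩ s₀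
    have hmem (s : ℝ) (hs : s ∈ Set.Ioo (s₀ - δ) (s₀ + δ)) : P.γ s ∈ frontier Ω :=
      P.range_eq ▸ Set.mem_range_self s
    rcases hn with hn | hn
    · exfalso
      apply hs₀
      rw [Set.mem_ofPred_eq, mem_interior_iff_mem_nhds]
      have := (P.chart s₀).image_mem_nhds (P.mem_chart_source s₀) (box_mem_nhds s₀ hδ)
      rw [chart_apply, tube_zero] at this
      refine Filter.mem_of_superset this ?_
      rintro _ ⟨x, hx, rfl⟩
      rcases lt_trichotomy x.2 0 with h | h | h
      · exact subset_closure (hn x hx h)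
      · have : x = (x.1, 0) := by ext <;> simp [h]
        rw [this, chart_apply, tube_zero]
        exact frontier_subset_closure (hmem _ hx.1)
      · exact subset_closure (hp x hx h)
    · refine Filter.mem_of_superset (Ioo_mem_nhds (a := s₀ - δ) (b := s₀ + δ) (by linarith)
        (by linarith)) ?_
      intro s hs' hint
      have hO : IsOpen (P.chart s₀ '' (Set.Ioo (s₀ - δ) (s₀ + δ) ×ˢ Set.Ioo (-δ) 0)) := by
        refine (P.chart s₀).isOpen_image_of_subset_source (isOpen_Ioo.prod isOpen_Ioo)
          (subset_trans ?_ hs)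
        exact Set.prod_mono le_rfl (Set.Ioo_subset_Ioo le_rfl hδ.le)
      have hdisj : Disjoint (P.chart s₀ '' (Set.Ioo (s₀ - δ) (s₀ + δ) ×ˢ Set.Ioo (-δ) 0))
          (closure Ω) := by
        refine Disjoint.closure_right ?_ hO
        rw [Set.disjoint_left]
        rintro _ ⟨x, hx, rfl⟩
        exact hn x ⟨hx.1, hx.2.1, hx.2.2.trans hδ⟩ hx.2.2
      have hpre : (fun t : ℝ => P.tube s₀ (s, t)) ⁻¹' (interior (closure Ω)) ∈ 𝓝 (0 : ℝ) := by
        refine IsOpen.mem_nhds (isOpen_interior.preimage ?_) ?_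
        · have := (P.contDiff_tube s₀).continuous
          fun_prop
        · simpa [tube_zero] using hint
      have h2 : ∀ᶠ t : ℝ in 𝓝[<] 0, False := by
        filter_upwards [mem_nhdsWithin_of_mem_nhds hpre,
          Ioo_mem_nhdsLT (show (-δ) < 0 by linarith)] with t ht ht'
        exact Set.disjoint_left.1 hdisj ⟨(s, t), ⟨hs', ht'⟩, rfl⟩ (interior_subset ht)
      simpa using h2.exists
  rcases isClopen_iff.1 hclopen with h | h
  · exact fun hs => by
      have : s ∈ {s | P.γ s ∈ interior (closure Ω)} := hs
      rw [h] at this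
      exact this
  · exfalso
    have hop : IsOpen (closure Ω) := by
      rw [← subset_interior_iff_isOpen]
      intro x hx
      rw [closure_eq_self_union_frontier] at hx
      rcases hx with hx | hx
      · exact interior_mono subset_closure (by rwa [hΩ.interior_eq])
      · rw [← P.range_eq] at hx
        obtain ⟨t, rfl⟩ := hx
        have : t ∈ {s | P.γ s ∈ interior (closure Ω)} := h ▸ Set.mem_univ t
        exact this
    rcases isClopen_iff.1 (⟨isClosed_closure, hop⟩ : IsClopen (closure Ω)) with h' | h'
    · have : P.γ 0 ∈ closure Ω := frontier_subset_closure (P.range_eq ▸ Set.mem_range_self 0)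
      rw [h'] at this
      exact this
    · have hb' : Bornology.IsBounded (Set.univ : Set Plane) := h' ▸ hb.closure
      exact NormedSpace.unbounded_univ ℝ Plane hb'

/-- Near a boundary point, `Ω` is exactly the image of the upper half of a box. -/
theorem exists_box_mem_iff (hΩ : IsOpen Ω) (hb : Bornology.IsBounded Ω) (s₀ : ℝ) :
    ∃ δ > 0, box s₀ δ ⊆ (P.chart s₀).source ∧
      ∀ x ∈ box s₀ δ, (P.tube s₀ x ∈ Ω ↔ 0 < x.2) := by
  obtain ⟨δ, hδ, hs, hp, hn⟩ := P.exists_box_sides hΩ s₀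
  refine ⟨δ, hδ, hs, fun x hx => ⟨fun h => ?_, hp x hx⟩⟩
  have hfr (s : ℝ) : P.γ s ∈ frontier Ω := P.range_eq ▸ Set.mem_range_self s
  rcases lt_trichotomy x.2 0 with h0 | h0 | h0
  · exfalso
    rcases hn with hn | hn
    · apply P.gamma_notMem_interior_closure hΩ hb s₀
      rw [mem_interior_iff_mem_nhds]
      have := (P.chart s₀).image_mem_nhds (P.mem_chart_source s₀) (box_mem_nhds s₀ hδ)
      rw [chart_apply, tube_zero] at this
      refine Filter.mem_of_superset this ?_
      rintro _ ⟨x, hx, rfl⟩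
      rcases lt_trichotomy x.2 0 with h | h | h
      · exact subset_closure (hn x hx h)
      · have : x = (x.1, 0) := by ext <;> simp [h]
        rw [this, chart_apply, tube_zero]
        exact frontier_subset_closure (hfr _)
      · exact subset_closure (hp x hx h)
    · exact hn x hx h0 h
  · exfalso
    have hx' : x = (x.1, 0) := by ext <;> simp [h0]
    rw [hx', tube_zero] at h
    have := hfr x.1
    rw [hΩ.frontier_eq] at this
    exact this.2 h
  · exact h0

end BoundaryParam

/-- `Ω` is locally connected at each point of its closure. -/
theorem BoundaryParam.exists_isPreconnected {Ω : Set Plane} (P : BoundaryParam Ω)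
    (hΩ : IsOpen Ω) (hb : Bornology.IsBounded Ω)
    {x : Plane} (hx : x ∈ closure Ω) {r : ℝ} (hr : 0 < r) :
    ∃ ρ > 0, ∃ C ⊆ Metric.ball x r ∩ Ω, IsPreconnected C ∧ Metric.ball x ρ ∩ Ω ⊆ C := by
  rw [closure_eq_self_union_frontier] at hx
  rcases hx with hx | hx
  · obtain ⟨ε, hε, hball⟩ := Metric.isOpen_iff.1 hΩ x hx
    refine ⟨min ε r, lt_min hε hr, Metric.ball x (min ε r), fun y hy =>
      ⟨Metric.ball_subset_ball (min_le_right _ _) hy, hball (Metric.ball_subset_ball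
        (min_le_left _ _) hy)⟩, (convex_ball _ _).isPreconnected, Set.inter_subset_left⟩
  · rw [← P.range_eq] at hx
    obtain ⟨s₀, rfl⟩ := hx
    obtain ⟨δ₁, hδ₁, hs, hiff⟩ := P.exists_box_mem_iff hΩ hb s₀
    have hc : ContinuousAt (P.tube s₀) (s₀, 0) := (P.contDiff_tube s₀).continuous.continuousAt
    have hev := hc.eventually (by rw [P.tube_zero]; exact Metric.ball_mem_nhds _ hr)
    obtain ⟨δ₂, hδ₂, h₂⟩ := exists_box_subset hev
    set δ := min δ₁ δ₂
    have hδ : 0 < δ := lt_min hδ₁ hδ₂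
    have hsub₁ := box_subset_box s₀ (min_le_left δ₁ δ₂)
    have hsub₂ := box_subset_box s₀ (min_le_right δ₁ δ₂)
    have hnhds := (P.chart s₀).image_mem_nhds (P.mem_chart_source s₀) (box_mem_nhds s₀ hδ)
    rw [P.chart_apply, P.tube_zero] at hnhds
    obtain ⟨ρ, hρ, hball⟩ := Metric.mem_nhds_iff.1 hnhds
    have hup : Set.Ioo (s₀ - δ) (s₀ + δ) ×ˢ Set.Ioo 0 δ ⊆ box s₀ δ :=
      Set.prod_mono le_rfl (Set.Ioo_subset_Ioo (by linarith) le_rfl)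
    refine ⟨ρ, hρ, P.tube s₀ '' (Set.Ioo (s₀ - δ) (s₀ + δ) ×ˢ Set.Ioo 0 δ), ?_,
      (((convex_Ioo _ _).prod (convex_Ioo _ _)).isPreconnected).image _
        (P.contDiff_tube s₀).continuous.continuousOn, ?_⟩
    · rintro _ ⟨x, hx, rfl⟩
      exact ⟨h₂ (hsub₂ (hup hx)), (hiff x (hsub₁ (hup hx))).2 hx.2.1⟩
    · rintro y ⟨hy, hyΩ⟩
      obtain ⟨x, hx, rfl⟩ := hball hy
      exact ⟨x, ⟨hx.1, (hiff x (hsub₁ hx)).1 hyΩ, hx.2.2⟩, rfl⟩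

section Primitive

variable {E : Type*} [NormedAddCommGroup E] [NormedSpace ℝ E]

/-- Two primitives of the same `1`-form on a preconnected open set differ by a constant. -/
theorem sub_eq_sub_of_hasFDerivAt {ω : E → E →L[ℝ] ℝ} {O : Set E} (hO : IsOpen O)
    (hc : IsPreconnected O) {f g : E → ℝ} (hf : ∀ x ∈ O, HasFDerivAt f (ω x) x)
    (hg : ∀ x ∈ O, HasFDerivAt g (ω x) x) {x y : E} (hx : x ∈ O) (hy : y ∈ O) :
    f x - g x = f y - g y := by
  have hd : ∀ z ∈ O, HasFDerivAt (fun z => f z - g z) (0 : E →L[ℝ] ℝ) z := fun z hz =>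
    ((hf z hz).sub (hg z hz)).congr_fderiv (sub_self _)
  exact hO.is_const_of_fderiv_eq_zero hc
    (fun z hz => (hd z hz).differentiableAt.differentiableWithinAt)
    (fun z hz => (hd z hz).fderiv) hx hy

/-- The real numbers with the discrete topology. -/
@[ext]
structure DReal where
  /-- The underlying real number. -/
  val : ℝ

instance : TopologicalSpace DReal := ⊥

instance : DiscreteTopology DReal := ⟨rfl⟩

/-- The bundle of germs of primitives of a locally exact `1`-form on `Ω`. -/
def germCore (Ω : Set E) (ω : E → E →L[ℝ] ℝ) (r : Ω → ℝ) (f : Ω → E → ℝ)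
    (hr : ∀ i, 0 < r i)
    (hf : ∀ i : Ω, ∀ x ∈ Metric.ball (i : E) (r i), HasFDerivAt (f i) (ω x) x) :
    FiberBundleCore Ω Ω DReal where
  baseSet i := Subtype.val ⁻¹' Metric.ball (i : E) (r i)
  isOpen_baseSet i := Metric.isOpen_ball.preimage continuous_subtype_val
  indexAt x := x
  mem_baseSet_at x := Metric.mem_ball_self (hr x)
  coordChange i j x v := ⟨v.val + (f i x - f j x)⟩
  coordChange_self i x _ v := by
    ext
    simp
  continuousOn_coordChange i j := by
    rintro ⟨x, v⟩ ⟨⟨hxi, hxj⟩, -⟩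
    have hconst : ∀ y ∈ Metric.ball (i : E) (r i) ∩ Metric.ball (j : E) (r j),
        f i y - f j y = f i x - f j x := fun y hy =>
      sub_eq_sub_of_hasFDerivAt (ω := ω) (Metric.isOpen_ball.inter Metric.isOpen_ball)
        ((convex_ball _ _).inter (convex_ball _ _)).isPreconnected
        (fun z hz => hf i z hz.1) (fun z hz => hf j z hz.2) hy ⟨hxi, hxj⟩
    refine ContinuousAt.continuousWithinAt ?_
    refine (continuousAt_const (y := (⟨v.val + (f i x - f j x)⟩ : DReal))).congr ?_
    have h1 : (Subtype.val ⁻¹' (Metric.ball (i : E) (r i) ∩ Metric.ball (j : E) (r j)) : Set Ω) ×ˢ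
        ({v} : Set DReal) ∈ 𝓝 (x, v) :=
      prod_mem_nhds (((Metric.isOpen_ball.inter Metric.isOpen_ball).preimage
        continuous_subtype_val).mem_nhds ⟨hxi, hxj⟩) (by simp)
    filter_upwards [h1] with p hp
    obtain ⟨y, w⟩ := p
    have hw : w = v := hp.2
    subst hw
    have := hconst y hp.1
    simp only
    rw [this]
  coordChange_comp i j k x _ v := by
    ext
    simp only
    ring

/-- A closed `1`-form on a simply connected open set has a primitive. -/
theorem exists_primitive_of_simplyConnected {Ω : Set E} (hΩ : IsOpen Ω)
    (hsc : SimplyConnectedSpace Ω) {ω : E → E →L[ℝ] ℝ} (hω : DifferentiableOn ℝ ω Ω)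
    (hsymm : ∀ a ∈ Ω, ∀ x y, fderiv ℝ ω a x y = fderiv ℝ ω a y x) :
    ∃ χ : E → ℝ, ∀ x ∈ Ω, HasFDerivAt χ (ω x) x := by
  have hloc : ∀ i : Ω, ∃ r : ℝ, 0 < r ∧ ∃ f : E → ℝ, Metric.ball (i : E) r ⊆ Ω ∧
      ∀ x ∈ Metric.ball (i : E) r, HasFDerivAt f (ω x) x := by
    intro i
    obtain ⟨r, hr, hball⟩ := Metric.isOpen_iff.1 hΩ i i.2
    obtain ⟨f, hf⟩ := (convex_ball (i : E) r).exists_forall_hasFDerivAt_of_fderiv_symmetric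
      Metric.isOpen_ball (hω.mono hball) fun a ha => hsymm a (hball ha)
    exact ⟨r, hr, f, hball, hf⟩
  choose r hr f hball hf using hloc
  let Z := germCore Ω ω r f hr hf
  have hcov : IsCoveringMap (Bundle.TotalSpace.proj : Z.TotalSpace → Ω) :=
    FiberBundle.isCoveringMap
  have : LocallyPathConnectedSpace Ω := hΩ.locallyPathConnectedSpace
  obtain ⟨a₀⟩ : Nonempty Ω := inferInstance
  obtain ⟨F, ⟨-, hF⟩, -⟩ := hcov.existsUnique_continuousMap_lifts (ContinuousMap.id Ω) a₀
    (⟨a₀, (⟨0⟩ : DReal)⟩ : Z.TotalSpace) rfl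
  have hFp : ∀ x, (F x).proj = x := fun x => congrFun hF x
  let val : Z.TotalSpace → ℝ := fun p => DReal.val p.snd
  let g : Ω → ℝ := fun x => f (F x).proj x + val (F x)
  have hg : ∀ i : Ω, ∃ c : ℝ, ∀ᶠ x in 𝓝 i, g x = f i x + c := by
    intro i
    let φ : Ω → DReal := fun x => (Z.localTriv i (F x)).2
    have hφ : ContinuousAt φ i := by
      have hmem : F i ∈ (Z.localTriv i).source := by
        rw [FiberBundleCore.mem_localTriv_source, ← FiberBundleCore.baseSet_at, hFp]
        exact Z.mem_baseSet_at i
      exact continuous_snd.continuousAt.comp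
        (((Z.localTriv i).continuousAt hmem).comp F.continuous.continuousAt)
    have hev : ∀ᶠ x in 𝓝 i, φ x = φ i := by
      have : ({φ i} : Set DReal) ∈ 𝓝 (φ i) := by simp
      exact hφ this
    refine ⟨(φ i).val, ?_⟩
    filter_upwards [hev] with x hx
    have hφx : (φ x).val = (val (F x) + (f (F x).proj (F x).proj - f i (F x).proj) : ℝ) := rfl
    rw [← hx, hφx, hFp]
    simp only [g, hFp]
    ring
  classical
  refine ⟨fun x => if h : x ∈ Ω then g ⟨x, h⟩ else 0, fun x hx => ?_⟩
  obtain ⟨c, hc⟩ := hg ⟨x, hx⟩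
  have h1 := (hf ⟨x, hx⟩ x (Metric.mem_ball_self (hr _))).add_const c
  refine h1.congr_of_eventuallyEq ?_
  rw [nhds_subtype_eq_comap, Filter.eventually_comap] at hc
  filter_upwards [hc, hΩ.mem_nhds hx] with y hy hyΩ
  rw [dif_pos hyΩ]
  exact hy ⟨y, hyΩ⟩ rfl

/-- A primitive on `Ω` of a `1`-form that is closed near `closure Ω` extends to a neighborhood of
the closure, provided `Ω` is locally connected at its boundary. -/
theorem exists_primitive_near_closure {Ω V : Set E} (hΩ : IsOpen Ω) (hV : IsOpen V)
    (hcl : closure Ω ⊆ V) {ω : E → E →L[ℝ] ℝ} (hω : DifferentiableOn ℝ ω V)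
    (hsymm : ∀ a ∈ V, ∀ x y, fderiv ℝ ω a x y = fderiv ℝ ω a y x)
    (hlc : ∀ x ∈ closure Ω, ∀ r > 0, ∃ ρ > 0, ∃ C ⊆ Metric.ball x r ∩ Ω,
      IsPreconnected C ∧ Metric.ball x ρ ∩ Ω ⊆ C)
    {χ₀ : E → ℝ} (hχ₀ : ∀ x ∈ Ω, HasFDerivAt χ₀ (ω x) x) :
    ∃ W, IsOpen W ∧ closure Ω ⊆ W ∧ ∃ χ : E → ℝ, ∀ x ∈ W, HasFDerivAt χ (ω x) x := by
  have hloc : ∀ p : closure Ω, ∃ ρ : ℝ, 0 < ρ ∧ ∃ g : E → ℝ,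
      (∀ x ∈ Metric.ball (p : E) ρ, HasFDerivAt g (ω x) x) ∧
      ∀ x ∈ Metric.ball (p : E) ρ ∩ Ω, g x = χ₀ x := by
    rintro ⟨p, hp⟩
    obtain ⟨r, hr, hball⟩ := Metric.isOpen_iff.1 hV p (hcl hp)
    obtain ⟨g, hg⟩ := (convex_ball p r).exists_forall_hasFDerivAt_of_fderiv_symmetric
      Metric.isOpen_ball (hω.mono hball) fun a ha => hsymm a (hball ha)
    obtain ⟨ρ, hρ, C, hC, hCc, hsub⟩ := hlc p hp r hr
    obtain ⟨q, hq, hqΩ⟩ := Metric.mem_closure_iff.1 hp ρ hρ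
    have hqC : q ∈ C := hsub ⟨by rwa [Metric.mem_ball, dist_comm], hq⟩
    set O := connectedComponentIn (Metric.ball p r ∩ Ω) q
    have hO : IsOpen O := (Metric.isOpen_ball.inter hΩ).connectedComponentIn
    have hCO : C ⊆ O := hCc.subset_connectedComponentIn hqC hC
    have hOs : O ⊆ Metric.ball p r ∩ Ω := connectedComponentIn_subset _ _
    refine ⟨min ρ r, lt_min hρ hr, fun x => g x - (g q - χ₀ q), fun x hx =>
      (hg x (Metric.ball_subset_ball (min_le_right _ _) hx)).sub_const _, fun x hx => ?_⟩
    have hxO : x ∈ O := hCO (hsub ⟨Metric.ball_subset_ball (min_le_left _ _) hx.1, hx.2⟩)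
    have := sub_eq_sub_of_hasFDerivAt hO isPreconnected_connectedComponentIn
      (fun z hz => hg z (hOs hz).1) (fun z hz => hχ₀ z (hOs hz).2) hxO (hCO hqC)
    simp only
    linarith
  choose ρ hρ g hg hgχ using hloc
  have hle : ∀ p q : closure Ω, ρ q ≤ ρ p → ∀ z ∈ Metric.ball (p : E) (ρ p / 3),
      z ∈ Metric.ball (q : E) (ρ q / 3) → g p z = g q z := by
    intro p q hpq z hzp hzq
    have hsub : Metric.ball (q : E) (ρ q / 3) ⊆ Metric.ball (p : E) (ρ p) := by
      refine Metric.ball_subset_ball' ?_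
      have h1 : dist (q : E) p ≤ dist z q + dist z p := dist_triangle_left _ _ _
      rw [Metric.mem_ball] at hzp hzq
      linarith
    have hsub' : Metric.ball (q : E) (ρ q / 3) ⊆ Metric.ball (q : E) (ρ q) :=
      Metric.ball_subset_ball (by linarith [hρ q])
    obtain ⟨y, hy, hyq⟩ := Metric.mem_closure_iff.1 q.2 (ρ q / 3) (by linarith [hρ q])
    rw [dist_comm] at hyq
    have hyq' : y ∈ Metric.ball (q : E) (ρ q / 3) := hyq
    have := sub_eq_sub_of_hasFDerivAt (Metric.isOpen_ball (x := (q : E)) (ε := ρ q / 3))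
      (convex_ball _ _).isPreconnected
      (fun x hx => hg p x (hsub hx)) (fun x hx => hg q x (hsub' hx)) hzq hyq'
    rw [hgχ p y ⟨hsub hyq', hy⟩, hgχ q y ⟨hsub' hyq', hy⟩] at this
    linarith
  have hcons : ∀ p q : closure Ω, ∀ z ∈ Metric.ball (p : E) (ρ p / 3),
      z ∈ Metric.ball (q : E) (ρ q / 3) → g p z = g q z := by
    intro p q z hp hq
    rcases le_total (ρ q) (ρ p) with h | h
    · exact hle p q h z hp hq
    · exact (hle q p h z hq hp).symm
  refine ⟨⋃ p : closure Ω, Metric.ball (p : E) (ρ p / 3),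
    isOpen_iUnion fun _ => Metric.isOpen_ball, fun x hx => Set.mem_iUnion.2
      ⟨⟨x, hx⟩, Metric.mem_ball_self (by linarith [hρ ⟨x, hx⟩])⟩, ?_⟩
  classical
  refine ⟨fun z => if h : ∃ p : closure Ω, z ∈ Metric.ball (p : E) (ρ p / 3)
    then g h.choose z else 0, fun x hx => ?_⟩
  obtain ⟨p, hp⟩ := Set.mem_iUnion.1 hx
  refine (hg p x (Metric.ball_subset_ball (by linarith [hρ p]) hp)).congr_of_eventuallyEq ?_
  filter_upwards [Metric.isOpen_ball.mem_nhds hp] with z hz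
  have hex : ∃ p : closure Ω, z ∈ Metric.ball (p : E) (ρ p / 3) := ⟨p, hz⟩
  rw [dif_pos hex]
  exact hcons _ _ z hex.choose_spec hz

end Primitive

/-- A closed `1`-form near the closure of a simply connected smooth domain has a primitive near the
closure. -/
theorem BoundaryParam.exists_primitive {Ω : Set Plane} (P : BoundaryParam Ω) (hΩ : IsOpen Ω)
    (hb : Bornology.IsBounded Ω) (hsc : SimplyConnectedSpace Ω) {V : Set Plane} (hV : IsOpen V)
    (hcl : closure Ω ⊆ V) {ω : Plane → Plane →L[ℝ] ℝ} (hω : DifferentiableOn ℝ ω V)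
    (hsymm : ∀ a ∈ V, ∀ x y, fderiv ℝ ω a x y = fderiv ℝ ω a y x) :
    ∃ W, IsOpen W ∧ closure Ω ⊆ W ∧ ∃ χ : Plane → ℝ, ∀ x ∈ W, HasFDerivAt χ (ω x) x := by
  have hΩV : Ω ⊆ V := subset_closure.trans hcl
  obtain ⟨χ₀, hχ₀⟩ := exists_primitive_of_simplyConnected hΩ hsc (hω.mono hΩV)
    fun a ha => hsymm a (hΩV ha)
  exact exists_primitive_near_closure hΩ hV hcl hω hsymm
    (fun x hx r hr => P.exists_isPreconnected hΩ hb hx hr) hχ₀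

theorem norm_sq_le_esq (z : Plane) : ‖z‖ ^ 2 ≤ esq z := by
  unfold esq
  rcases max_choice ‖z.1‖ ‖z.2‖ with h | h <;> rw [Prod.norm_def, h, Real.norm_eq_abs, sq_abs] <;>
    nlinarith [sq_nonneg z.1, sq_nonneg z.2]

theorem abs_fst_le_norm (z : Plane) : |z.1| ≤ ‖z‖ := norm_fst_le z

theorem abs_snd_le_norm (z : Plane) : |z.2| ≤ ‖z‖ := norm_snd_le z

theorem esq_nonneg (z : Plane) : 0 ≤ esq z := by unfold esq; positivity

theorem esq_le_norm_sq (z : Plane) : esq z ≤ 2 * ‖z‖ ^ 2 := by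
  unfold esq
  nlinarith [sq_abs z.1, sq_abs z.2, abs_fst_le_norm z, abs_snd_le_norm z, abs_nonneg z.1,
    abs_nonneg z.2]

theorem continuous_esq : Continuous esq := by unfold esq; fun_prop

/-- The coordinate `l` of the kernel `z / (2π|z|²)`. -/
def bsKernel (l : Plane → ℝ) (z : Plane) : ℝ := l z / (2 * Real.pi * esq z)

theorem abs_bsKernel_le {l : Plane → ℝ} (hl : ∀ z, |l z| ≤ ‖z‖) (z : Plane) :
    |bsKernel l z| ≤ ‖z‖⁻¹ := by
  unfold bsKernel
  rcases eq_or_ne z 0 with rfl | hz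
  · simp [esq]
  have hn : 0 < ‖z‖ := norm_pos_iff.2 hz
  have h1 := norm_sq_le_esq z
  have hpi := Real.pi_gt_three
  have he : 0 < esq z := lt_of_lt_of_le (by positivity) h1
  rw [abs_div, abs_of_pos (by positivity : 0 < 2 * Real.pi * esq z), div_le_iff₀ (by positivity),
    inv_mul_eq_div, le_div_iff₀ hn]
  nlinarith [hl z, abs_nonneg (l z)]

theorem measurable_bsKernel {l : Plane → ℝ} (hl : Continuous l) : Measurable (bsKernel l) := by
  unfold bsKernel
  exact hl.measurable.div (continuous_esq.measurable.const_mul _)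

theorem locallyIntegrable_bsKernel {l : Plane → ℝ} (hc : Continuous l) (hl : ∀ z, |l z| ≤ ‖z‖) :
    LocallyIntegrable (bsKernel l) (volume : Measure Plane) := by
  refine locallyIntegrable_of_norm_le_rpow (C := 1) (α := 1) (by simp) (by simp) ?_
    (measurable_bsKernel hc).aestronglyMeasurable
  refine Eventually.of_forall fun z => ?_
  rw [Real.norm_eq_abs, Real.rpow_neg_one, one_mul]
  exact abs_bsKernel_le hl z

theorem setIntegral_prod_swap_order {f : ℝ × ℝ → ℝ} {s t : Set ℝ}
    (hf : IntegrableOn f (s ×ˢ t)) :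
    ∫ z in s ×ˢ t, f z = ∫ y in t, ∫ x in s, f (x, y) := by
  have h : (volume : Measure (ℝ × ℝ)).restrict (s ×ˢ t) =
      ((volume : Measure ℝ).restrict s).prod ((volume : Measure ℝ).restrict t) := by
    rw [Measure.prod_restrict]; rfl
  rw [IntegrableOn, h] at hf
  rw [h, integral_prod_symm _ hf]

/-- The fundamental solution identity in the plane. -/
theorem integral_radial_derivative {β : Plane → ℝ} (hβ : ContDiff ℝ 1 β)
    (hc : HasCompactSupport β) (x : Plane) :
    ∫ t, fderiv ℝ β (x - t) t / esq t = 2 * Real.pi * β x := by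
  have hcs : ∀ p : ℝ × ℝ, polarCoord.symm p = (p.1 * Real.cos p.2, p.1 * Real.sin p.2) :=
    fun p => rfl
  set G : ℝ × ℝ → ℝ := fun p => fderiv ℝ β (x - (p.1 * Real.cos p.2, p.1 * Real.sin p.2))
    (Real.cos p.2, Real.sin p.2) with hG
  have hfc : Continuous (fderiv ℝ β) := hβ.continuous_fderiv (by simp)
  have hGc : Continuous G := by
    rw [hG]
    exact (hfc.comp (by fun_prop)).clm_apply (by fun_prop)
  obtain ⟨R, hRp, hR⟩ := hc.isCompact.isBounded.exists_pos_norm_lt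
  have hβ0 : ∀ z : Plane, R ≤ ‖z‖ → β z = 0 := fun z hz => by
    by_contra h
    exact absurd (hR z (subset_tsupport _ h)) (not_lt.2 hz)
  have hf0 : ∀ z : Plane, R ≤ ‖z‖ → fderiv ℝ β z = 0 := fun z hz => by
    by_contra h
    exact absurd (hR z (support_fderiv_subset ℝ h)) (not_lt.2 hz)
  have hfar : ∀ r θ : ℝ, 2 * (R + ‖x‖) < r → R ≤ ‖x - (r * Real.cos θ, r * Real.sin θ)‖ := by
    intro r θ hr
    have h1 := esq_le_norm_sq (r * Real.cos θ, r * Real.sin θ)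
    have h2 : esq (r * Real.cos θ, r * Real.sin θ) = r ^ 2 := by
      simp only [esq]; nlinarith [Real.sin_sq_add_cos_sq θ]
    have h3 : R + ‖x‖ ≤ ‖((r * Real.cos θ, r * Real.sin θ) : Plane)‖ := by
      rw [h2] at h1
      by_contra! h
      nlinarith [norm_nonneg ((r * Real.cos θ, r * Real.sin θ) : Plane), norm_nonneg x]
    have h4 := norm_sub_norm_le ((r * Real.cos θ, r * Real.sin θ) : Plane) x
    rw [norm_sub_rev] at h4
    linarith
  rw [← integral_comp_polarCoord_symm]
  have e1 : ∀ p ∈ polarCoord.target,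
      p.1 • (fderiv ℝ β (x - polarCoord.symm p) (polarCoord.symm p) / esq (polarCoord.symm p)) =
        G p := by
    intro p hp
    have hp1 : 0 < p.1 := hp.1
    have e : polarCoord.symm p = p.1 • ((Real.cos p.2, Real.sin p.2) : Plane) := by
      rw [hcs]; rfl
    have e2 : esq (polarCoord.symm p) = p.1 ^ 2 := by
      rw [hcs]; simp only [esq]; nlinarith [Real.sin_sq_add_cos_sq p.2]
    rw [e2, e, map_smul, ← e, hcs, smul_eq_mul, smul_eq_mul, hG]
    field_simp
  rw [setIntegral_congr_fun polarCoord.open_target.measurableSet e1]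
  have hint : IntegrableOn G (Ioi (0 : ℝ) ×ˢ Ioo (-Real.pi) Real.pi) := by
    have hK : IsCompact (Icc (0 : ℝ) (2 * (R + ‖x‖)) ×ˢ Icc (-Real.pi) Real.pi) :=
      isCompact_Icc.prod isCompact_Icc
    refine (hGc.continuousOn.integrableOn_compact hK).of_forall_sdiff_eq_zero
      (measurableSet_Ioi.prod measurableSet_Ioo) ?_
    rintro ⟨r, θ⟩ ⟨⟨hr, hθ⟩, hn⟩
    have : 2 * (R + ‖x‖) < r := by
      by_contra! h
      exact hn ⟨⟨le_of_lt hr, h⟩, Ioo_subset_Icc_self hθ⟩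
    simp only [hG]
    rw [hf0 _ (hfar r θ this)]; rfl
  change ∫ p in Ioi (0 : ℝ) ×ˢ Ioo (-Real.pi) Real.pi, G p = _
  rw [setIntegral_prod_swap_order hint]
  have hin : ∀ θ : ℝ, ∫ r in Ioi (0 : ℝ), G (r, θ) = β x := by
    intro θ
    set g : ℝ → ℝ := fun r => β (x - (r * Real.cos θ, r * Real.sin θ)) with hg
    have hgd : ContDiff ℝ 1 g := by
      rw [hg]; exact hβ.comp (by fun_prop)
    have hgs : HasCompactSupport g := by
      have : ∀ r, r ∉ Icc (-(2 * (R + ‖x‖))) (2 * (R + ‖x‖)) → g r = 0 := by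
        intro r hr
        apply hβ0
        rcases lt_or_ge (2 * (R + ‖x‖)) r with h | h
        · exact hfar r θ h
        · have h' : 2 * (R + ‖x‖) < -r := by
            by_contra! h2
            exact hr ⟨by linarith, h⟩
          have := hfar (-r) (θ + Real.pi) h'
          simpa [Real.cos_add_pi, Real.sin_add_pi] using this
      exact HasCompactSupport.intro isCompact_Icc this
    have hgder : ∀ r, deriv g r = -G (r, θ) := by
      intro r
      have h1 : HasDerivAt (fun r : ℝ => x - ((r * Real.cos θ, r * Real.sin θ) : Plane))
          (-((Real.cos θ, Real.sin θ) : Plane)) r := by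
        have := (((hasDerivAt_id r).mul_const (Real.cos θ)).prodMk
          ((hasDerivAt_id r).mul_const (Real.sin θ))).const_sub x
        simpa using this
      have h2 := ((hβ.differentiable (by simp)) (x - (r * Real.cos θ, r * Real.sin θ))).hasFDerivAt
      have h3 := h2.comp_hasDerivAt r h1
      rw [map_neg] at h3
      exact h3.deriv
    have := hgs.integral_Ioi_deriv_eq hgd 0
    simp only [hgder, integral_neg] at this
    have hg0 : g 0 = β x := by simp [hg, ← Prod.zero_eq_mk]
    linarith
  simp only [hin]
  rw [setIntegral_const, smul_eq_mul, Real.volume_real_Ioo_of_le (by linarith [Real.pi_pos])]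
  ring

/-- The Biot–Savart potential of `β`. -/
def biotSavart (β : Plane → ℝ) (x : Plane) : Plane :=
  (∫ t, bsKernel (fun z => -z.2) t * β (x - t), ∫ t, bsKernel Prod.fst t * β (x - t))

theorem locallyIntegrable_bsKernel_snd :
    LocallyIntegrable (bsKernel fun z => -z.2) (volume : Measure Plane) :=
  locallyIntegrable_bsKernel (by fun_prop) fun z => by rw [abs_neg]; exact abs_snd_le_norm z

theorem locallyIntegrable_bsKernel_fst :
    LocallyIntegrable (bsKernel Prod.fst) (volume : Measure Plane) :=
  locallyIntegrable_bsKernel (by fun_prop) abs_fst_le_norm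

open scoped Convolution in
theorem contDiff_integral_kernel {K β : Plane → ℝ} (hK : LocallyIntegrable K volume)
    (hβ : ContDiff ℝ 1 β) (hc : HasCompactSupport β) :
    ContDiff ℝ 1 fun x => ∫ t, K t * β (x - t) :=
  hc.contDiff_convolution_right (n := 1) (ContinuousLinearMap.mul ℝ ℝ) hK hβ

open scoped Convolution in
theorem fderiv_integral_kernel {K β : Plane → ℝ} (hK : LocallyIntegrable K volume)
    (hβ : ContDiff ℝ 1 β) (hc : HasCompactSupport β) (x v : Plane) :
    fderiv ℝ (fun x => ∫ t, K t * β (x - t)) x v = ∫ t, K t * fderiv ℝ β (x - t) v := by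
  have h := hc.hasFDerivAt_convolution_right (ContinuousLinearMap.mul ℝ ℝ) hK hβ x
  have h2 : fderiv ℝ (fun x => ∫ t, K t * β (x - t)) x = _ := h.fderiv
  rw [h2, convolution_precompR_apply _ hK (hc.fderiv ℝ) (hβ.continuous_fderiv (by simp))]
  rfl

theorem integrable_kernel_mul {K g : Plane → ℝ} (hK : LocallyIntegrable K volume)
    (hg : Continuous g) (hc : HasCompactSupport g) (x : Plane) :
    Integrable fun t => K t * g (x - t) :=
  (hc.convolutionExists_right (ContinuousLinearMap.mul ℝ ℝ) hK hg) x

theorem contDiff_biotSavart {β : Plane → ℝ} (hβ : ContDiff ℝ 1 β) (hc : HasCompactSupport β) :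
    ContDiff ℝ 1 (biotSavart β) :=
  (contDiff_integral_kernel locallyIntegrable_bsKernel_snd hβ hc).prodMk
    (contDiff_integral_kernel locallyIntegrable_bsKernel_fst hβ hc)

theorem curl2_biotSavart {β : Plane → ℝ} (hβ : ContDiff ℝ 1 β) (hc : HasCompactSupport β)
    (x : Plane) : curl2 (biotSavart β) x = β x := by
  have hd : ∀ v, Continuous fun z => fderiv ℝ β z v := fun v =>
    (hβ.continuous_fderiv (by simp)).clm_apply continuous_const
  have hdc : ∀ v, HasCompactSupport fun z => fderiv ℝ β z v := fun v => hc.fderiv_apply ℝ v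
  have h1 := fderiv_integral_kernel locallyIntegrable_bsKernel_fst hβ hc x (1, 0)
  have h2 := fderiv_integral_kernel locallyIntegrable_bsKernel_snd hβ hc x (0, 1)
  unfold curl2
  simp only [biotSavart]
  rw [h1, h2, ← integral_sub (integrable_kernel_mul locallyIntegrable_bsKernel_fst (hd _) (hdc _) x)
    (integrable_kernel_mul locallyIntegrable_bsKernel_snd (hd _) (hdc _) x)]
  have h3 := integral_radial_derivative hβ hc x
  have e : ∀ t : Plane, bsKernel Prod.fst t * fderiv ℝ β (x - t) (1, 0) -
      bsKernel (fun z => -z.2) t * fderiv ℝ β (x - t) (0, 1) =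
      (2 * Real.pi)⁻¹ * (fderiv ℝ β (x - t) t / esq t) := by
    intro t
    have ht : t = t.1 • ((1, 0) : Plane) + t.2 • ((0, 1) : Plane) := by
      ext <;> simp
    have : fderiv ℝ β (x - t) t = t.1 * fderiv ℝ β (x - t) (1, 0) +
        t.2 * fderiv ℝ β (x - t) (0, 1) := by
      conv_lhs => rw [ht]
      rw [map_add, map_smul, map_smul, ← ht]; rfl
    rw [this]
    unfold bsKernel
    rcases eq_or_ne (esq t) 0 with h0 | h0
    · simp [h0]
    · field_simp
      ring
  simp only [e]
  rw [integral_const_mul, h3]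
  field_simp

open scoped ENNReal in
theorem lintegral_mul_sq_le {f g : Plane → ℝ≥0∞} (hf : Measurable f) (hg : Measurable g) :
    (∫⁻ x, f x * g x) ^ 2 ≤ (∫⁻ x, f x ^ 2) * ∫⁻ x, g x ^ 2 := by
  have h := ENNReal.lintegral_mul_le_Lp_mul_Lq volume Real.HolderConjugate.two_two
    hf.aemeasurable hg.aemeasurable
  have h2 := pow_le_pow_left₀ zero_le h 2
  refine h2.trans (le_of_eq ?_)
  rw [mul_pow, ← ENNReal.rpow_natCast, ← ENNReal.rpow_natCast, ← ENNReal.rpow_mul,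
    ← ENNReal.rpow_mul]
  simp

open scoped ENNReal in
/-- A special case of Young's convolution inequality. -/
theorem lintegral_conv_pow_four_le {h b : Plane → ℝ≥0∞} (hh : Measurable h) (hb : Measurable b) :
    ∫⁻ x, (∫⁻ y, h (x - y) ^ 3 * b y) ^ 4 ≤ (∫⁻ z, h z ^ 4) ^ 3 * (∫⁻ y, b y ^ 2) ^ 2 := by
  have hm : ∀ x, Measurable fun y => h (x - y) := fun x =>
    hh.comp (measurable_const.sub measurable_id)
  have hm2 : Measurable fun p : Plane × Plane => h (p.1 - p.2) :=
    hh.comp (measurable_fst.sub measurable_snd)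
  set S := ∫⁻ z, h z ^ 4 with hS
  set T := ∫⁻ y, b y ^ 2 with hT
  have hSx : ∀ x, ∫⁻ y, h (x - y) ^ 4 = S := fun x =>
    lintegral_sub_left_eq_self (fun z => h z ^ 4) x
  have hSy : ∀ y, ∫⁻ x, h (x - y) ^ 4 = S := fun y =>
    lintegral_sub_right_eq_self (fun z => h z ^ 4) y
  have key : ∀ x, (∫⁻ y, h (x - y) ^ 3 * b y) ^ 4 ≤
      S ^ 2 * (T * ∫⁻ y, h (x - y) ^ 4 * b y ^ 2) := by
    intro x
    have h1 : (∫⁻ y, h (x - y) ^ 3 * b y) ^ 2 ≤ S * ∫⁻ y, (h (x - y) * b y) ^ 2 := by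
      have := lintegral_mul_sq_le ((hm x).pow_const 2) ((hm x).mul hb)
      simp only [← pow_mul, hSx] at this
      refine le_trans (le_of_eq ?_) this
      congr 2; ext y; simp only [Pi.mul_apply]; ring
    have h2 : (∫⁻ y, (h (x - y) * b y) ^ 2) ^ 2 ≤ (∫⁻ y, h (x - y) ^ 4 * b y ^ 2) * T := by
      have := lintegral_mul_sq_le (((hm x).pow_const 2).mul hb) hb
      refine le_trans (le_of_eq ?_) (this.trans (le_of_eq ?_))
      · congr 2; ext y; simp only [Pi.mul_apply]; ring
      · congr 2; ext y; simp only [Pi.mul_apply]; ring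
    calc (∫⁻ y, h (x - y) ^ 3 * b y) ^ 4 = ((∫⁻ y, h (x - y) ^ 3 * b y) ^ 2) ^ 2 := by ring
      _ ≤ (S * ∫⁻ y, (h (x - y) * b y) ^ 2) ^ 2 := pow_le_pow_left₀ zero_le h1 2
      _ = S ^ 2 * (∫⁻ y, (h (x - y) * b y) ^ 2) ^ 2 := by ring
      _ ≤ S ^ 2 * ((∫⁻ y, h (x - y) ^ 4 * b y ^ 2) * T) := by gcongr
      _ = _ := by ring
  have hmF : Measurable fun p : Plane × Plane => h (p.1 - p.2) ^ 4 * b p.2 ^ 2 :=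
    (hm2.pow_const 4).mul ((hb.comp measurable_snd).pow_const 2)
  refine (lintegral_mono key).trans ?_
  rw [lintegral_const_mul _ ((Measurable.lintegral_prod_right hmF).const_mul _),
    lintegral_const_mul _ (Measurable.lintegral_prod_right hmF),
    lintegral_lintegral_swap hmF.aemeasurable]
  have : ∀ y, ∫⁻ x, h (x - y) ^ 4 * b y ^ 2 = S * b y ^ 2 := fun y => by
    rw [lintegral_mul_const _ (f := fun x => h (x - y) ^ 4)
      ((hh.comp (measurable_id.sub_const y)).pow_const 4), hSy]
  simp only [this]
  rw [lintegral_const_mul _ (hb.pow_const 2)]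
  exact le_of_eq (by ring)

open scoped ENNReal in
theorem exists_biotSavart_bound (R : ℝ) : ∃ C > 0, ∀ β : Plane → ℝ, ContDiff ℝ 1 β →
    HasCompactSupport β → Function.support β ⊆ Metric.ball 0 R →
    ∫ x in Metric.ball 0 R, esq (biotSavart β x) ^ 2 ≤ C * (∫ x, β x ^ 2) ^ 2 := by
  set h : Plane → ℝ≥0∞ := (Metric.ball 0 (2 * R)).indicator
    fun z => ENNReal.ofReal (‖z‖ ^ (-(1 / 3) : ℝ)) with hh
  have hm : Measurable h :=
    (ENNReal.measurable_ofReal.comp (measurable_norm.pow_const _)).indicator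
      Metric.isOpen_ball.measurableSet
  have hS : ∫⁻ z, h z ^ 4 ≠ ⊤ := by
    have h1 : IntegrableOn (fun z : Plane => ‖z‖ ^ (-(4 / 3) : ℝ)) (Metric.ball 0 (2 * R)) := by
      refine integrableOn_ball_of_norm_le_rpow (C := 1) (α := 4 / 3) (by simp) (by norm_num) ?_
        (measurable_norm.pow_const _).aestronglyMeasurable
      refine Eventually.of_forall fun z => ?_
      rw [one_mul, Real.norm_of_nonneg (by positivity)]
    have h2 : ∫⁻ z, h z ^ 4 = ∫⁻ z in Metric.ball (0 : Plane) (2 * R),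
        ENNReal.ofReal (‖z‖ ^ (-(4 / 3) : ℝ)) := by
      rw [← lintegral_indicator Metric.isOpen_ball.measurableSet]
      congr 1; ext z
      by_cases hz : z ∈ Metric.ball (0 : Plane) (2 * R)
      · rw [hh, indicator_of_mem hz, indicator_of_mem hz, ← ENNReal.ofReal_pow (by positivity),
          ← Real.rpow_natCast, ← Real.rpow_mul (norm_nonneg z)]
        norm_num
      · rw [hh, indicator_of_notMem hz, indicator_of_notMem hz]; simp
    rw [h2]
    exact h1.lintegral_lt_top.ne
  set S := (∫⁻ z, h z ^ 4).toReal with hSdef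
  refine ⟨4 * S ^ 3 + 1, by positivity, fun β hβ hc hs => ?_⟩
  set b : Plane → ℝ≥0∞ := fun y => ‖β y‖ₑ with hb
  have hbm : Measurable b := hβ.continuous.measurable.enorm
  have hint2 : Integrable fun x => β x ^ 2 :=
    (hβ.continuous.pow 2).integrable_of_hasCompactSupport
      (by simpa [pow_two] using hc.mul_left (f := β))
  have hT : ∫⁻ y, b y ^ 2 = ENNReal.ofReal (∫ x, β x ^ 2) := by
    rw [ofReal_integral_eq_lintegral_ofReal hint2 (Eventually.of_forall fun x => by positivity)]
    congr 1; ext y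
    change ‖β y‖ₑ ^ 2 = _
    rw [← ofReal_norm, ← ENNReal.ofReal_pow (norm_nonneg _), Real.norm_eq_abs, sq_abs]
  have hker : ∀ l : Plane → ℝ, (∀ z, |l z| ≤ ‖z‖) → ∀ x ∈ Metric.ball (0 : Plane) R,
      ‖∫ t, bsKernel l t * β (x - t)‖ₑ ≤ ∫⁻ y, h (x - y) ^ 3 * b y := by
    intro l hl x hx
    rw [← integral_sub_left_eq_self _ volume x]
    refine (enorm_integral_le_lintegral_enorm _).trans (lintegral_mono fun y => ?_)
    rw [sub_sub_cancel]
    rcases eq_or_ne (β y) 0 with h0 | h0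
    · simp [h0]
    have hy : y ∈ Metric.ball (0 : Plane) R := hs h0
    have hxy : x - y ∈ Metric.ball (0 : Plane) (2 * R) := by
      rw [mem_ball_zero_iff] at *
      linarith [norm_sub_le x y]
    rw [enorm_mul]
    refine mul_le_mul' ?_ le_rfl
    rw [hh, indicator_of_mem hxy, ← ENNReal.ofReal_pow (by positivity), ← ofReal_norm]
    refine ENNReal.ofReal_le_ofReal ?_
    rw [← Real.rpow_natCast, ← Real.rpow_mul (norm_nonneg _), Real.norm_eq_abs]
    norm_num
    rw [Real.rpow_neg_one]
    exact abs_bsKernel_le hl _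
  have hpt : ∀ x ∈ Metric.ball (0 : Plane) R, ENNReal.ofReal (esq (biotSavart β x) ^ 2) ≤
      4 * (∫⁻ y, h (x - y) ^ 3 * b y) ^ 4 := by
    intro x hx
    have h1 := hker (fun z => -z.2) (fun z => by rw [abs_neg]; exact abs_snd_le_norm z) x hx
    have h2 := hker Prod.fst abs_fst_le_norm x hx
    have e : ENNReal.ofReal (esq (biotSavart β x)) =
        ‖(biotSavart β x).1‖ₑ ^ 2 + ‖(biotSavart β x).2‖ₑ ^ 2 := by
      rw [← ofReal_norm, ← ofReal_norm, ← ENNReal.ofReal_pow (norm_nonneg _),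
        ← ENNReal.ofReal_pow (norm_nonneg _), ← ENNReal.ofReal_add (by positivity) (by positivity),
        Real.norm_eq_abs, Real.norm_eq_abs, sq_abs, sq_abs]
      rfl
    rw [ENNReal.ofReal_pow (esq_nonneg _), e]
    set m := ∫⁻ y, h (x - y) ^ 3 * b y
    calc (‖(biotSavart β x).1‖ₑ ^ 2 + ‖(biotSavart β x).2‖ₑ ^ 2) ^ 2 ≤ (m ^ 2 + m ^ 2) ^ 2 := by
          gcongr
          · exact h1
          · exact h2
      _ = 4 * m ^ 4 := by ring
  have hc2 : Continuous fun x => esq (biotSavart β x) ^ 2 :=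
    (continuous_esq.comp (contDiff_biotSavart hβ hc).continuous).pow 2
  rw [integral_eq_lintegral_of_nonneg_ae (Eventually.of_forall fun x => by positivity)
    hc2.aestronglyMeasurable]
  have hfin : ∫⁻ x in Metric.ball (0 : Plane) R, ENNReal.ofReal (esq (biotSavart β x) ^ 2) ≤
      4 * ((∫⁻ z, h z ^ 4) ^ 3 * ENNReal.ofReal (∫ x, β x ^ 2) ^ 2) := by
    calc _ ≤ ∫⁻ x in Metric.ball (0 : Plane) R, 4 * (∫⁻ y, h (x - y) ^ 3 * b y) ^ 4 :=
          setLIntegral_mono' Metric.isOpen_ball.measurableSet hpt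
      _ ≤ ∫⁻ x, 4 * (∫⁻ y, h (x - y) ^ 3 * b y) ^ 4 := setLIntegral_le_lintegral _ _
      _ = 4 * ∫⁻ x, (∫⁻ y, h (x - y) ^ 3 * b y) ^ 4 := lintegral_const_mul' _ _ (by simp)
      _ ≤ _ := by
        rw [← hT]
        exact mul_le_mul' le_rfl (lintegral_conv_pow_four_le hm hbm)
  have hI : 0 ≤ ∫ x, β x ^ 2 := integral_nonneg fun x => by positivity
  refine (ENNReal.toReal_mono ?_ hfin).trans ?_
  · exact ENNReal.mul_ne_top (by simp) (ENNReal.mul_ne_top (ENNReal.pow_ne_top hS) (by simp))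
  · rw [ENNReal.toReal_mul, ENNReal.toReal_mul, ENNReal.toReal_pow, ENNReal.toReal_pow,
      ENNReal.toReal_ofReal hI, ← hSdef]
    have : ENNReal.toReal 4 = 4 := by norm_num
    rw [this]
    nlinarith [sq_nonneg (∫ x, β x ^ 2)]

open scoped Manifold ContDiff in
theorem exists_cutoff {K U : Set Plane} (hK : IsCompact K) (hU : IsOpen U) (hKU : K ⊆ U) :
    ∃ θ : Plane → ℝ, ContDiff ℝ ∞ θ ∧ HasCompactSupport θ ∧ tsupport θ ⊆ U ∧
      (∃ V, IsOpen V ∧ K ⊆ V ∧ ∀ x ∈ V, θ x = 1) ∧ ∀ x, θ x ∈ Icc (0 : ℝ) 1 := by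
  obtain ⟨K', hK', h1, h2⟩ := exists_compact_between hK hU hKU
  obtain ⟨f, hf1, hf0, hf⟩ := exists_contMDiffMap_one_nhds_of_subset_interior (n := (⊤ : ℕ∞))
    𝓘(ℝ, Plane) hK.isClosed h1
  have hts : tsupport f ⊆ K' :=
    closure_minimal (fun x hx => by
      by_contra h
      exact hx (hf0 x h)) hK'.isClosed
  obtain ⟨V, hV, hKV, hV1⟩ := eventually_nhdsSet_iff_exists.1 hf1
  exact ⟨f, contMDiff_iff_contDiff.1 f.contMDiff, HasCompactSupport.of_support_subset_isCompact hK'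
    (subset_closure.trans hts), hts.trans h2, ⟨V, hV, hKV, hV1⟩, hf⟩

/-- A function of class `C¹` near a compact closure extends to a compactly supported one. -/
theorem CNearCl.exists_extension {E : Type*} [NormedAddCommGroup E] [NormedSpace ℝ E]
    {Ω : Set Plane} (hb : Bornology.IsBounded Ω) {f : Plane → E} (hf : CNearCl 1 Ω f) :
    ∃ g : Plane → E, ContDiff ℝ 1 g ∧ HasCompactSupport g ∧
      ∀ x ∈ closure Ω, g =ᶠ[𝓝 x] f := by
  obtain ⟨U, hU, hcl, hfU⟩ := hf
  obtain ⟨θ, hθ, hθc, hθU, ⟨V, hV, hKV, hV1⟩, -⟩ := exists_cutoff hb.isCompact_closure hU hcl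
  refine ⟨fun x => θ x • f x, ?_, hθc.smul_right, fun x hx => ?_⟩
  · rw [contDiff_iff_contDiffAt]
    intro x
    by_cases hx : x ∈ U
    · exact ((hθ.of_le (by exact_mod_cast le_top)).contDiffAt).smul
        (hfU.contDiffAt (hU.mem_nhds hx))
    · have hx' : x ∉ tsupport θ := fun h => hx (hθU h)
      have : (fun x => θ x • f x) =ᶠ[𝓝 x] fun _ => 0 := by
        filter_upwards [(isClosed_tsupport θ).isOpen_compl.mem_nhds hx'] with y hy
        rw [image_eq_zero_of_notMem_tsupport hy, zero_smul]
      exact contDiffAt_const.congr_of_eventuallyEq this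
  · filter_upwards [hV.mem_nhds (hKV hx)] with y hy
    rw [hV1 y hy, one_smul]

open scoped Convolution ContDiff in
theorem exists_smooth_seq {E : Type*} [NormedAddCommGroup E] [NormedSpace ℝ E]
    [FiniteDimensional ℝ E] {Ω : Set Plane} (hb : Bornology.IsBounded Ω) {f : Plane → E}
    (hf : CNearCl 1 Ω f) :
    ∃ (g : ℕ → Plane → E) (M : ℝ), (∀ n, ContDiff ℝ ∞ (g n)) ∧
      (∀ n x, ‖g n x‖ ≤ M ∧ ‖fderiv ℝ (g n) x‖ ≤ M) ∧
      ∀ x ∈ closure Ω, Tendsto (fun n => g n x) atTop (𝓝 (f x)) ∧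
        Tendsto (fun n => fderiv ℝ (g n) x) atTop (𝓝 (fderiv ℝ f x)) := by
  have := FiniteDimensional.complete ℝ E
  obtain ⟨h, hh, hc, hfh⟩ := hf.exists_extension hb
  set φ : ℕ → ContDiffBump (0 : Plane) := fun n =>
    ⟨1 / (n + 1 : ℝ) / 2, 1 / (n + 1 : ℝ), by positivity, half_lt_self (by positivity)⟩ with hφ
  have hφ0 : Tendsto (fun n => (φ n).rOut) atTop (𝓝 0) := tendsto_one_div_add_atTop_nhds_zero_nat
  have hcf : Continuous (fderiv ℝ h) := hh.continuous_fderiv (by simp)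
  obtain ⟨M₁, hM₁⟩ := hc.exists_bound_of_continuous hh.continuous
  obtain ⟨M₂, hM₂⟩ := (hc.fderiv ℝ).exists_bound_of_continuous hcf
  have hφi : ∀ n, LocallyIntegrable ((φ n).normed volume) (volume : Measure Plane) := fun n =>
    (φ n).continuous_normed.locallyIntegrable
  have hfd : ∀ n x, fderiv ℝ ((φ n).normed volume ⋆[ContinuousLinearMap.lsmul ℝ ℝ] h) x =
      ((φ n).normed volume ⋆[ContinuousLinearMap.lsmul ℝ ℝ] fderiv ℝ h) x := by
    intro n x
    rw [(hc.hasFDerivAt_convolution_right (ContinuousLinearMap.lsmul ℝ ℝ) (hφi n) hh x).fderiv]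
    refine integral_congr_ae (Eventually.of_forall fun t => ?_)
    exact ContinuousLinearMap.ext fun v => rfl
  have hbd : ∀ {F : Type _} [NormedAddCommGroup F] [NormedSpace ℝ F] (n : ℕ) (k : Plane → F)
      (M : ℝ) (_ : ∀ x, ‖k x‖ ≤ M) (x : Plane),
      ‖((φ n).normed volume ⋆[ContinuousLinearMap.lsmul ℝ ℝ] k) x‖ ≤ M := by
    intro F _ _ n k M hk x
    refine (norm_integral_le_of_norm_le ((φ n).integrable_normed.mul_const M)
      (Eventually.of_forall fun t => ?_)).trans (le_of_eq ?_)
    · rw [ContinuousLinearMap.lsmul_apply, norm_smul, Real.norm_of_nonneg ((φ n).nonneg_normed t)]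
      exact mul_le_mul_of_nonneg_left (hk _) ((φ n).nonneg_normed t)
    · rw [integral_mul_const, (φ n).integral_normed, one_mul]
  refine ⟨fun n => (φ n).normed volume ⋆[ContinuousLinearMap.lsmul ℝ ℝ] h, max M₁ M₂,
    fun n => ?_, fun n x => ⟨?_, ?_⟩, fun x hx => ⟨?_, ?_⟩⟩
  · exact (φ n).hasCompactSupport_normed.contDiff_convolution_left _ (φ n).contDiff_normed
      hh.continuous.locallyIntegrable
  · exact (hbd n h M₁ hM₁ x).trans (le_max_left _ _)
  · rw [hfd]
    exact (hbd n _ M₂ hM₂ x).trans (le_max_right _ _)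
  · rw [← (hfh x hx).eq_of_nhds]
    exact ContDiffBump.convolution_tendsto_right_of_continuous hφ0 hh.continuous x
  · rw [← (hfh x hx).fderiv_eq]
    simp only [hfd]
    exact ContDiffBump.convolution_tendsto_right_of_continuous hφ0 hcf x

/-- Dominated convergence for a continuous function of a bounded sequence of jets. -/
theorem tendsto_integral_comp_of_bounded {V : Type*} [NormedAddCommGroup V] [NormedSpace ℝ V]
    [FiniteDimensional ℝ V] {Ω : Set Plane} (hΩ : IsOpen Ω) (hb : Bornology.IsBounded Ω)
    {J : ℕ → Plane → V} {J₀ : Plane → V} {M : ℝ} (hJc : ∀ n, Continuous (J n))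
    (hJ : ∀ n x, ‖J n x‖ ≤ M) (hlim : ∀ x ∈ Ω, Tendsto (fun n => J n x) atTop (𝓝 (J₀ x)))
    {p : V → ℝ} (hp : Continuous p) :
    Tendsto (fun n => ∫ x in Ω, p (J n x)) atTop (𝓝 (∫ x in Ω, p (J₀ x))) := by
  have := FiniteDimensional.proper_real V
  obtain ⟨C, hC⟩ := (isCompact_closedBall (0 : V) M).exists_bound_of_continuousOn hp.continuousOn
  refine tendsto_integral_of_dominated_convergence (fun _ => C)
    (fun n => (hp.comp (hJc n)).aestronglyMeasurable) ?_ (fun n => ?_) ?_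
  · exact integrableOn_const (hb.measure_lt_top.ne)
  · exact Eventually.of_forall fun x => hC _ (mem_closedBall_zero_iff.2 (hJ n x))
  · exact (ae_restrict_iff' hΩ.measurableSet).2 (Eventually.of_forall fun x hx =>
      (hp.tendsto _).comp (hlim x hx))

/-- The jet `(ψ, Dψ, A, DA)` of a configuration. -/
abbrev GLJet := ℂ × (Plane →L[ℝ] ℂ) × Plane × (Plane →L[ℝ] Plane)

/-- The Ginzburg–Landau density as a function of the jet of the configuration. -/
def glDensity (κ H : ℝ) (v : GLJet) : ℝ :=
  (‖(-Complex.I) * v.2.1 ((1 : ℝ), (0 : ℝ)) - ((κ * H * v.2.2.1.1 : ℝ) : ℂ) * v.1‖ ^ 2 +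
    ‖(-Complex.I) * v.2.1 ((0 : ℝ), (1 : ℝ)) - ((κ * H * v.2.2.1.2 : ℝ) : ℂ) * v.1‖ ^ 2)
    - κ ^ 2 * ‖v.1‖ ^ 2 + κ ^ 2 / 2 * ‖v.1‖ ^ 4
    + κ ^ 2 * H ^ 2 *
      ((v.2.2.2 ((1 : ℝ), (0 : ℝ))).2 - (v.2.2.2 ((0 : ℝ), (1 : ℝ))).1 - 1) ^ 2

theorem continuous_glDensity (κ H : ℝ) : Continuous (glDensity κ H) := by
  unfold glDensity
  have h1 : Continuous fun v : GLJet => v.2.1 ((1 : ℝ), (0 : ℝ)) :=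
    (continuous_fst.comp continuous_snd).clm_apply continuous_const
  have h2 : Continuous fun v : GLJet => v.2.1 ((0 : ℝ), (1 : ℝ)) :=
    (continuous_fst.comp continuous_snd).clm_apply continuous_const
  have h3 : Continuous fun v : GLJet => v.2.2.2 ((1 : ℝ), (0 : ℝ)) :=
    (continuous_snd.comp (continuous_snd.comp continuous_snd)).clm_apply continuous_const
  have h4 : Continuous fun v : GLJet => v.2.2.2 ((0 : ℝ), (1 : ℝ)) :=
    (continuous_snd.comp (continuous_snd.comp continuous_snd)).clm_apply continuous_const
  have h5 : Continuous fun v : GLJet => ((κ * H * v.2.2.1.1 : ℝ) : ℂ) :=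
    Complex.continuous_ofReal.comp (by fun_prop)
  have h6 : Continuous fun v : GLJet => ((κ * H * v.2.2.1.2 : ℝ) : ℂ) :=
    Complex.continuous_ofReal.comp (by fun_prop)
  fun_prop

theorem curl2_eq_of_differentiableAt {A : Plane → Plane} {x : Plane}
    (hA : DifferentiableAt ℝ A x) :
    curl2 A x = (fderiv ℝ A x (1, 0)).2 - (fderiv ℝ A x (0, 1)).1 := by
  unfold curl2
  rw [fderiv.snd hA, fderiv.fst hA]
  rfl

theorem CNearCl.differentiableAt {E : Type*} [NormedAddCommGroup E] [NormedSpace ℝ E]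
    {Ω : Set Plane} {f : Plane → E} (hf : CNearCl 1 Ω f) {x : Plane} (hx : x ∈ closure Ω) :
    DifferentiableAt ℝ f x := by
  obtain ⟨U, hU, hcl, hfU⟩ := hf
  exact (hfU.contDiffAt (hU.mem_nhds (hcl hx))).differentiableAt (by simp)

theorem cNearCl_of_contDiff {E : Type*} [NormedAddCommGroup E] [NormedSpace ℝ E]
    {Ω : Set Plane} {f : Plane → E} (hf : ContDiff ℝ 1 f) : CNearCl 1 Ω f :=
  ⟨univ, isOpen_univ, subset_univ _, hf.contDiffOn⟩

theorem GLenergy_eq_integral_glDensity {Ω : Set Plane} (hΩ : IsOpen Ω) (κ H : ℝ)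
    {ψ : Plane → ℂ} {A : Plane → Plane} (hA : CNearCl 1 Ω A) :
    GLenergy Ω κ H ψ A =
      ∫ x in Ω, glDensity κ H (ψ x, fderiv ℝ ψ x, A x, fderiv ℝ A x) := by
  refine setIntegral_congr_fun hΩ.measurableSet fun x hx => ?_
  rw [curl2_eq_of_differentiableAt (hA.differentiableAt (subset_closure hx))]
  rfl

open scoped ContDiff in
/-- A quartic lower bound for the energy extends from smooth to all admissible configurations. -/
theorem le_GLenergy_of_smooth {Ω : Set Plane} (hΩ : IsOpen Ω) (hb : Bornology.IsBounded Ω)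
    {κ H c : ℝ} (h : ∀ (ψ : Plane → ℂ) (A : Plane → Plane), ContDiff ℝ ∞ ψ → ContDiff ℝ ∞ A →
      c * ∫ x in Ω, ‖ψ x‖ ^ 4 ≤ GLenergy Ω κ H ψ A)
    {ψ : Plane → ℂ} {A : Plane → Plane} (hψA : GLadm Ω ψ A) :
    c * ∫ x in Ω, ‖ψ x‖ ^ 4 ≤ GLenergy Ω κ H ψ A := by
  obtain ⟨p, M₁, hp, hpM, hpl⟩ := exists_smooth_seq hb hψA.1
  obtain ⟨a, M₂, ha, haM, hal⟩ := exists_smooth_seq hb hψA.2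
  have hp1 : ∀ n, ContDiff ℝ 1 (p n) := fun n => (hp n).of_le (by exact_mod_cast le_top)
  have ha1 : ∀ n, ContDiff ℝ 1 (a n) := fun n => (ha n).of_le (by exact_mod_cast le_top)
  have hlim : ∀ P : GLJet → ℝ, Continuous P → Tendsto
      (fun n => ∫ x in Ω, P (p n x, fderiv ℝ (p n) x, a n x, fderiv ℝ (a n) x)) atTop
      (𝓝 (∫ x in Ω, P (ψ x, fderiv ℝ ψ x, A x, fderiv ℝ A x))) := by
    intro P hP
    refine tendsto_integral_comp_of_bounded (M := max M₁ M₂) hΩ hb (fun n => ?_) (fun n x => ?_)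
      (fun x hx => ?_) hP
    · exact (hp1 n).continuous.prodMk (((hp1 n).continuous_fderiv (by simp)).prodMk
        ((ha1 n).continuous.prodMk ((ha1 n).continuous_fderiv (by simp))))
    · simp only [Prod.norm_def]
      exact max_le ((hpM n x).1.trans (le_max_left _ _)) (max_le ((hpM n x).2.trans
        (le_max_left _ _)) (max_le ((haM n x).1.trans (le_max_right _ _))
          ((haM n x).2.trans (le_max_right _ _))))
    · have h1 := hpl x (subset_closure hx)
      have h2 := hal x (subset_closure hx)
      exact h1.1.prodMk_nhds (h1.2.prodMk_nhds (h2.1.prodMk_nhds h2.2))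
  have l1 := hlim (glDensity κ H) (continuous_glDensity κ H)
  have l2 := (hlim (fun v => ‖v.1‖ ^ 4) (by fun_prop)).const_mul c
  rw [GLenergy_eq_integral_glDensity hΩ κ H hψA.2]
  refine le_of_tendsto_of_tendsto' l2 l1 fun n => ?_
  rw [← GLenergy_eq_integral_glDensity hΩ κ H (cNearCl_of_contDiff (ha1 n))]
  exact h _ _ (hp n) (ha n)

theorem integral_mul_fderiv_of_hasCompactSupport {f g : Plane → ℝ} (hf : ContDiff ℝ 1 f)
    (hg : ContDiff ℝ 1 g) (hc : HasCompactSupport g) (v : Plane) :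
    ∫ x, f x * fderiv ℝ g x v = -∫ x, fderiv ℝ f x v * g x := by
  have h1 : Continuous fun x => fderiv ℝ f x v :=
    (hf.continuous_fderiv (by simp)).clm_apply continuous_const
  have h2 : Continuous fun x => fderiv ℝ g x v :=
    (hg.continuous_fderiv (by simp)).clm_apply continuous_const
  refine integral_mul_fderiv_eq_neg_fderiv_mul_of_integrable ?_ ?_ ?_ ?_ ?_
  · exact (h1.mul hg.continuous).integrable_of_hasCompactSupport hc.mul_left
  · exact (hf.continuous.mul h2).integrable_of_hasCompactSupport (hc.fderiv_apply ℝ v).mul_left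
  · exact (hf.continuous.mul hg.continuous).integrable_of_hasCompactSupport hc.mul_left
  · exact fun x _ => hf.differentiable (by simp) x
  · exact fun x _ => hg.differentiable (by simp) x

theorem hasFDerivAt_re {u : Plane → ℂ} {x : Plane} (hu : DifferentiableAt ℝ u x) (v : Plane) :
    fderiv ℝ (fun y => (u y).re) x v = (fderiv ℝ u x v).re := by
  have := (Complex.reCLM.hasFDerivAt.comp x hu.hasFDerivAt).fderiv
  exact congrArg (fun L => L v) this

theorem hasFDerivAt_im {u : Plane → ℂ} {x : Plane} (hu : DifferentiableAt ℝ u x) (v : Plane) :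
    fderiv ℝ (fun y => (u y).im) x v = (fderiv ℝ u x v).im := by
  have := (Complex.imCLM.hasFDerivAt.comp x hu.hasFDerivAt).fderiv
  exact congrArg (fun L => L v) this

theorem continuous_magSq {B : ℝ} {A : Plane → Plane} {u : Plane → ℂ} (hu : ContDiff ℝ 1 u)
    (hA : Continuous A) : Continuous (magSq B A u) := by
  have h1 : ∀ v, Continuous fun x => fderiv ℝ u x v := fun v =>
    (hu.continuous_fderiv (by simp)).clm_apply continuous_const
  have h2 : Continuous fun x => ((B * (A x).1 : ℝ) : ℂ) :=
    Complex.continuous_ofReal.comp (by fun_prop)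
  have h3 : Continuous fun x => ((B * (A x).2 : ℝ) : ℂ) :=
    Complex.continuous_ofReal.comp (by fun_prop)
  have h4 := h1 (1, 0)
  have h5 := h1 (0, 1)
  have h6 := hu.continuous
  unfold magSq
  fun_prop

theorem magSq_nonneg (B : ℝ) (A : Plane → Plane) (u : Plane → ℂ) (x : Plane) :
    0 ≤ magSq B A u x := by unfold magSq; positivity

theorem norm_sq_eq_re_add_im (z : ℂ) : ‖z‖ ^ 2 = z.re ^ 2 + z.im ^ 2 := by
  rw [← Complex.normSq_eq_norm_sq, Complex.normSq_apply]; ring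

theorem integral_fderiv_cross_eq {p q : Plane → ℝ} (hp : ContDiff ℝ 2 p) (hq : ContDiff ℝ 2 q)
    (hc : HasCompactSupport q) (v w : Plane) :
    ∫ x, fderiv ℝ p x v * fderiv ℝ q x w = ∫ x, fderiv ℝ p x w * fderiv ℝ q x v := by
  have hd : ∀ v, ContDiff ℝ 1 fun x => fderiv ℝ p x v := fun v =>
    (hp.fderiv_right (m := 1) (by norm_num)).clm_apply contDiff_const
  have hq1 : ContDiff ℝ 1 q := hq.of_le (by norm_num)
  rw [integral_mul_fderiv_of_hasCompactSupport (hd v) hq1 hc w,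
    integral_mul_fderiv_of_hasCompactSupport (hd w) hq1 hc v]
  congr 1
  refine integral_congr_ae (Eventually.of_forall fun x => ?_)
  have hdd : DifferentiableAt ℝ (fderiv ℝ p) x :=
    (hp.fderiv_right (m := 1) (by norm_num)).differentiable (by simp) x
  have e : ∀ a b, fderiv ℝ (fun x => fderiv ℝ p x a) x b = fderiv ℝ (fderiv ℝ p) x b a := by
    intro a b
    rw [fderiv_clm_apply hdd (differentiableAt_const a)]
    simp
  have hs : IsSymmSndFDerivAt ℝ p x := hp.contDiffAt.isSymmSndFDerivAt (by simp)
  simp only [e]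
  rw [hs.eq v w]

theorem magSq_eq_re_im (B : ℝ) (A : Plane → Plane) (u : Plane → ℂ) (x : Plane) :
    magSq B A u x = ((fderiv ℝ u x (1, 0)).im - B * (A x).1 * (u x).re) ^ 2
      + ((fderiv ℝ u x (1, 0)).re + B * (A x).1 * (u x).im) ^ 2
      + (((fderiv ℝ u x (0, 1)).im - B * (A x).2 * (u x).re) ^ 2
      + ((fderiv ℝ u x (0, 1)).re + B * (A x).2 * (u x).im) ^ 2) := by
  unfold magSq
  rw [norm_sq_eq_re_add_im, norm_sq_eq_re_add_im]
  simp only [Complex.sub_re, Complex.sub_im, Complex.mul_re, Complex.mul_im, Complex.neg_re,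
    Complex.neg_im, Complex.I_re, Complex.I_im, Complex.ofReal_re, Complex.ofReal_im]
  ring

theorem fderiv_sq_add_sq {p q : Plane → ℝ} (hp : Differentiable ℝ p) (hq : Differentiable ℝ q)
    (x v : Plane) : fderiv ℝ (fun x => p x ^ 2 + q x ^ 2) x v =
      2 * p x * fderiv ℝ p x v + 2 * q x * fderiv ℝ q x v := by
  rw [fderiv_fun_add ((hp x).fun_pow 2) ((hq x).fun_pow 2), fderiv_fun_pow 2 (hp x),
    fderiv_fun_pow 2 (hq x)]
  simp

theorem cross_le_sum_sq (B a b p q p₁ p₂ q₁ q₂ : ℝ) :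
    2 * (p₁ * q₂ - p₂ * q₁)
      + B * (a * (2 * p * p₂ + 2 * q * q₂) - b * (2 * p * p₁ + 2 * q * q₁)) ≤
    (q₁ - B * a * p) ^ 2 + (p₁ + B * a * q) ^ 2 +
      ((q₂ - B * b * p) ^ 2 + (p₂ + B * b * q) ^ 2) := by
  nlinarith [sq_nonneg ((q₁ - B * a * p) + (p₂ + B * b * q)),
    sq_nonneg (-(p₁ + B * a * q) + (q₂ - B * b * p))]

/-- The lower bound of the magnetic Dirichlet energy by the field. -/
theorem integral_curl_le_integral_magSq {B : ℝ} {A : Plane → Plane} {u : Plane → ℂ}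
    (hA : ContDiff ℝ 1 A) (hu : ContDiff ℝ 2 u) (hc : HasCompactSupport u) :
    B * ∫ x, curl2 A x * ‖u x‖ ^ 2 ≤ ∫ x, magSq B A u x := by
  set p : Plane → ℝ := fun x => (u x).re
  set q : Plane → ℝ := fun x => (u x).im
  have hpd : ContDiff ℝ 2 p := Complex.reCLM.contDiff.comp hu
  have hqd : ContDiff ℝ 2 q := Complex.imCLM.contDiff.comp hu
  have hqc : HasCompactSupport q := hc.comp_left (g := Complex.im) Complex.zero_im
  have hp1 : ContDiff ℝ 1 p := hpd.of_le (by norm_num)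
  have hq1 : ContDiff ℝ 1 q := hqd.of_le (by norm_num)
  have hu1 : ContDiff ℝ 1 u := hu.of_le (by norm_num)
  set ρ : Plane → ℝ := fun x => p x ^ 2 + q x ^ 2
  have hρ1 : ContDiff ℝ 1 ρ := (hp1.pow 2).add (hq1.pow 2)
  have hρu : ∀ x, ‖u x‖ ^ 2 = ρ x := fun x => norm_sq_eq_re_add_im _
  have hρc : HasCompactSupport ρ := HasCompactSupport.intro hc.isCompact fun x hx => by
    rw [← hρu, image_eq_zero_of_notMem_tsupport hx, norm_zero, zero_pow two_ne_zero]
  have hcont : ∀ {f : Plane → ℝ}, ContDiff ℝ 1 f → ∀ v, Continuous fun x => fderiv ℝ f x v :=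
    fun hf v => (hf.continuous_fderiv (by simp)).clm_apply continuous_const
  have hA1 : ContDiff ℝ 1 fun x => (A x).1 := contDiff_fst.comp hA
  have hA2 : ContDiff ℝ 1 fun x => (A x).2 := contDiff_snd.comp hA
  have hρd : ∀ x v, fderiv ℝ ρ x v = 2 * p x * fderiv ℝ p x v + 2 * q x * fderiv ℝ q x v :=
    fderiv_sq_add_sq (hp1.differentiable (by simp)) (hq1.differentiable (by simp))
  have hpt : ∀ x, 2 * (fderiv ℝ p x (1, 0) * fderiv ℝ q x (0, 1)
      - fderiv ℝ p x (0, 1) * fderiv ℝ q x (1, 0))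
      + B * ((A x).1 * fderiv ℝ ρ x (0, 1) - (A x).2 * fderiv ℝ ρ x (1, 0)) ≤ magSq B A u x := by
    intro x
    have hux := hu1.differentiable (by simp) x
    rw [hρd, hρd, magSq_eq_re_im, ← hasFDerivAt_re hux, ← hasFDerivAt_im hux,
      ← hasFDerivAt_re hux, ← hasFDerivAt_im hux]
    exact cross_le_sum_sq _ _ _ _ _ _ _ _ _
  have i1 : Integrable fun x => fderiv ℝ p x (1, 0) * fderiv ℝ q x (0, 1) :=
    ((hcont hp1 _).mul (hcont hq1 _)).integrable_of_hasCompactSupport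
      (hqc.fderiv_apply ℝ _).mul_left
  have i2 : Integrable fun x => fderiv ℝ p x (0, 1) * fderiv ℝ q x (1, 0) :=
    ((hcont hp1 _).mul (hcont hq1 _)).integrable_of_hasCompactSupport
      (hqc.fderiv_apply ℝ _).mul_left
  have i3 : Integrable fun x => (A x).1 * fderiv ℝ ρ x (0, 1) :=
    (hA1.continuous.mul (hcont hρ1 _)).integrable_of_hasCompactSupport
      (hρc.fderiv_apply ℝ _).mul_left
  have i4 : Integrable fun x => (A x).2 * fderiv ℝ ρ x (1, 0) :=
    (hA2.continuous.mul (hcont hρ1 _)).integrable_of_hasCompactSupport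
      (hρc.fderiv_apply ℝ _).mul_left
  have i5 : Integrable fun x => fderiv ℝ (fun y => (A y).2) x (1, 0) * ρ x :=
    ((hcont hA2 _).mul hρ1.continuous).integrable_of_hasCompactSupport hρc.mul_left
  have i6 : Integrable fun x => fderiv ℝ (fun y => (A y).1) x (0, 1) * ρ x :=
    ((hcont hA1 _).mul hρ1.continuous).integrable_of_hasCompactSupport hρc.mul_left
  have i7 : Integrable (magSq B A u) := by
    refine (continuous_magSq hu1 hA.continuous).integrable_of_hasCompactSupport ?_
    refine HasCompactSupport.intro hc.isCompact fun x hx => ?_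
    have h1 : fderiv ℝ u x = 0 := by
      by_contra h
      exact hx (support_fderiv_subset ℝ h)
    simp [magSq, h1, image_eq_zero_of_notMem_tsupport hx]
  have i12 : Integrable fun x => 2 * (fderiv ℝ p x (1, 0) * fderiv ℝ q x (0, 1)
      - fderiv ℝ p x (0, 1) * fderiv ℝ q x (1, 0)) := (i1.sub i2).const_mul 2
  have i34 : Integrable fun x => B * ((A x).1 * fderiv ℝ ρ x (0, 1)
      - (A x).2 * fderiv ℝ ρ x (1, 0)) := (i3.sub i4).const_mul B
  have hm := integral_mono (i12.add i34) i7 hpt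
  refine le_trans (le_of_eq ?_) hm
  simp only [Pi.add_apply]
  rw [integral_add i12 i34, integral_const_mul,
    integral_const_mul, integral_sub i1 i2, integral_sub i3 i4,
    integral_fderiv_cross_eq hpd hqd hqc, integral_mul_fderiv_of_hasCompactSupport hA1 hρ1 hρc,
    integral_mul_fderiv_of_hasCompactSupport hA2 hρ1 hρc, sub_self, mul_zero, zero_add,
    sub_neg_eq_add, neg_add_eq_sub, ← integral_sub i5 i6]
  congr 1
  refine integral_congr_ae (Eventually.of_forall fun x => ?_)
  simp only [hρu, curl2]
  ring

theorem norm_add_sq_le_young {τ : ℝ} (hτ : 0 < τ) (a b : ℂ) :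
    ‖a + b‖ ^ 2 ≤ (1 + τ) * ‖a‖ ^ 2 + (1 + 1 / τ) * ‖b‖ ^ 2 := by
  have h := norm_add_le a b
  have h1 : ‖a + b‖ ^ 2 ≤ (‖a‖ + ‖b‖) ^ 2 := pow_le_pow_left₀ (norm_nonneg _) h 2
  have h2 : 2 * ‖a‖ * ‖b‖ ≤ τ * ‖a‖ ^ 2 + 1 / τ * ‖b‖ ^ 2 := by
    have : τ * ‖a‖ ^ 2 + 1 / τ * ‖b‖ ^ 2 - 2 * ‖a‖ * ‖b‖ = (τ * ‖a‖ - ‖b‖) ^ 2 / τ := by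
      field_simp; ring
    have h3 : 0 ≤ (τ * ‖a‖ - ‖b‖) ^ 2 / τ := by positivity
    linarith
  nlinarith

theorem le_norm_sub_sq_young {ε : ℝ} (hε : 0 < ε) (a b : ℂ) :
    (1 - ε) * ‖a‖ ^ 2 - 1 / ε * ‖b‖ ^ 2 ≤ ‖a - b‖ ^ 2 := by
  have h1 : (‖a‖ - ‖b‖) ^ 2 ≤ ‖a - b‖ ^ 2 :=
    sq_le_sq.2 (by rw [abs_norm]; exact abs_norm_sub_norm_le a b)
  have h2 : 2 * ‖a‖ * ‖b‖ ≤ ε * ‖a‖ ^ 2 + 1 / ε * ‖b‖ ^ 2 := by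
    have : ε * ‖a‖ ^ 2 + 1 / ε * ‖b‖ ^ 2 - 2 * ‖a‖ * ‖b‖ = (ε * ‖a‖ - ‖b‖) ^ 2 / ε := by
      field_simp; ring
    have h3 : 0 ≤ (ε * ‖a‖ - ‖b‖) ^ 2 / ε := by positivity
    linarith
  nlinarith [sq_nonneg ‖b‖]

/-- Localization of the magnetic energy density. -/
theorem magSq_smul_le {τ : ℝ} (hτ : 0 < τ) {B : ℝ} {A : Plane → Plane} {η : Plane → ℝ}
    {ψ : Plane → ℂ} {x : Plane} (hη : DifferentiableAt ℝ η x) (hψ : DifferentiableAt ℝ ψ x) :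
    magSq B A (fun y => η y • ψ y) x ≤ (1 + τ) * (η x ^ 2 * magSq B A ψ x) +
      (1 + 1 / τ) * ((fderiv ℝ η x (1, 0) ^ 2 + fderiv ℝ η x (0, 1) ^ 2) * ‖ψ x‖ ^ 2) := by
  have hd : ∀ v, fderiv ℝ (fun y => η y • ψ y) x v = η x * fderiv ℝ ψ x v
      + fderiv ℝ η x v * ψ x := by
    intro v
    rw [fderiv_fun_smul hη hψ]
    simp
  have key : ∀ (v : Plane) (c : ℂ), ‖(-Complex.I) * fderiv ℝ (fun y => η y • ψ y) x v
      - c * (η x • ψ x)‖ ^ 2 ≤ (1 + τ) * (η x ^ 2 * ‖(-Complex.I) * fderiv ℝ ψ x v - c * ψ x‖ ^ 2)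
      + (1 + 1 / τ) * (fderiv ℝ η x v ^ 2 * ‖ψ x‖ ^ 2) := by
    intro v c
    have e : (-Complex.I) * fderiv ℝ (fun y => η y • ψ y) x v - c * (η x • ψ x) =
        (η x : ℂ) * ((-Complex.I) * fderiv ℝ ψ x v - c * ψ x)
        + (-Complex.I) * ((fderiv ℝ η x v : ℝ) * ψ x) := by
      rw [hd, Complex.real_smul]; ring
    rw [e]
    refine (norm_add_sq_le_young hτ _ _).trans (le_of_eq ?_)
    simp only [norm_mul, norm_neg, Complex.norm_I, Complex.norm_real, mul_pow, Real.norm_eq_abs,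
      sq_abs, one_mul]
  unfold magSq
  have h1 := key (1, 0) ((B * (A x).1 : ℝ) : ℂ)
  have h2 := key (0, 1) ((B * (A x).2 : ℝ) : ℂ)
  refine (add_le_add h1 h2).trans (le_of_eq ?_)
  ring

theorem le_magSq_add {ε : ℝ} (hε : 0 < ε) (B : ℝ) (F a : Plane → Plane) (φ : Plane → ℂ)
    (x : Plane) :
    (1 - ε) * magSq B F φ x - 1 / ε * (B ^ 2 * (esq (a x) * ‖φ x‖ ^ 2)) ≤
      magSq B (fun y => F y + a y) φ x := by
  have key : ∀ (z : ℂ) (f g : ℝ), (1 - ε) * ‖z - ((B * f : ℝ) : ℂ) * φ x‖ ^ 2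
      - 1 / ε * (B ^ 2 * (g ^ 2 * ‖φ x‖ ^ 2)) ≤ ‖z - ((B * (f + g) : ℝ) : ℂ) * φ x‖ ^ 2 := by
    intro z f g
    have e : z - ((B * (f + g) : ℝ) : ℂ) * φ x =
        (z - ((B * f : ℝ) : ℂ) * φ x) - ((B * g : ℝ) : ℂ) * φ x := by
      push_cast; ring
    rw [e]
    refine le_trans (le_of_eq ?_) (le_norm_sub_sq_young hε _ _)
    congr 2
    rw [norm_mul, Complex.norm_real, mul_pow, Real.norm_eq_abs, sq_abs]
    ring
  unfold magSq esq
  have h1 := key ((-Complex.I) * fderiv ℝ φ x (1, 0)) (F x).1 (a x).1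
  have h2 := key ((-Complex.I) * fderiv ℝ φ x (0, 1)) (F x).2 (a x).2
  refine le_trans (le_of_eq ?_) (add_le_add h1 h2)
  ring

/-- Gauge invariance of the magnetic energy density. -/
theorem magSq_gauge {B : ℝ} {A F : Plane → Plane} {ψ : Plane → ℂ} {χ : Plane → ℝ}
    {L : Plane →L[ℝ] ℝ} {x : Plane} (hχ : HasFDerivAt χ L x) (hψ : DifferentiableAt ℝ ψ x)
    (h1 : (A x).1 = (F x).1 + L (1, 0)) (h2 : (A x).2 = (F x).2 + L (0, 1)) :
    magSq B F (fun y => Complex.exp (-(B * χ y : ℝ) * Complex.I) * ψ y) x = magSq B A ψ x := by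
  have hexp : HasFDerivAt (fun y => Complex.exp (-(B * χ y : ℝ) * Complex.I))
      (Complex.exp (-(B * χ x : ℝ) * Complex.I) •
        ((-(B : ℂ) * Complex.I) • Complex.ofRealCLM.comp L)) x := by
    have hc := (Complex.ofRealCLM.hasFDerivAt.comp x hχ).const_mul (-(B : ℂ) * Complex.I)
    refine (hc.cexp.congr_fderiv ?_).congr_of_eventuallyEq (Eventually.of_forall fun y => ?_)
    · congr 2
      simp only [Function.comp_apply, Complex.ofRealCLM_apply]
      push_cast; ring
    · simp only [Function.comp_apply, Complex.ofRealCLM_apply]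
      push_cast; ring_nf
  set e := Complex.exp (-(B * χ x : ℝ) * Complex.I) with he
  have hne : ‖e‖ = 1 := by
    rw [he, ← Complex.ofReal_neg]
    exact Complex.norm_exp_ofReal_mul_I _
  have hd : ∀ v, fderiv ℝ (fun y => Complex.exp (-(B * χ y : ℝ) * Complex.I) * ψ y) x v =
      e * (fderiv ℝ ψ x v + (-(B : ℂ) * Complex.I) * L v * ψ x) := by
    intro v
    rw [(hexp.fun_mul hψ.hasFDerivAt).fderiv]
    simp [he]
    ring
  have key : ∀ (v : Plane) (f g : ℝ), g = f + L v →
      ‖(-Complex.I) * fderiv ℝ (fun y => Complex.exp (-(B * χ y : ℝ) * Complex.I) * ψ y) x v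
        - ((B * f : ℝ) : ℂ) * (e * ψ x)‖ = ‖(-Complex.I) * fderiv ℝ ψ x v
        - ((B * g : ℝ) : ℂ) * ψ x‖ := by
    rintro v f g rfl
    have : (-Complex.I) * fderiv ℝ (fun y => Complex.exp (-(B * χ y : ℝ) * Complex.I) * ψ y) x v
        - ((B * f : ℝ) : ℂ) * (e * ψ x) = e * ((-Complex.I) * fderiv ℝ ψ x v
        - ((B * (f + L v) : ℝ) : ℂ) * ψ x) := by
      rw [hd]
      push_cast
      linear_combination e * B * L v * ψ x * Complex.I_sq
    rw [this, norm_mul, hne, one_mul]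
  unfold magSq
  rw [key (1, 0) _ _ h1, key (0, 1) _ _ h2]

theorem contDiff_F0 {n : WithTop ℕ∞} : ContDiff ℝ n F0 := by
  unfold F0; fun_prop

theorem continuous_F0 : Continuous F0 := contDiff_F0 (n := 0) |>.continuous

/-- A Gaussian wave packet at `p` with momentum `ω`. -/
def wavePacket (B : ℝ) (p ω : Plane) (x : Plane) : ℂ :=
  Complex.exp (((-(B / 4 * esq (x - p)) : ℝ) : ℂ) + ((dot2 ω x : ℝ) : ℂ) * Complex.I)

theorem contDiff_wavePacket (B : ℝ) (p ω : Plane) {n : WithTop ℕ∞} :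
    ContDiff ℝ n (wavePacket B p ω) := by
  unfold wavePacket esq dot2
  have h1 : ContDiff ℝ n (fun x : Plane => -(B / 4 * ((x - p).1 ^ 2 + (x - p).2 ^ 2))) := by
    fun_prop
  have h2 : ContDiff ℝ n (fun x : Plane => ω.1 * x.1 + ω.2 * x.2) := by fun_prop
  exact ((Complex.ofRealCLM.contDiff.comp h1).add
    ((Complex.ofRealCLM.contDiff.comp h2).mul contDiff_const)).cexp

theorem norm_wavePacket_sq (B : ℝ) (p ω x : Plane) :
    ‖wavePacket B p ω x‖ ^ 2 = Real.exp (-(B / 2 * esq (x - p))) := by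
  rw [wavePacket, Complex.norm_exp, ← Real.exp_nat_mul]
  simp
  ring

theorem fderiv_wavePacket (B : ℝ) (p ω x v : Plane) :
    fderiv ℝ (wavePacket B p ω) x v =
      (((-(B / 2 * dot2 (x - p) v) : ℝ) : ℂ) + ((dot2 ω v : ℝ) : ℂ) * Complex.I) *
        wavePacket B p ω x := by
  have hl (f : Plane → ℂ) (hf : DifferentiableAt ℝ f x) : fderiv ℝ f x v =
      deriv (fun t : ℝ => f (x + t • v)) 0 := by
    have h : HasDerivAt (fun t : ℝ => x + t • v) v 0 := by
      simpa using ((hasDerivAt_id (0 : ℝ)).smul_const v).const_add x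
    have hf' : HasFDerivAt f (fderiv ℝ f x) (x + (0 : ℝ) • v) := by
      simpa using hf.hasFDerivAt
    exact (hf'.comp_hasDerivAt 0 h).deriv.symm
  rw [hl _ ((contDiff_wavePacket B p ω (n := 1)).differentiable one_ne_zero x)]
  have h1 : HasDerivAt (fun t : ℝ => -(B / 4 * esq (x + t • v - p)))
      (-(B / 2 * dot2 (x - p) v)) 0 := by
    have : (fun t : ℝ => -(B / 4 * esq (x + t • v - p))) = fun t : ℝ =>
        -(B / 4 * esq (x - p)) + t * (-(B / 2 * dot2 (x - p) v)) + t ^ 2 * (-(B / 4 * esq v)) := by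
      funext t
      simp only [esq, dot2, Prod.fst_sub, Prod.snd_sub, Prod.fst_add, Prod.snd_add, Prod.smul_fst,
        Prod.smul_snd, smul_eq_mul]
      ring
    rw [this]
    have := (((hasDerivAt_id (0 : ℝ)).mul_const (-(B / 2 * dot2 (x - p) v))).const_add
      (-(B / 4 * esq (x - p)))).fun_add ((hasDerivAt_pow 2 (0 : ℝ)).mul_const (-(B / 4 * esq v)))
    simpa using this
  have h2 : HasDerivAt (fun t : ℝ => dot2 ω (x + t • v)) (dot2 ω v) 0 := by
    have : (fun t : ℝ => dot2 ω (x + t • v)) = fun t : ℝ => dot2 ω x + t * dot2 ω v := by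
      funext t
      simp only [dot2, Prod.fst_add, Prod.snd_add, Prod.smul_fst,
        Prod.smul_snd, smul_eq_mul]
      ring
    rw [this]
    simpa using ((hasDerivAt_id (0 : ℝ)).mul_const (dot2 ω v)).const_add (dot2 ω x)
  have h3 := (h1.ofReal_comp.add (h2.ofReal_comp.mul_const Complex.I)).cexp
  have h4 : deriv (fun t : ℝ => wavePacket B p ω (x + t • v)) 0 = _ := h3.deriv
  rw [h4]
  simp [wavePacket]
  ring

/-- The magnetic energy density of a wave packet. -/
theorem magSq_wavePacket (B : ℝ) (p ω x : Plane) :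
    magSq B F0 (wavePacket B p ω) x =
      (B ^ 2 / 4 * esq (x - p) + esq (ω - B • F0 x)) * Real.exp (-(B / 2 * esq (x - p))) := by
  have key : ∀ (z : ℂ) (r s f : ℝ), ‖(-Complex.I) * ((((-r : ℝ) : ℂ) + (s : ℂ) * Complex.I) * z)
      - ((f : ℝ) : ℂ) * z‖ ^ 2 = (r ^ 2 + (s - f) ^ 2) * ‖z‖ ^ 2 := by
    intro z r s f
    have : (-Complex.I) * ((((-r : ℝ) : ℂ) + (s : ℂ) * Complex.I) * z) - ((f : ℝ) : ℂ) * z =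
        (((s - f : ℝ) : ℂ) + (r : ℂ) * Complex.I) * z := by
      push_cast
      linear_combination (-s * z) * Complex.I_sq
    rw [this, norm_mul, mul_pow, ← Complex.normSq_eq_norm_sq, Complex.normSq_add_mul_I]
    ring
  unfold magSq
  rw [fderiv_wavePacket, fderiv_wavePacket, key, key, norm_wavePacket_sq]
  simp only [esq, dot2, Prod.fst_sub, Prod.snd_sub, Prod.smul_fst, Prod.smul_snd, smul_eq_mul]
  ring

theorem integrable_gauss : Integrable fun y : ℝ => Real.exp (-y ^ 2 / 2) := by
  have := integrable_exp_neg_mul_sq (b := 1 / 2) (by norm_num)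
  exact this.congr (Eventually.of_forall fun y => by simp only; congr 1; ring)

theorem integrable_mul_gauss : Integrable fun y : ℝ => y * Real.exp (-y ^ 2 / 2) := by
  have := integrable_mul_exp_neg_mul_sq (b := 1 / 2) (by norm_num)
  exact this.congr (Eventually.of_forall fun y => by simp only; congr 2; ring)

theorem integrable_sq_mul_gauss : Integrable fun y : ℝ => y ^ 2 * Real.exp (-y ^ 2 / 2) := by
  have := integrable_rpow_mul_exp_neg_mul_sq (b := 1 / 2) (by norm_num) (s := 2) (by norm_num)
  exact this.congr (Eventually.of_forall fun y => by
    simp only [Real.rpow_two]; congr 2; ring)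

theorem hasDerivAt_gauss (y : ℝ) :
    HasDerivAt (fun y : ℝ => Real.exp (-y ^ 2 / 2)) (-y * Real.exp (-y ^ 2 / 2)) y := by
  have h := (((hasDerivAt_pow 2 y).neg).div_const 2).exp
  simp only [Pi.neg_apply] at h
  convert h using 1
  push_cast; ring

theorem integral_gauss : ∫ y : ℝ, Real.exp (-y ^ 2 / 2) = √(2 * Real.pi) := by
  have := integral_gaussian (1 / 2)
  rw [show Real.pi / (1 / 2) = 2 * Real.pi by ring] at this
  rw [← this]
  congr 1; funext y; congr 1; ring

theorem integral_gauss_Ioi : ∫ y in Ioi (0 : ℝ), Real.exp (-y ^ 2 / 2) = √(2 * Real.pi) / 2 := by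
  have := integral_gaussian_Ioi (1 / 2)
  rw [show Real.pi / (1 / 2) = 2 * Real.pi by ring] at this
  rw [← this]
  congr 1; funext y; congr 1; ring

theorem tendsto_gauss_atTop : Tendsto (fun y : ℝ => Real.exp (-y ^ 2 / 2)) atTop (𝓝 0) := by
  refine Real.tendsto_exp_neg_atTop_nhds_zero.comp
    ((tendsto_pow_atTop (two_ne_zero)).atTop_div_const (two_pos : (0:ℝ) < 2)) |>.congr fun y => ?_
  simp only [Function.comp]; congr 1; ring

theorem integral_mul_gauss_Ioi : ∫ y in Ioi (0 : ℝ), y * Real.exp (-y ^ 2 / 2) = 1 := by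
  have h := integral_Ioi_of_hasDerivAt_of_tendsto' (a := (0 : ℝ))
    (f := fun y => -Real.exp (-y ^ 2 / 2)) (f' := fun y => y * Real.exp (-y ^ 2 / 2)) (m := 0)
    (fun y _ => (hasDerivAt_gauss y).neg.congr_deriv (by ring)) integrable_mul_gauss.integrableOn
    (by simpa using tendsto_gauss_atTop.neg)
  rw [h]; simp

theorem tendsto_mul_gauss_atTop :
    Tendsto (fun y : ℝ => y * Real.exp (-y ^ 2 / 2)) atTop (𝓝 0) := by
  have h := tendsto_rpow_abs_mul_exp_neg_mul_sq_cocompact (a := 1 / 2) (by norm_num) 1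
  have h' := h.mono_left atTop_le_cocompact
  refine h'.congr' ?_
  filter_upwards [eventually_ge_atTop 0] with y hy
  rw [Real.rpow_one, abs_of_nonneg hy]
  congr 2; ring

theorem integral_sq_sub_one_mul_gauss_Ioi :
    ∫ y in Ioi (0 : ℝ), (y ^ 2 - 1) * Real.exp (-y ^ 2 / 2) = 0 := by
  have hi : Integrable fun y : ℝ => (y ^ 2 - 1) * Real.exp (-y ^ 2 / 2) := by
    refine (integrable_sq_mul_gauss.sub integrable_gauss).congr (Eventually.of_forall fun y => ?_)
    simp only [Pi.sub_apply]; ring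
  have h := integral_Ioi_of_hasDerivAt_of_tendsto' (a := (0 : ℝ))
    (f := fun y => -(y * Real.exp (-y ^ 2 / 2)))
    (f' := fun y => (y ^ 2 - 1) * Real.exp (-y ^ 2 / 2)) (m := 0)
    (fun y _ => ((hasDerivAt_id y).fun_mul (hasDerivAt_gauss y)).neg.congr_deriv
      (by simp; ring)) hi.integrableOn
    (by simpa using tendsto_mul_gauss_atTop.neg)
  rw [h]; simp

theorem integral_sq_sub_one_mul_gauss :
    ∫ y : ℝ, (y ^ 2 - 1) * Real.exp (-y ^ 2 / 2) = 0 := by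
  have h := integral_comp_abs (f := fun y : ℝ => (y ^ 2 - 1) * Real.exp (-y ^ 2 / 2))
  simp only [sq_abs] at h
  rw [h, integral_sq_sub_one_mul_gauss_Ioi, mul_zero]

/-- The half-plane energy density of a wave packet, minus `9/10`. -/
def profile (y : Plane) : ℝ :=
  (esq y / 2 + 1 / 4 - y.2 / 2 - 9 / 10) * Real.exp (-(esq y / 2))

theorem profile_eq (y : Plane) : profile y =
    (1 / 2 * (((y.1 ^ 2 - 1) * Real.exp (-y.1 ^ 2 / 2)) * Real.exp (-y.2 ^ 2 / 2)) +
    1 / 2 * (Real.exp (-y.1 ^ 2 / 2) * ((y.2 ^ 2 - 1) * Real.exp (-y.2 ^ 2 / 2)))) +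
    (7 / 20 * (Real.exp (-y.1 ^ 2 / 2) * Real.exp (-y.2 ^ 2 / 2)) -
    1 / 2 * (Real.exp (-y.1 ^ 2 / 2) * (y.2 * Real.exp (-y.2 ^ 2 / 2)))) := by
  have : Real.exp (-(esq y / 2)) = Real.exp (-y.1 ^ 2 / 2) * Real.exp (-y.2 ^ 2 / 2) := by
    rw [← Real.exp_add, esq]; congr 1; ring
  rw [profile, this, esq]
  ring

theorem continuous_profile : Continuous profile := by
  unfold profile esq; fun_prop

theorem integrable_sq_sub_one_mul_gauss :
    Integrable fun y : ℝ => (y ^ 2 - 1) * Real.exp (-y ^ 2 / 2) := by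
  refine (integrable_sq_mul_gauss.sub integrable_gauss).congr (Eventually.of_forall fun y => ?_)
  simp only [Pi.sub_apply]; ring

theorem integrable_profile : Integrable profile := by
  have h1 := (integrable_sq_sub_one_mul_gauss.mul_prod integrable_gauss).const_mul (1 / 2)
  have h2 := (integrable_gauss.mul_prod integrable_sq_sub_one_mul_gauss).const_mul (1 / 2)
  have h3 := (integrable_gauss.mul_prod integrable_gauss).const_mul (7 / 20)
  have h4 := (integrable_gauss.mul_prod integrable_mul_gauss).const_mul (1 / 2)
  exact ((h1.add h2).add (h3.sub h4)).congr (Eventually.of_forall fun y => (profile_eq y).symm)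

theorem integral_add_add_sub {α : Type*} [MeasurableSpace α] {μ : Measure α} {f g h k : α → ℝ}
    (hf : Integrable f μ) (hg : Integrable g μ) (hh : Integrable h μ) (hk : Integrable k μ) :
    ∫ x, (f x + g x + (h x - k x)) ∂μ =
      ∫ x, f x ∂μ + ∫ x, g x ∂μ + (∫ x, h x ∂μ - ∫ x, k x ∂μ) := by
  rw [← integral_add hf hg, ← integral_sub hh hk]
  exact integral_add (hf.add hg) (hh.sub hk)

theorem integral_profile_neg : ∫ y in {y : Plane | 0 < y.2}, profile y < 0 := by
  have hset : {y : Plane | 0 < y.2} = univ ×ˢ Ioi (0 : ℝ) := by ext; simp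
  have hvol : (volume : Measure Plane).restrict (univ ×ˢ Ioi (0 : ℝ)) =
      (volume : Measure ℝ).prod (volume.restrict (Ioi 0)) := by
    rw [Measure.volume_eq_prod, ← Measure.prod_restrict, Measure.restrict_univ]
  rw [hset, hvol]
  have i1 := integrable_gauss
  have i2 := integrable_sq_sub_one_mul_gauss
  have j1 := (integrable_gauss.integrableOn (s := Ioi 0)).integrable
  have j2 := (integrable_sq_sub_one_mul_gauss.integrableOn (s := Ioi 0)).integrable
  have j3 := (integrable_mul_gauss.integrableOn (s := Ioi 0)).integrable
  have h1 := (i2.mul_prod j1).const_mul (1 / 2)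
  have h2 := (i1.mul_prod j2).const_mul (1 / 2)
  have h3 := (i1.mul_prod j1).const_mul (7 / 20)
  have h4 := (i1.mul_prod j3).const_mul (1 / 2)
  simp_rw [profile_eq]
  rw [integral_add_add_sub h1 h2 h3 h4]
  simp only [integral_const_mul]
  rw [integral_prod_mul (fun y : ℝ => (y ^ 2 - 1) * Real.exp (-y ^ 2 / 2))
      (fun y : ℝ => Real.exp (-y ^ 2 / 2)),
    integral_prod_mul (fun y : ℝ => Real.exp (-y ^ 2 / 2))
      (fun y : ℝ => (y ^ 2 - 1) * Real.exp (-y ^ 2 / 2)),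
    integral_prod_mul (fun y : ℝ => Real.exp (-y ^ 2 / 2)) (fun y : ℝ => Real.exp (-y ^ 2 / 2)),
    integral_prod_mul (fun y : ℝ => Real.exp (-y ^ 2 / 2))
      (fun y : ℝ => y * Real.exp (-y ^ 2 / 2)),
    integral_sq_sub_one_mul_gauss, integral_sq_sub_one_mul_gauss_Ioi, integral_gauss,
    integral_gauss_Ioi, integral_mul_gauss_Ioi]
  have hpi := Real.pi_lt_d2
  have hpos : 0 < √(2 * Real.pi) := Real.sqrt_pos.2 (by positivity)
  have hlt : √(2 * Real.pi) < 2.6 := by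
    rw [Real.sqrt_lt' (by norm_num)]
    nlinarith
  nlinarith

namespace BoundaryParam

variable {Ω : Set Plane} (P : BoundaryParam Ω)

/-- The blow-up of the plane at the boundary point `γ 0`. -/
def blowup (B : ℝ) (y : Plane) : Plane :=
  P.γ 0 + (√B)⁻¹ • frameEquiv (deriv P.γ 0) (P.unit_speed 0) y

theorem eventually_blowup_mem_iff (hΩ : IsOpen Ω) (hb : Bornology.IsBounded Ω) {y : Plane}
    (hy : y.2 ≠ 0) : ∀ᶠ B in atTop, (P.blowup B y ∈ Ω ↔ 0 < y.2) := by
  obtain ⟨δ, hδ, hsub, hiff⟩ := P.exists_box_mem_iff hΩ hb 0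
  set R := frameEquiv (deriv P.γ 0) (P.unit_speed 0) with hR
  set e := P.chart 0 with he
  have hsrc : ((0 : ℝ), (0 : ℝ)) ∈ e.source := P.mem_chart_source 0
  have he0 : e (0, 0) = P.γ 0 := by rw [he, chart_apply, tube_zero]
  have hsymm0 : e.symm (P.γ 0) = (0, 0) := by rw [← he0, e.left_inv hsrc]
  have htgt : P.γ 0 ∈ e.target := by rw [← he0]; exact e.map_source hsrc
  have hder : HasFDerivAt e.symm (R.symm : Plane →L[ℝ] Plane) (P.γ 0) := by
    refine e.hasFDerivAt_symm htgt ?_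
    rw [hsymm0]
    exact P.hasFDerivAt_tube 0
  have hs : Tendsto (fun B : ℝ => (√B)⁻¹) atTop (𝓝[>] 0) :=
    tendsto_inv_atTop_nhdsGT_zero.comp Real.tendsto_sqrt_atTop
  have hline : HasDerivAt (fun t : ℝ => P.γ 0 + t • R y) (R y) 0 := by
    simpa using ((hasDerivAt_id (0 : ℝ)).smul_const (R y)).const_add (P.γ 0)
  have hcomp : HasDerivAt (fun t : ℝ => e.symm (P.γ 0 + t • R y)) y 0 := by
    have h' : HasFDerivAt e.symm (R.symm : Plane →L[ℝ] Plane) (P.γ 0 + (0 : ℝ) • R y) := by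
      simpa using hder
    exact (h'.comp_hasDerivAt 0 hline).congr_deriv (by simp)
  have hcont := hcomp.continuousAt
  have hlc := hline.continuousAt
  have hsnd : HasDerivAt (fun t : ℝ => (e.symm (P.γ 0 + t • R y)).2) y.2 0 := by
    exact (ContinuousLinearMap.snd ℝ ℝ ℝ).hasFDerivAt.comp_hasDerivAt 0 hcomp
  have hslope := hsnd.tendsto_slope_zero_right
  simp only [zero_add, zero_smul, add_zero, hsymm0, sub_zero, smul_eq_mul] at hslope
  have E1 : ∀ᶠ t in 𝓝[>] (0 : ℝ), e.symm (P.γ 0 + t • R y) ∈ box 0 δ := by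
    refine (hcont.eventually ?_).filter_mono nhdsWithin_le_nhds
    simp only [zero_smul, add_zero, hsymm0]
    exact box_mem_nhds 0 hδ
  have E2 : ∀ᶠ t in 𝓝[>] (0 : ℝ), P.γ 0 + t • R y ∈ e.target := by
    refine (hlc.eventually ?_).filter_mono nhdsWithin_le_nhds
    simp only [zero_smul, add_zero]
    exact e.open_target.mem_nhds htgt
  have E3 : ∀ᶠ t in 𝓝[>] (0 : ℝ), (0 < (e.symm (P.γ 0 + t • R y)).2 ↔ 0 < y.2) := by
    rcases lt_or_gt_of_ne hy with h | h
    · filter_upwards [hslope.eventually (gt_mem_nhds h), self_mem_nhdsWithin] with t ht ht0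
      have ht0 : 0 < t := ht0
      refine iff_of_false (fun hc => ?_) h.not_gt
      have : 0 < t⁻¹ * (e.symm (P.γ 0 + t • R y)).2 := by positivity
      linarith
    · filter_upwards [hslope.eventually (lt_mem_nhds h), self_mem_nhdsWithin] with t ht ht0
      have ht0 : 0 < t := ht0
      exact iff_of_true ((pos_iff_pos_of_mul_pos ht).1 (by positivity)) h
  have E : ∀ᶠ t in 𝓝[>] (0 : ℝ), (P.γ 0 + t • R y ∈ Ω ↔ 0 < y.2) := by
    filter_upwards [E1, E2, E3] with t h1 h2 h3
    have h4 := hiff _ h1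
    rw [← chart_apply, ← he, e.right_inv h2] at h4
    rw [h4, h3]
  exact hs.eventually E

theorem tendsto_integral_profile (hΩ : IsOpen Ω) (hb : Bornology.IsBounded Ω) :
    Tendsto (fun B => ∫ y in P.blowup B ⁻¹' Ω, profile y) atTop
      (𝓝 (∫ y in {y : Plane | 0 < y.2}, profile y)) := by
  have hcont (B : ℝ) : Continuous (P.blowup B) := by unfold blowup; fun_prop
  have hm (B : ℝ) : MeasurableSet (P.blowup B ⁻¹' Ω) := (hΩ.preimage (hcont B)).measurableSet
  have hm0 : MeasurableSet {y : Plane | 0 < y.2} :=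
    (isOpen_lt continuous_const continuous_snd).measurableSet
  simp_rw [← integral_indicator (hm _), ← integral_indicator hm0]
  refine tendsto_integral_filter_of_dominated_convergence (fun y => ‖profile y‖)
    (Eventually.of_forall fun B =>
      (continuous_profile.measurable.indicator (hm B)).aestronglyMeasurable)
    (Eventually.of_forall fun B => Eventually.of_forall fun y => norm_indicator_le_norm_self _ _)
    integrable_profile.norm ?_
  have hae : ∀ᵐ y : Plane, y.2 ≠ 0 := by
    have h := (Measure.quasiMeasurePreserving_snd (μ := (volume : Measure ℝ))
      (ν := (volume : Measure ℝ))).ae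
      (p := fun t : ℝ => t ≠ 0) (by simp [ae_iff])
    simpa [Measure.volume_eq_prod] using h
  filter_upwards [hae] with y hy
  refine tendsto_const_nhds.congr' ?_
  filter_upwards [P.eventually_blowup_mem_iff hΩ hb hy] with B hB
  by_cases h : 0 < y.2
  · rw [indicator_of_mem (show y ∈ {y : Plane | 0 < y.2} from h),
      indicator_of_mem (show y ∈ P.blowup B ⁻¹' Ω from hB.2 h)]
  · rw [indicator_of_notMem (show y ∉ {y : Plane | 0 < y.2} from h),
      indicator_of_notMem (show y ∉ P.blowup B ⁻¹' Ω from fun hc => h (hB.1 hc))]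

end BoundaryParam

theorem integrableOn_of_continuous {E : Type*} [NormedAddCommGroup E] {Ω : Set Plane}
    (hb : Bornology.IsBounded Ω) {f : Plane → E} (hf : Continuous f) : IntegrableOn f Ω :=
  (hf.continuousOn.integrableOn_compact hb.isCompact_closure).mono_set subset_closure

/-- Any test function bounds the ground state energy from above. -/
theorem lam1_mul_le {Ω : Set Plane} {B : ℝ} {u : Plane → ℂ} (hu : CNearCl 1 Ω u) :
    lam1 Ω B * ∫ x in Ω, ‖u x‖ ^ 2 ≤ ∫ x in Ω, magSq B F0 u x := by
  have h0 : 0 ≤ ∫ x in Ω, ‖u x‖ ^ 2 := integral_nonneg fun x => sq_nonneg _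
  have hQ : ∀ u : Plane → ℂ, 0 ≤ ∫ x in Ω, magSq B F0 u x := fun u =>
    integral_nonneg fun x => magSq_nonneg B F0 u x
  by_cases h : ∫ x in Ω, ‖u x‖ ^ 2 = 0
  · rw [h, mul_zero]; exact hQ u
  · rw [← le_div_iff₀ (lt_of_le_of_ne h0 (Ne.symm h))]
    refine csInf_le ⟨0, ?_⟩ ⟨u, hu, h, rfl⟩
    rintro r ⟨v, -, -, rfl⟩
    exact div_nonneg (hQ v) (integral_nonneg fun x => sq_nonneg _)

theorem BoundaryParam.nonempty {Ω : Set Plane} (P : BoundaryParam Ω) : Ω.Nonempty := by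
  obtain ⟨ε, hε, h⟩ := P.inward 0
  exact ⟨_, h (ε / 2) ⟨by linarith, by linarith⟩⟩

theorem integral_norm_sq_pos {Ω : Set Plane} (hΩ : IsOpen Ω) (hne : Ω.Nonempty)
    (hb : Bornology.IsBounded Ω) {u : Plane → ℂ} (hu : Continuous u) (h0 : ∀ x, u x ≠ 0) :
    0 < ∫ x in Ω, ‖u x‖ ^ 2 := by
  rw [integral_pos_iff_support_of_nonneg (fun x => sq_nonneg _)
    (integrableOn_of_continuous hb (hu.norm.pow 2))]
  have : Function.support (fun x => ‖u x‖ ^ 2) = univ := by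
    ext x; simp [h0 x]
  rw [this, Measure.restrict_apply_univ]
  exact hΩ.measure_pos volume hne

theorem esq_frameEquiv (v : Plane) (hv : esq v = 1) (y : Plane) :
    esq (frameEquiv v hv y) = esq y := by
  have h : v.1 ^ 2 + v.2 ^ 2 = 1 := hv
  rw [frameEquiv_apply]
  simp only [esq]
  linear_combination (y.1 ^ 2 + y.2 ^ 2) * h

theorem BoundaryParam.packet_blowup {Ω : Set Plane} (P : BoundaryParam Ω) {B : ℝ} (hB : 0 < B)
    (y : Plane) :
    let u := wavePacket B (P.γ 0) (B • F0 (P.γ 0) - (√B / 2) • deriv P.γ 0)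
    magSq B F0 u (P.blowup B y) - 9 / 10 * B * ‖u (P.blowup B y)‖ ^ 2 = B * profile y := by
  intro u
  have hs : 0 < √B := Real.sqrt_pos.2 hB
  have hss : √B ^ 2 = B := Real.sq_sqrt hB.le
  have h1 : (deriv P.γ 0).1 ^ 2 + (deriv P.γ 0).2 ^ 2 = 1 := P.unit_speed 0
  rw [magSq_wavePacket, norm_wavePacket_sq]
  have e1 : P.blowup B y - P.γ 0 =
    (√B)⁻¹ • frameEquiv (deriv P.γ 0) (P.unit_speed 0) y := by simp [blowup]
  have hsm : ∀ (c : ℝ) (z : Plane), esq (c • z) = c ^ 2 * esq z := by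
    intro c z; simp only [esq, Prod.smul_fst, Prod.smul_snd, smul_eq_mul]; ring
  have e2 : B * esq (P.blowup B y - P.γ 0) = esq y := by
    rw [e1, hsm, esq_frameEquiv, inv_pow, hss]
    field_simp
  have e3 : esq ((B • F0 (P.γ 0) - (√B / 2) • deriv P.γ 0) - B • F0 (P.blowup B y)) =
      B * (esq y / 4 + 1 / 4 - y.2 / 2) := by
    rw [blowup, frameEquiv_apply]
    simp only [F0, esq, Prod.fst_sub, Prod.snd_sub, Prod.fst_add, Prod.snd_add, Prod.smul_fst,
      Prod.smul_snd, smul_eq_mul]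
    generalize (deriv P.γ 0).1 = a at *
    generalize (deriv P.γ 0).2 = b at *
    generalize √B = s at *
    subst hss
    field_simp
    linear_combination (4 * y.1 ^ 2 + 4 * y.2 ^ 2 + 4 - 8 * y.2) * h1
  have e4 : B / 2 * esq (P.blowup B y - P.γ 0) = esq y / 2 := by linarith
  have e5 : B ^ 2 / 4 * esq (P.blowup B y - P.γ 0) = B * (esq y / 4) := by
    linear_combination B / 4 * e2
  rw [e3, e4, e5, profile]
  ring

/-- The ground state energy is asymptotically strictly below the field strength. -/
theorem BoundaryParam.exists_lam1_le {Ω : Set Plane} (P : BoundaryParam Ω) (hΩ : IsOpen Ω)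
    (hb : Bornology.IsBounded Ω) : ∃ B₀ > 0, ∀ B ≥ B₀, lam1 Ω B ≤ 9 / 10 * B := by
  obtain ⟨B₁, h₁⟩ := eventually_atTop.1
    ((P.tendsto_integral_profile hΩ hb).eventually (gt_mem_nhds integral_profile_neg))
  refine ⟨max B₁ 1, lt_max_of_lt_right one_pos, fun B hB => ?_⟩
  have hB0 : 0 < B := one_pos.trans_le ((le_max_right _ _).trans hB)
  have hneg := h₁ B ((le_max_left _ _).trans hB)
  set u := wavePacket B (P.γ 0) (B • F0 (P.γ 0) - (√B / 2) • deriv P.γ 0) with hu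
  have hcu : ContDiff ℝ 1 u := contDiff_wavePacket _ _ _
  set R := frameEquiv (deriv P.γ 0) (P.unit_speed 0) with hR
  have hs : 0 < √B := Real.sqrt_pos.2 hB0
  have hcb : Continuous (P.blowup B) := by unfold blowup; fun_prop
  have hder : ∀ y, HasFDerivAt (P.blowup B) ((√B)⁻¹ • (R : Plane →L[ℝ] Plane)) y := fun y =>
    (R.hasFDerivAt.const_smul (√B)⁻¹).const_add (P.γ 0)
  have hinj : Function.Injective (P.blowup B) := by
    intro y z h
    simpa [blowup, hs.ne'] using h
  have hsurj : Function.Surjective (P.blowup B) := by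
    intro x
    refine ⟨R.symm (√B • (x - P.γ 0)), ?_⟩
    simp only [blowup, ← hR, R.apply_symm_apply, smul_smul, inv_mul_cancel₀ hs.ne', one_smul]
    abel
  set G : Plane → ℝ := fun x => magSq B F0 u x - 9 / 10 * B * ‖u x‖ ^ 2 with hG
  have hcov := integral_image_eq_integral_abs_det_fderiv_smul volume
    (hΩ.preimage hcb).measurableSet (fun y _ => (hder y).hasFDerivWithinAt) hinj.injOn G
  rw [image_preimage_eq _ hsurj] at hcov
  have hGy : ∀ y, G (P.blowup B y) = B * profile y := fun y => P.packet_blowup hB0 y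
  simp only [hGy, smul_eq_mul, integral_const_mul] at hcov
  have hle : ∫ x in Ω, G x ≤ 0 := by
    rw [hcov]
    exact mul_nonpos_of_nonneg_of_nonpos (abs_nonneg _)
      (mul_nonpos_of_nonneg_of_nonpos hB0.le hneg.le)
  have hI1 : IntegrableOn (fun x => magSq B F0 u x) Ω :=
    integrableOn_of_continuous hb (continuous_magSq hcu continuous_F0)
  have hI2 : IntegrableOn (fun x => 9 / 10 * B * ‖u x‖ ^ 2) Ω :=
    integrableOn_of_continuous hb (by have := hcu.continuous; fun_prop)
  rw [hG, integral_sub hI1 hI2, integral_const_mul] at hle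
  have hpos := integral_norm_sq_pos hΩ P.nonempty hb hcu.continuous
    (fun x => by simp [hu, wavePacket])
  have := lam1_mul_le (B := B) (cNearCl_of_contDiff (Ω := Ω) hcu)
  exact le_of_mul_le_mul_right (by linarith) hpos

/-- Cauchy–Schwarz for real integrals. -/
theorem integral_mul_sq_le {α : Type*} [MeasurableSpace α] {μ : Measure α} {f g : α → ℝ}
    (hf : Integrable (fun x => f x ^ 2) μ) (hg : Integrable (fun x => g x ^ 2) μ)
    (hfg : Integrable (fun x => f x * g x) μ) :
    (∫ x, f x * g x ∂μ) ^ 2 ≤ (∫ x, f x ^ 2 ∂μ) * ∫ x, g x ^ 2 ∂μ := by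
  have h : ∀ t : ℝ, 0 ≤ (∫ x, f x ^ 2 ∂μ) * (t * t) + (2 * ∫ x, f x * g x ∂μ) * t
      + ∫ x, g x ^ 2 ∂μ := by
    intro t
    have h0 : 0 ≤ ∫ x, (t * f x + g x) ^ 2 ∂μ := integral_nonneg fun x => sq_nonneg _
    have e : (fun x => (t * f x + g x) ^ 2) =
        fun x => (t * t) * f x ^ 2 + (2 * t) * (f x * g x) + g x ^ 2 := by
      funext x; ring
    have i1 : Integrable (fun x => (t * t) * f x ^ 2) μ := hf.const_mul _
    have i2 : Integrable (fun x => (2 * t) * (f x * g x)) μ := hfg.const_mul _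
    have i3 : Integrable (fun x => (t * t) * f x ^ 2 + (2 * t) * (f x * g x)) μ := i1.add i2
    rw [e, integral_add i3 hg, integral_add i1 i2, integral_const_mul,
      integral_const_mul] at h0
    linarith
  have := discrim_le_zero h
  rw [discrim] at this
  linarith

theorem integral_mul_le_of_sq_le {α : Type*} [MeasurableSpace α] {μ : Measure α} {f g : α → ℝ}
    {a b : ℝ} (ha : 0 ≤ a) (hb : 0 ≤ b)
    (hf : Integrable (fun x => f x ^ 2) μ) (hg : Integrable (fun x => g x ^ 2) μ)
    (hfg : Integrable (fun x => f x * g x) μ) (hfa : ∫ x, f x ^ 2 ∂μ ≤ a ^ 2)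
    (hgb : ∫ x, g x ^ 2 ∂μ ≤ b ^ 2) : |∫ x, f x * g x ∂μ| ≤ a * b := by
  refine abs_le_of_sq_le_sq ?_ (by positivity)
  refine (integral_mul_sq_le hf hg hfg).trans ?_
  rw [mul_pow]
  exact mul_le_mul hfa hgb (integral_nonneg fun x => sq_nonneg _) (sq_nonneg _)

theorem BoundaryParam.volume_frontier {Ω : Set Plane} (P : BoundaryParam Ω) :
    volume (frontier Ω) = 0 := by
  have hs : volume ((univ : Set ℝ) ×ˢ ({0} : Set ℝ)) = 0 := by
    rw [Measure.volume_eq_prod, Measure.prod_prod]; simp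
  have h := addHaar_image_eq_zero_of_differentiableOn_of_addHaar_eq_zero volume
    (f := fun x : Plane => P.γ x.1) (s := univ ×ˢ ({0} : Set ℝ))
    ((P.smooth.differentiable (by simp)).comp differentiable_fst).differentiableOn hs
  refine measure_mono_null ?_ h
  rw [← P.range_eq]
  rintro _ ⟨s, rfl⟩
  exact ⟨(s, 0), by simp, rfl⟩

open scoped ContDiff in
/-- A continuous function on a neighbourhood of a bounded set can be cut off with an arbitrarily
small increase of its square integral. -/
theorem exists_cutoff_integral_sq_le {Ω : Set Plane} (hΩ : IsOpen Ω) (hb : Bornology.IsBounded Ω)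
    (hfr : volume (frontier Ω) = 0) {R : ℝ} (hR : closure Ω ⊆ Metric.ball 0 R) {f : Plane → ℝ}
    (hf : Continuous f) {ε : ℝ} (hε : 0 < ε) :
    ∃ θ : Plane → ℝ, ContDiff ℝ ∞ θ ∧ HasCompactSupport θ ∧
      Function.support θ ⊆ Metric.ball 0 R ∧
      (∃ V, IsOpen V ∧ closure Ω ⊆ V ∧ ∀ x ∈ V, θ x = 1) ∧
      ∫ x, (θ x * f x) ^ 2 ≤ (∫ x in Ω, f x ^ 2) + ε := by
  obtain ⟨M, hM⟩ := ((isCompact_closedBall (0 : Plane) R).image_of_continuousOn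
    hf.continuousOn).isBounded.exists_norm_le
  have hfM : ∀ x ∈ Metric.ball (0 : Plane) R, f x ^ 2 ≤ M ^ 2 := fun x hx =>
    sq_le_sq' (abs_le.1 (hM _ ⟨x, Metric.ball_subset_closedBall hx, rfl⟩)).1
      (abs_le.1 (hM _ ⟨x, Metric.ball_subset_closedBall hx, rfl⟩)).2
  have hδ : ENNReal.ofReal (ε / (M ^ 2 + 1)) ≠ 0 := by
    simp only [ne_eq, ENNReal.ofReal_eq_zero, not_le]; positivity
  obtain ⟨U, hKU, hU, hvol⟩ := hb.isCompact_closure.exists_isOpen_lt_add (μ := volume) hδ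
  obtain ⟨θ, hθ, hθc, hθs, hV, h01⟩ := exists_cutoff hb.isCompact_closure
    (hU.inter Metric.isOpen_ball) (subset_inter hKU hR)
  have hsub : Function.support θ ⊆ U ∩ Metric.ball 0 R := (subset_tsupport θ).trans hθs
  refine ⟨θ, hθ, hθc, hsub.trans inter_subset_right, hV, ?_⟩
  set U' := U ∩ Metric.ball (0 : Plane) R with hU'
  have hU'b : Bornology.IsBounded U' := Metric.isBounded_ball.subset inter_subset_right
  have hU'm : MeasurableSet U' := (hU.inter Metric.isOpen_ball).measurableSet
  have hi : IntegrableOn (fun x => f x ^ 2) U' :=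
    ((hf.pow 2).continuousOn.integrableOn_compact hU'b.isCompact_closure).mono_set subset_closure
  have hΩU : Ω ⊆ U' := subset_closure.trans (subset_inter hKU hR)
  have h1 : ∫ x, (θ x * f x) ^ 2 ≤ ∫ x in U', f x ^ 2 := by
    rw [← integral_indicator hU'm]
    refine integral_mono_of_nonneg (Eventually.of_forall fun x => sq_nonneg _)
      (hi.integrable_indicator hU'm) (Eventually.of_forall fun x => ?_)
    by_cases hx : x ∈ U'
    · simp only [indicator_of_mem hx, mul_pow]
      exact mul_le_of_le_one_left (sq_nonneg _) (pow_le_one₀ (h01 x).1 (h01 x).2)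
    · have : θ x = 0 := by
        by_contra h; exact hx (hsub h)
      simp [indicator_of_notMem hx, this]
  have hfin : volume (U' \ Ω) ≤ ENNReal.ofReal (ε / (M ^ 2 + 1)) := by
    have hcl : volume (closure Ω) = volume Ω := by
      refine le_antisymm ?_ (measure_mono subset_closure)
      rw [closure_eq_self_union_frontier]
      refine (measure_union_le _ _).trans ?_
      rw [hfr, add_zero]
    rw [measure_sdiff hΩU hΩ.measurableSet.nullMeasurableSet hb.measure_lt_top.ne]
    refine tsub_le_iff_left.2 ((measure_mono inter_subset_left).trans ?_)
    rw [← hcl]; exact hvol.le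
  have h2 : ∫ x in U', f x ^ 2 = (∫ x in Ω, f x ^ 2) + ∫ x in U' \ Ω, f x ^ 2 := by
    rw [← setIntegral_union disjoint_sdiff_right (hU'm.diff hΩ.measurableSet)
      (hi.mono_set hΩU) (hi.mono_set sdiff_subset), union_sdiff_cancel hΩU]
  have h3 : ∫ x in U' \ Ω, f x ^ 2 ≤ ε := by
    have hlt : volume (U' \ Ω) < ⊤ := hfin.trans_lt ENNReal.ofReal_lt_top
    have h4 : ∫ x in U' \ Ω, f x ^ 2 ≤ ∫ x in U' \ Ω, M ^ 2 :=
      setIntegral_mono_on (hi.mono_set sdiff_subset) (integrableOn_const hlt.ne)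
        (hU'm.diff hΩ.measurableSet) fun x hx => hfM x hx.1.2
    refine h4.trans ?_
    rw [setIntegral_const, smul_eq_mul]
    have h5 : volume.real (U' \ Ω) ≤ ε / (M ^ 2 + 1) :=
      ENNReal.toReal_le_of_le_ofReal (by positivity) hfin
    calc volume.real (U' \ Ω) * M ^ 2 ≤ ε / (M ^ 2 + 1) * (M ^ 2 + 1) :=
          mul_le_mul h5 (by linarith) (sq_nonneg _) (by positivity)
      _ = ε := by field_simp
  linarith

/-- The linear form `v ↦ a · v`. -/
def dotForm (a : Plane) : Plane →L[ℝ] ℝ :=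
  a.1 • ContinuousLinearMap.fst ℝ ℝ ℝ + a.2 • ContinuousLinearMap.snd ℝ ℝ ℝ

theorem dotForm_apply (a v : Plane) : dotForm a v = a.1 * v.1 + a.2 * v.2 := rfl

theorem contDiff_dotForm {n : WithTop ℕ∞} : ContDiff ℝ n dotForm := by
  unfold dotForm; fun_prop

theorem fderiv_dotForm_symm {g : Plane → Plane} {x : Plane} (hg : DifferentiableAt ℝ g x)
    (hc : curl2 g x = 0) (v w : Plane) :
    fderiv ℝ (fun y => dotForm (g y)) x v w = fderiv ℝ (fun y => dotForm (g y)) x w v := by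
  have h : ∀ v w, fderiv ℝ (fun y => dotForm (g y)) x v w = dotForm (fderiv ℝ g x v) w := by
    intro v w
    have h1 : HasFDerivAt (fun y => (g y).1)
        ((ContinuousLinearMap.fst ℝ ℝ ℝ).comp (fderiv ℝ g x)) x :=
      (ContinuousLinearMap.fst ℝ ℝ ℝ).hasFDerivAt.comp x hg.hasFDerivAt
    have h2 : HasFDerivAt (fun y => (g y).2)
        ((ContinuousLinearMap.snd ℝ ℝ ℝ).comp (fderiv ℝ g x)) x :=
      (ContinuousLinearMap.snd ℝ ℝ ℝ).hasFDerivAt.comp x hg.hasFDerivAt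
    have h3 := (h1.smul_const (ContinuousLinearMap.fst ℝ ℝ ℝ)).fun_add
      (h2.smul_const (ContinuousLinearMap.snd ℝ ℝ ℝ))
    have h4 : fderiv ℝ (fun y => dotForm (g y)) x = _ := h3.fderiv
    rw [h4]
    simp [dotForm]
  have hdec : ∀ v : Plane, fderiv ℝ g x v =
      v.1 • fderiv ℝ g x (1, 0) + v.2 • fderiv ℝ g x (0, 1) := by
    intro v
    rw [← map_smul, ← map_smul, ← map_add]
    congr 1
    ext <;> simp
  rw [curl2_eq_of_differentiableAt hg] at hc
  rw [h, h, dotForm_apply, dotForm_apply, hdec v, hdec w]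
  simp only [Prod.fst_add, Prod.snd_add, Prod.smul_fst, Prod.smul_snd, smul_eq_mul]
  linear_combination (v.1 * w.2 - w.1 * v.2) * hc

theorem contDiff_curl2 {A : Plane → Plane} (hA : ContDiff ℝ 2 A) : ContDiff ℝ 1 (curl2 A) := by
  have : curl2 A = fun x => (fderiv ℝ A x (1, 0)).2 - (fderiv ℝ A x (0, 1)).1 := by
    funext x
    rw [curl2_eq_of_differentiableAt (hA.differentiable two_ne_zero x)]
  rw [this]
  have h3 : ∀ v, ContDiff ℝ 1 fun x => fderiv ℝ A x v := fun v =>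
    (hA.fderiv_right (m := 1) (by norm_num)).clm_apply contDiff_const
  exact (contDiff_snd.comp (h3 _)).sub (contDiff_fst.comp (h3 _))

theorem curl2_F0 (x : Plane) : curl2 F0 x = 1 := by
  have h1 : HasFDerivAt (fun y : Plane => (F0 y).2) ((1 / 2 : ℝ) • ContinuousLinearMap.fst ℝ ℝ ℝ)
      x :=
    ((ContinuousLinearMap.fst ℝ ℝ ℝ).hasFDerivAt.const_smul (1 / 2 : ℝ)).congr_of_eventuallyEq
      (Eventually.of_forall fun y => by simp [F0]; ring)
  have h2 : HasFDerivAt (fun y : Plane => (F0 y).1)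
      ((-1 / 2 : ℝ) • ContinuousLinearMap.snd ℝ ℝ ℝ) x :=
    ((ContinuousLinearMap.snd ℝ ℝ ℝ).hasFDerivAt.const_smul (-1 / 2 : ℝ)).congr_of_eventuallyEq
      (Eventually.of_forall fun y => by simp [F0]; ring)
  rw [curl2, h1.fderiv, h2.fderiv]
  norm_num

theorem curl2_sub_sub {f g h : Plane → Plane} {x : Plane} (hf : DifferentiableAt ℝ f x)
    (hg : DifferentiableAt ℝ g x) (hh : DifferentiableAt ℝ h x) :
    curl2 (fun y => f y - g y - h y) x = curl2 f x - curl2 g x - curl2 h x := by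
  have hd : fderiv ℝ (fun y => f y - g y - h y) x = fderiv ℝ f x - fderiv ℝ g x - fderiv ℝ h x :=
    ((hf.hasFDerivAt.fun_sub hg.hasFDerivAt).fun_sub hh.hasFDerivAt).fderiv
  rw [curl2_eq_of_differentiableAt ((hf.fun_sub hg).fun_sub hh), curl2_eq_of_differentiableAt hf,
    curl2_eq_of_differentiableAt hg, curl2_eq_of_differentiableAt hh, hd]
  simp only [sub_apply, Prod.fst_sub, Prod.snd_sub]
  ring

/-- A vector potential with the same curl as `F₀ + a` near the domain is gauge equivalent to it:
every wave function has a gauge transform, of class `C¹`, with the corresponding energy density. -/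
theorem BoundaryParam.exists_gauge {Ω : Set Plane} (P : BoundaryParam Ω) (hΩ : IsOpen Ω)
    (hb : Bornology.IsBounded Ω) (hsc : SimplyConnectedSpace Ω) {A a : Plane → Plane}
    (hA : ContDiff ℝ 1 A) (ha : ContDiff ℝ 1 a) {V : Set Plane} (hV : IsOpen V)
    (hcl : closure Ω ⊆ V) (hcurl : ∀ x ∈ V, curl2 A x = 1 + curl2 a x) (B : ℝ) {ψ : Plane → ℂ}
    (hψ : ContDiff ℝ 1 ψ) : ∃ φ : Plane → ℂ, ContDiff ℝ 1 φ ∧ (∀ x ∈ Ω, ‖φ x‖ = ‖ψ x‖) ∧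
      ∀ x ∈ Ω, magSq B (fun y => F0 y + a y) φ x = magSq B A ψ x := by
  set g : Plane → Plane := fun y => A y - F0 y - a y with hg
  have hgc : ContDiff ℝ 1 g := (hA.sub contDiff_F0).sub ha
  have hd : ∀ {f : Plane → Plane}, ContDiff ℝ 1 f → ∀ x, DifferentiableAt ℝ f x :=
    fun hf x => hf.differentiable one_ne_zero x
  have hωc : ContDiff ℝ 1 fun y => dotForm (g y) := contDiff_dotForm.comp hgc
  obtain ⟨W, hW, hclW, χ, hχ⟩ := P.exists_primitive hΩ hb hsc hV hcl
    (ω := fun y => dotForm (g y)) (hωc.differentiable one_ne_zero).differentiableOn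
    (fun x hx v w => fderiv_dotForm_symm (hd hgc x) (by
      rw [hg, curl2_sub_sub (hd hA x) (hd contDiff_F0 x) (hd ha x), curl2_F0, hcurl x hx]; ring)
      v w)
  have hχc : ContDiffOn ℝ 1 χ W := by
    rw [← zero_add (1 : WithTop ℕ∞)]
    refine (contDiffOn_succ_iff_fderiv_of_isOpen (n := 0) hW).2
      ⟨fun x hx => (hχ x hx).differentiableAt.differentiableWithinAt, by simp,
        contDiffOn_zero.2 ?_⟩
    exact hωc.continuous.continuousOn.congr fun x hx => (hχ x hx).fderiv
  set φ₀ : Plane → ℂ := fun y => Complex.exp (-(B * χ y : ℝ) * Complex.I) * ψ y with hφ₀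
  have hφ₀c : CNearCl 1 Ω φ₀ := by
    refine ⟨W, hW, hclW, ContDiffOn.mul (ContDiffOn.cexp (ContDiffOn.mul ?_ contDiffOn_const))
      hψ.contDiffOn⟩
    exact (Complex.ofRealCLM.contDiff.comp_contDiffOn (contDiffOn_const.mul hχc)).neg
  obtain ⟨φ, hφ, -, hφeq⟩ := hφ₀c.exists_extension hb
  refine ⟨φ, hφ, fun x hx => ?_, fun x hx => ?_⟩
  · rw [(hφeq x (subset_closure hx)).eq_of_nhds, hφ₀]
    simp only
    rw [norm_mul, ← Complex.ofReal_neg, Complex.norm_exp_ofReal_mul_I, one_mul]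
  · have he := hφeq x (subset_closure hx)
    have hm : magSq B (fun y => F0 y + a y) φ x = magSq B (fun y => F0 y + a y) φ₀ x := by
      simp only [magSq, he.fderiv_eq, he.eq_of_nhds]
    rw [hm, hφ₀]
    refine magSq_gauge (hχ x (hclW (subset_closure hx))) (hψ.differentiable one_ne_zero x) ?_ ?_
    · simp [dotForm_apply, hg]
    · simp [dotForm_apply, hg]

open scoped ContDiff in
/-- Comparison of the magnetic energy for a general potential with the ground state energy for the
constant field. -/
theorem BoundaryParam.exists_magSq_lower_bound {Ω : Set Plane} (P : BoundaryParam Ω)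
    (hΩ : IsOpen Ω) (hb : Bornology.IsBounded Ω) (hsc : SimplyConnectedSpace Ω) :
    ∃ C > 0, ∀ (B ε : ℝ), 0 < ε → ε ≤ 1 → ∀ (ψ : Plane → ℂ) (A : Plane → Plane),
      ContDiff ℝ 1 ψ → ContDiff ℝ ∞ A →
      (1 - ε) * (lam1 Ω B * ∫ x in Ω, ‖ψ x‖ ^ 2) - 1 / ε * (B ^ 2 *
        (C * (∫ x in Ω, (curl2 A x - 1) ^ 2) * √(∫ x in Ω, ‖ψ x‖ ^ 4))) ≤
      ∫ x in Ω, magSq B A ψ x := by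
  obtain ⟨R, hR⟩ := hb.closure.subset_ball 0
  obtain ⟨C, hC, hbs⟩ := exists_biotSavart_bound R
  refine ⟨√C, Real.sqrt_pos.2 hC, fun B ε hε hε1 ψ A hψ hA => ?_⟩
  set X := √(∫ x in Ω, ‖ψ x‖ ^ 4) with hX
  set N := ∫ x in Ω, ‖ψ x‖ ^ 2 with hN
  set Q := ∫ x in Ω, magSq B A ψ x with hQ
  set b := ∫ x in Ω, (curl2 A x - 1) ^ 2 with hbdef
  have hX0 : 0 ≤ X := Real.sqrt_nonneg _
  have hX2 : X ^ 2 = ∫ x in Ω, ‖ψ x‖ ^ 4 := Real.sq_sqrt (integral_nonneg fun x => by positivity)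
  have hA1 : ContDiff ℝ 1 A := hA.of_le (by exact_mod_cast le_top)
  have hcurlA : ContDiff ℝ 1 (fun x => curl2 A x - 1) :=
    (contDiff_curl2 (contDiff_infty.1 hA 2)).sub contDiff_const
  have key : ∀ t > 0, (1 - ε) * (lam1 Ω B * N) - 1 / ε * (B ^ 2 * (√C * (b + t) * X)) ≤ Q := by
    intro t ht
    obtain ⟨θ, hθ, hθc, hθs, ⟨V, hV, hclV, hV1⟩, hint⟩ := exists_cutoff_integral_sq_le hΩ hb
      P.volume_frontier hR hcurlA.continuous ht
    set β : Plane → ℝ := fun x => θ x * (curl2 A x - 1) with hβ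
    have hβ1 : ContDiff ℝ 1 β := (hθ.of_le (by exact_mod_cast le_top)).mul hcurlA
    have hβc : HasCompactSupport β := hθc.mul_right
    have hβs : Function.support β ⊆ Metric.ball 0 R := by
      refine (Function.support_mul_subset_left _ _).trans hθs
    set a := biotSavart β with ha
    have ha1 : ContDiff ℝ 1 a := contDiff_biotSavart hβ1 hβc
    obtain ⟨φ, hφ, hφn, hφm⟩ := P.exists_gauge hΩ hb hsc hA1 ha1 hV hclV (fun x hx => by
      rw [ha, curl2_biotSavart hβ1 hβc, hβ]; simp only [hV1 x hx]; ring) B hψ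
    have hac : Continuous fun x => esq (a x) := continuous_esq.comp ha1.continuous
    have hφ2 : Continuous fun x => ‖φ x‖ ^ 2 := hφ.continuous.norm.pow 2
    have hNφ : ∫ x in Ω, ‖φ x‖ ^ 2 = N :=
      setIntegral_congr_fun hΩ.measurableSet fun x hx => by simp only [hφn x hx]
    have h4φ : ∫ x in Ω, (‖φ x‖ ^ 2) ^ 2 = X ^ 2 := by
      rw [hX2]
      exact setIntegral_congr_fun hΩ.measurableSet fun x hx => by
        simp only [hφn x hx]; ring
    have hlam := lam1_mul_le (B := B) (cNearCl_of_contDiff (Ω := Ω) hφ)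
    rw [hNφ] at hlam
    have hcross : ∫ x in Ω, esq (a x) * ‖φ x‖ ^ 2 ≤ √C * (b + t) * X := by
      have hb0 : 0 ≤ b := integral_nonneg fun x => sq_nonneg _
      refine (le_abs_self _).trans (integral_mul_le_of_sq_le (by positivity) hX0
        (integrableOn_of_continuous hb (hac.pow 2)) (integrableOn_of_continuous hb (hφ2.pow 2))
        (integrableOn_of_continuous hb (hac.mul hφ2)) ?_ h4φ.le)
      rw [mul_pow, Real.sq_sqrt hC.le]
      have h1 : ∫ x in Ω, esq (a x) ^ 2 ≤ ∫ x in Metric.ball 0 R, esq (a x) ^ 2 :=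
        setIntegral_mono_set (integrableOn_of_continuous Metric.isBounded_ball (hac.pow 2))
          (Eventually.of_forall fun x => sq_nonneg _)
          (Eventually.of_forall fun x hx => hR (subset_closure hx))
      refine (h1.trans (hbs β hβ1 hβc hβs)).trans ?_
      exact mul_le_mul_of_nonneg_left
        (pow_le_pow_left₀ (integral_nonneg fun x => sq_nonneg _) hint 2) hC.le
    have i1 : IntegrableOn (fun x => (1 - ε) * magSq B F0 φ x) Ω :=
      integrableOn_of_continuous hb (continuous_const.mul (continuous_magSq hφ continuous_F0))
    have i2 : IntegrableOn (fun x => 1 / ε * (B ^ 2 * (esq (a x) * ‖φ x‖ ^ 2))) Ω :=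
      integrableOn_of_continuous hb
        (continuous_const.mul (continuous_const.mul (hac.mul hφ2)))
    have hmono : ∫ x in Ω, ((1 - ε) * magSq B F0 φ x
        - 1 / ε * (B ^ 2 * (esq (a x) * ‖φ x‖ ^ 2))) ≤ Q :=
      setIntegral_mono_on (i1.sub i2)
        (integrableOn_of_continuous hb (continuous_magSq hψ hA1.continuous)) hΩ.measurableSet
        fun x hx => (le_magSq_add hε B F0 a φ x).trans_eq (hφm x hx)
    rw [integral_sub i1 i2, integral_const_mul, integral_const_mul, integral_const_mul] at hmono
    refine le_trans (sub_le_sub ?_ ?_) hmono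
    · exact mul_le_mul_of_nonneg_left hlam (by linarith)
    · have : (0 : ℝ) ≤ 1 / ε := by positivity
      gcongr
  have hlim : Tendsto (fun t : ℝ => (1 - ε) * (lam1 Ω B * N)
      - 1 / ε * (B ^ 2 * (√C * (b + t) * X))) (𝓝[>] 0)
      (𝓝 ((1 - ε) * (lam1 Ω B * N) - 1 / ε * (B ^ 2 * (√C * (b + 0) * X)))) :=
    (Continuous.tendsto (by fun_prop) 0).mono_left nhdsWithin_le_nhds
  rw [add_zero] at hlim
  refine le_of_tendsto hlim ?_
  filter_upwards [self_mem_nhdsWithin] with t ht using key t ht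

open scoped ContDiff in
/-- Away from the boundary the magnetic energy controls the field strength. -/
theorem exists_interior_estimate {Ω : Set Plane} (hΩ : IsOpen Ω) (hb : Bornology.IsBounded Ω)
    {w : ℝ} (hw : 0 < w) : ∃ M ≥ 0, ∀ (B : ℝ), 0 ≤ B → ∀ (ψ : Plane → ℂ) (A : Plane → Plane),
      ContDiff ℝ 2 ψ → ContDiff ℝ 2 A →
      B * ((∫ x in Ω, ‖ψ x‖ ^ 2) - w * √(∫ x in Ω, ‖ψ x‖ ^ 4)
        - √(∫ x in Ω, (curl2 A x - 1) ^ 2) * √(∫ x in Ω, ‖ψ x‖ ^ 4)) ≤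
      21 / 20 * (∫ x in Ω, magSq B A ψ x) + M * ∫ x in Ω, ‖ψ x‖ ^ 2 := by
  obtain ⟨K, hKΩ, hK, hKvol⟩ := hΩ.measurableSet.exists_isCompact_sdiff_lt (μ := volume)
    hb.measure_lt_top.ne (ε := ENNReal.ofReal (w ^ 2)) (by simpa using hw.ne')
  obtain ⟨η, hη, hηc, hηs, ⟨V, hV, hKV, hV1⟩, h01⟩ := exists_cutoff hK hΩ hKΩ
  have hη1 : ContDiff ℝ 1 η := hη.of_le (by exact_mod_cast le_top)
  have hη2 : ContDiff ℝ 2 η := contDiff_infty.1 hη 2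
  have hdη : ∀ v, Continuous fun x => fderiv ℝ η x v := fun v =>
    (hη1.continuous_fderiv one_ne_zero).clm_apply continuous_const
  obtain ⟨M, hM⟩ := hb.isCompact_closure.exists_bound_of_continuousOn
    (f := fun x => fderiv ℝ η x (1, 0) ^ 2 + fderiv ℝ η x (0, 1) ^ 2)
    (((hdη _).pow 2).add ((hdη _).pow 2)).continuousOn
  have hsq : ∀ x, η x ^ 2 ≤ 1 := fun x => pow_le_one₀ (h01 x).1 (h01 x).2
  have hcη : Continuous fun x => 1 - η x ^ 2 := continuous_const.sub (hη.continuous.pow 2)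
  have hηint : ∫ x in Ω, (1 - η x ^ 2) ^ 2 ≤ w ^ 2 := by
    have hm : MeasurableSet (Ω \ K) := hΩ.measurableSet.diff hK.measurableSet
    have hle : ∫ x in Ω, (1 - η x ^ 2) ^ 2 ≤ ∫ x in Ω, (Ω \ K).indicator (fun _ => (1 : ℝ)) x := by
      refine setIntegral_mono_on (integrableOn_of_continuous hb (hcη.pow 2))
        ((integrableOn_const hb.measure_lt_top.ne).indicator hm) hΩ.measurableSet fun x hx => ?_
      by_cases hxK : x ∈ K
      · rw [hV1 x (hKV hxK), indicator_of_notMem (fun h => h.2 hxK)]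
        norm_num
      · rw [indicator_of_mem (show x ∈ Ω \ K from ⟨hx, hxK⟩)]
        exact pow_le_one₀ (by linarith [hsq x]) (by linarith [sq_nonneg (η x)])
    refine hle.trans ?_
    rw [setIntegral_indicator hm, inter_eq_right.2 sdiff_subset, setIntegral_const, smul_eq_mul,
      mul_one]
    exact ENNReal.toReal_le_of_le_ofReal (sq_nonneg _) hKvol.le
  refine ⟨21 * |M|, by positivity, fun B hB ψ A hψ hA => ?_⟩
  set X := √(∫ x in Ω, ‖ψ x‖ ^ 4) with hX
  set b := √(∫ x in Ω, (curl2 A x - 1) ^ 2) with hbdef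
  have hX0 : 0 ≤ X := Real.sqrt_nonneg _
  have hb0 : 0 ≤ b := Real.sqrt_nonneg _
  have hX2 : X ^ 2 = ∫ x in Ω, ‖ψ x‖ ^ 4 := Real.sq_sqrt (integral_nonneg fun x => by positivity)
  have hb2 : b ^ 2 = ∫ x in Ω, (curl2 A x - 1) ^ 2 :=
    Real.sq_sqrt (integral_nonneg fun x => sq_nonneg _)
  have hψ1 : ContDiff ℝ 1 ψ := hψ.of_le one_le_two
  have hA1 : ContDiff ℝ 1 A := hA.of_le one_le_two
  have hcc : Continuous fun x => curl2 A x - 1 :=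
    (contDiff_curl2 hA).continuous.sub continuous_const
  have hψ2 : Continuous fun x => ‖ψ x‖ ^ 2 := hψ.continuous.norm.pow 2
  have hηψ : Continuous fun x => η x ^ 2 * ‖ψ x‖ ^ 2 := (hη.continuous.pow 2).mul hψ2
  set u : Plane → ℂ := fun x => η x • ψ x with hu
  have huc : HasCompactSupport u := hηc.smul_right
  have hu2 : ContDiff ℝ 2 u := hη2.smul hψ
  have hus : tsupport u ⊆ Ω := (closure_mono (Function.support_smul_subset_left _ _)).trans hηs
  have hun : ∀ x, ‖u x‖ ^ 2 = η x ^ 2 * ‖ψ x‖ ^ 2 := fun x => by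
    rw [hu]; simp only [norm_smul, mul_pow, Real.norm_eq_abs, sq_abs]
  have hmain := integral_curl_le_integral_magSq (B := B) hA1 hu2 huc
  have hz : ∀ x, x ∉ Ω → u x = 0 := fun x hx =>
    image_eq_zero_of_notMem_tsupport fun h => hx (hus h)
  have e1 : ∫ x, curl2 A x * ‖u x‖ ^ 2 = ∫ x in Ω, curl2 A x * ‖u x‖ ^ 2 :=
    (setIntegral_eq_integral_of_forall_compl_eq_zero fun x hx => by simp [hz x hx]).symm
  have e2 : ∫ x, magSq B A u x = ∫ x in Ω, magSq B A u x :=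
    (setIntegral_eq_integral_of_forall_compl_eq_zero fun x hx => by
      simp [magSq, hz x hx, fderiv_of_notMem_tsupport (𝕜 := ℝ) (fun h => hx (hus h))]).symm
  have hupper : ∫ x in Ω, magSq B A u x ≤
      21 / 20 * (∫ x in Ω, magSq B A ψ x) + 21 * |M| * ∫ x in Ω, ‖ψ x‖ ^ 2 := by
    have i1 : IntegrableOn (fun x => 21 / 20 * magSq B A ψ x) Ω := integrableOn_of_continuous hb
      (continuous_const.mul (continuous_magSq hψ1 hA1.continuous))
    have i2 : IntegrableOn (fun x => 21 * |M| * ‖ψ x‖ ^ 2) Ω :=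
      integrableOn_of_continuous hb (continuous_const.mul hψ2)
    rw [← integral_const_mul, ← integral_const_mul, ← integral_add i1 i2]
    refine setIntegral_mono_on (integrableOn_of_continuous hb (continuous_magSq
      (hu2.of_le one_le_two) hA1.continuous)) (i1.add i2) hΩ.measurableSet fun x hx => ?_
    refine (magSq_smul_le (τ := 1 / 20) (by norm_num) (hη1.differentiable one_ne_zero x)
      (hψ1.differentiable one_ne_zero x)).trans (add_le_add ?_ ?_)
    · have := mul_le_of_le_one_left (magSq_nonneg B A ψ x) (hsq x)
      linarith
    · have h1 := (le_abs_self _).trans ((hM x (subset_closure hx)).trans (le_abs_self M))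
      have h2 := mul_le_mul_of_nonneg_right h1 (sq_nonneg ‖ψ x‖)
      norm_num at h2 ⊢
      linarith
  have hD : ∫ x in Ω, (1 - η x ^ 2) * ‖ψ x‖ ^ 2 ≤ w * X :=
    (le_abs_self _).trans (integral_mul_le_of_sq_le hw.le hX0
      (integrableOn_of_continuous hb (hcη.pow 2)) (integrableOn_of_continuous hb (hψ2.pow 2))
      (integrableOn_of_continuous hb (hcη.mul hψ2)) hηint
      (by rw [hX2]; exact le_of_eq (by congr 1; funext x; ring)))
  have hF : -(b * X) ≤ ∫ x in Ω, (curl2 A x - 1) * (η x ^ 2 * ‖ψ x‖ ^ 2) := by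
    refine (abs_le.1 (integral_mul_le_of_sq_le hb0 hX0
      (integrableOn_of_continuous hb (hcc.pow 2)) (integrableOn_of_continuous hb (hηψ.pow 2))
      (integrableOn_of_continuous hb (hcc.mul hηψ)) hb2.ge ?_)).1
    rw [hX2]
    refine setIntegral_mono_on (integrableOn_of_continuous hb (hηψ.pow 2))
      (integrableOn_of_continuous hb (hψ.continuous.norm.pow 4)) hΩ.measurableSet fun x _ => ?_
    have h1 : (η x ^ 2) ^ 2 ≤ 1 := pow_le_one₀ (sq_nonneg _) (hsq x)
    calc (η x ^ 2 * ‖ψ x‖ ^ 2) ^ 2 = (η x ^ 2) ^ 2 * ‖ψ x‖ ^ 4 := by ring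
      _ ≤ ‖ψ x‖ ^ 4 := mul_le_of_le_one_left (by positivity) h1
  have hsplit : ∫ x in Ω, curl2 A x * ‖u x‖ ^ 2 = (∫ x in Ω, ‖ψ x‖ ^ 2)
      - (∫ x in Ω, (1 - η x ^ 2) * ‖ψ x‖ ^ 2)
      + ∫ x in Ω, (curl2 A x - 1) * (η x ^ 2 * ‖ψ x‖ ^ 2) := by
    have i1 : IntegrableOn (fun x => ‖ψ x‖ ^ 2) Ω := integrableOn_of_continuous hb hψ2
    have i2 : IntegrableOn (fun x => (1 - η x ^ 2) * ‖ψ x‖ ^ 2) Ω :=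
      integrableOn_of_continuous hb (hcη.mul hψ2)
    have i3 : IntegrableOn (fun x => (curl2 A x - 1) * (η x ^ 2 * ‖ψ x‖ ^ 2)) Ω :=
      integrableOn_of_continuous hb (hcc.mul hηψ)
    have i12 : IntegrableOn (fun x => ‖ψ x‖ ^ 2 - (1 - η x ^ 2) * ‖ψ x‖ ^ 2) Ω := i1.sub i2
    rw [← integral_sub i1 i2, ← integral_add i12 i3]
    congr 1; funext x
    rw [hun]; ring
  rw [e1, e2, hsplit] at hmain
  refine le_trans (mul_le_mul_of_nonneg_left ?_ hB) (hmain.trans hupper)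
  linarith

theorem quartic_le_of_estimates {κ B N X b C M Q l : ℝ} (hκ : 0 < κ) (hB : 0 < B)
    (hN : 0 ≤ N) (hX : 0 ≤ X) (hC : 0 < C) (hQ : 0 ≤ Q)
    (hl : κ ^ 2 ≤ l) (hlB : l ≤ 9 / 10 * B) (hMB : M + 2 / 3 ≤ B / 200)
    (hXN : X = 0 → N = 0)
    (hint : B * (N - 1 / (200 * C) * X - b * X) ≤ 21 / 20 * Q + M * N)
    (hlow : ∀ ε, 0 < ε → ε ≤ 1 →
      (1 - ε) * (l * N) - 1 / ε * (B ^ 2 * (C * b ^ 2 * X)) ≤ Q) :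
    κ ^ 2 / 8 * X ^ 2 ≤ Q - κ ^ 2 * N + κ ^ 2 / 2 * X ^ 2 + B ^ 2 * b ^ 2 := by
  have hκ2 : 0 < κ ^ 2 := by positivity
  have hBb : 0 ≤ B ^ 2 * b ^ 2 := by positivity
  rcases hX.eq_or_lt with h0 | hX0
  · rw [← h0, hXN h0.symm]
    linarith
  by_contra! hE
  have hX2 : X ^ 2 ≤ 8 / 3 * N := by
    have : κ ^ 2 * (3 / 8 * X ^ 2) ≤ κ ^ 2 * N := by linarith
    linarith [le_of_mul_le_mul_left this hκ2]
  have hκN : κ ^ 2 * N ≤ 9 / 10 * B * N := mul_le_mul_of_nonneg_right (hl.trans hlB) hN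
  have hQu : Q ≤ 9 / 10 * B * N - B ^ 2 * b ^ 2 := by
    have : 0 ≤ κ ^ 2 * X ^ 2 := by positivity
    linarith
  have hNX : N ≤ X / (10 * C) := by
    have hMN := mul_le_mul_of_nonneg_right hMB hN
    have h1 : B * (b * X) ≤ B ^ 2 * b ^ 2 + X ^ 2 / 4 := by
      linarith [sq_nonneg (B * b - X / 2)]
    have h2 : B * (N / 20) ≤ B * (1 / (200 * C) * X) := by linarith
    have h3 := le_of_mul_le_mul_left h2 hB
    have h4 : X / (10 * C) = 20 * (1 / (200 * C) * X) := by field_simp; norm_num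
    linarith
  rw [le_div_iff₀ (by positivity)] at hNX
  have hXC : C * X ≤ 1 := by
    have h1 : X * (C * X) ≤ X * (8 / 30) := by
      linarith [mul_le_mul_of_nonneg_left hX2 hC.le]
    linarith [le_of_mul_le_mul_left h1 hX0]
  have hlow' := hlow (C * X) (by positivity) hXC
  have e : 1 / (C * X) * (B ^ 2 * (C * b ^ 2 * X)) = B ^ 2 * b ^ 2 := by field_simp
  rw [e] at hlow'
  have h1 : (1 - C * X) * (κ ^ 2 * N) ≤ (1 - C * X) * (l * N) :=
    mul_le_mul_of_nonneg_left (mul_le_mul_of_nonneg_right hl hN) (by linarith)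
  have h2 : C * X * (κ ^ 2 * N) ≤ κ ^ 2 * X ^ 2 / 10 := by
    linarith [mul_le_mul_of_nonneg_left hNX (by positivity : 0 ≤ κ ^ 2 * X)]
  have : 0 ≤ κ ^ 2 * X ^ 2 := by positivity
  linarith

/-- The ground state energy grows at most quadratically. -/
theorem exists_lam1_le_sq {Ω : Set Plane} (hΩ : IsOpen Ω) (hne : Ω.Nonempty)
    (hb : Bornology.IsBounded Ω) : ∃ C > 0, ∀ B, lam1 Ω B ≤ C * B ^ 2 := by
  have h1 := integral_norm_sq_pos hΩ hne hb (continuous_const (y := (1 : ℂ)))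
    fun _ => one_ne_zero
  refine ⟨(∫ x in Ω, esq (F0 x)) / (∫ x in Ω, ‖(1 : ℂ)‖ ^ 2) + 1, ?_, fun B => ?_⟩
  · have : 0 ≤ ∫ x in Ω, esq (F0 x) := integral_nonneg fun x =>
      add_nonneg (sq_nonneg _) (sq_nonneg _)
    positivity
  · have h2 := lam1_mul_le (Ω := Ω) (B := B) (u := fun _ => 1) (cNearCl_of_contDiff contDiff_const)
    have e : ∫ x in Ω, magSq B F0 (fun _ => 1) x = B ^ 2 * ∫ x in Ω, esq (F0 x) := by
      rw [← integral_const_mul]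
      congr 1; funext x
      simp only [magSq, fderiv_fun_const, esq]
      simp [mul_pow, mul_add]
    rw [e, ← le_div_iff₀ h1, mul_div_assoc] at h2
    nlinarith [sq_nonneg B]

/-- A nonnegative Ginzburg–Landau energy forces the linear spectral bound. -/
theorem NormalMin.le_lam1 {Ω : Set Plane} (hΩ : IsOpen Ω) (hne : Ω.Nonempty)
    (hb : Bornology.IsBounded Ω) {κ H : ℝ} (h : NormalMin Ω κ H) : κ ^ 2 ≤ lam1 Ω (κ * H) := by
  refine le_csInf ⟨_, fun _ => 1, cNearCl_of_contDiff contDiff_const, (integral_norm_sq_pos hΩ hne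
    hb continuous_const fun _ => one_ne_zero).ne', rfl⟩ ?_
  rintro r ⟨u, hu, h0, rfl⟩
  have hpos : 0 < ∫ x in Ω, ‖u x‖ ^ 2 :=
    lt_of_le_of_ne (integral_nonneg fun x => sq_nonneg _) (Ne.symm h0)
  rw [le_div_iff₀ hpos]
  obtain ⟨g, hg, -, hgu⟩ := hu.exists_extension hb
  have hval : ∀ x ∈ Ω, g x = u x := fun x hx => (hgu x (subset_closure hx)).eq_of_nhds
  have hmag : ∀ x ∈ Ω, magSq (κ * H) F0 g x = magSq (κ * H) F0 u x := fun x hx => by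
    simp only [magSq, hval x hx, (hgu x (subset_closure hx)).fderiv_eq]
  rw [← setIntegral_congr_fun hΩ.measurableSet hmag, ← setIntegral_congr_fun hΩ.measurableSet
    (g := fun x => ‖u x‖ ^ 2) fun x hx => congrArg (‖·‖ ^ 2) (hval x hx)]
  have i1 : IntegrableOn (magSq (κ * H) F0 g) Ω :=
    integrableOn_of_continuous hb (continuous_magSq hg continuous_F0)
  have i2 : IntegrableOn (fun x => ‖g x‖ ^ 2) Ω :=
    integrableOn_of_continuous hb (hg.continuous.norm.pow 2)
  have i4 : IntegrableOn (fun x => ‖g x‖ ^ 4) Ω :=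
    integrableOn_of_continuous hb (hg.continuous.norm.pow 4)
  have key : ∀ t : ℝ, 0 < t → κ ^ 2 * (∫ x in Ω, ‖g x‖ ^ 2) ≤
      (∫ x in Ω, magSq (κ * H) F0 g x) + t ^ 2 * (κ ^ 2 / 2 * ∫ x in Ω, ‖g x‖ ^ 4) := by
    intro t ht
    have h1 := h (fun x => t • g x) F0 ⟨cNearCl_of_contDiff (hg.const_smul t),
      cNearCl_of_contDiff (contDiff_F0.of_le le_top)⟩
    have e : ∀ x, magSq (κ * H) F0 (fun x => t • g x) x - κ ^ 2 * ‖t • g x‖ ^ 2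
        + κ ^ 2 / 2 * ‖t • g x‖ ^ 4 + κ ^ 2 * H ^ 2 * (curl2 F0 x - 1) ^ 2 =
        t ^ 2 * (magSq (κ * H) F0 g x - κ ^ 2 * ‖g x‖ ^ 2
          + t ^ 2 * (κ ^ 2 / 2) * ‖g x‖ ^ 4) := by
      intro x
      have e1 : ∀ (c : ℝ) (v : Plane), ‖(-Complex.I) * fderiv ℝ (fun x => t • g x) x v
          - (c : ℂ) * t • g x‖ ^ 2 =
          t ^ 2 * ‖(-Complex.I) * fderiv ℝ g x v - (c : ℂ) * g x‖ ^ 2 := by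
        intro c v
        rw [fderiv_fun_const_smul (hg.differentiable one_ne_zero x), smul_apply,
          mul_smul_comm, mul_smul_comm, ← smul_sub, norm_smul, mul_pow, Real.norm_eq_abs, sq_abs]
      simp only [magSq, e1, curl2_F0, norm_smul, mul_pow, Real.norm_eq_abs, abs_of_pos ht]
      ring
    simp only [GLenergy, e, integral_const_mul] at h1
    have h2 := nonneg_of_mul_nonneg_right h1 (by positivity : 0 < t ^ 2)
    have i12 : IntegrableOn (fun x => magSq (κ * H) F0 g x - κ ^ 2 * ‖g x‖ ^ 2) Ω :=
      i1.sub (i2.const_mul _)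
    rw [integral_add i12 (i4.const_mul _), integral_sub i1 (i2.const_mul _), integral_const_mul,
      integral_const_mul] at h2
    linarith
  have hlim : Tendsto (fun t : ℝ => (∫ x in Ω, magSq (κ * H) F0 g x)
      + t ^ 2 * (κ ^ 2 / 2 * ∫ x in Ω, ‖g x‖ ^ 4)) (𝓝[>] 0)
      (𝓝 ((∫ x in Ω, magSq (κ * H) F0 g x) + 0 ^ 2 * (κ ^ 2 / 2 * ∫ x in Ω, ‖g x‖ ^ 4))) :=
    (Continuous.tendsto (by fun_prop) 0).mono_left nhdsWithin_le_nhds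
  have := ge_of_tendsto hlim (eventually_nhdsWithin_of_forall key)
  linarith

/-- If `∫ ‖ψ‖⁴` vanishes then so does `∫ ‖ψ‖²`. -/
theorem integral_sq_eq_zero_of_quartic {Ω : Set Plane} (hb : Bornology.IsBounded Ω)
    {g : Plane → ℂ} (hg : Continuous g) (h : ∫ x in Ω, ‖g x‖ ^ 4 = 0) :
    ∫ x in Ω, ‖g x‖ ^ 2 = 0 := by
  have h1 := integral_mul_sq_le (μ := volume.restrict Ω) (f := fun x => ‖g x‖ ^ 2)
    (g := fun _ => 1) (integrableOn_of_continuous hb ((hg.norm.pow 2).pow 2))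
    (integrableOn_of_continuous hb (continuous_const.pow 2))
    (integrableOn_of_continuous hb ((hg.norm.pow 2).mul continuous_const))
  simp only [← pow_mul, Nat.reduceMul, h, zero_mul, mul_one] at h1
  exact pow_eq_zero_iff two_ne_zero |>.1 (le_antisymm h1 (sq_nonneg _))

/-- For large `κ`, the linear spectral bound makes the Ginzburg–Landau energy coercive. -/
theorem BoundaryParam.exists_GLenergy_coercive {Ω : Set Plane} (P : BoundaryParam Ω)
    (hΩ : IsOpen Ω) (hb : Bornology.IsBounded Ω) (hsc : SimplyConnectedSpace Ω) :
    ∃ κ₀ > 0, ∀ κ > κ₀, ∀ H > 0, κ ^ 2 ≤ lam1 Ω (κ * H) → ∀ ψ A, GLadm Ω ψ A →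
      κ ^ 2 / 8 * ∫ x in Ω, ‖ψ x‖ ^ 4 ≤ GLenergy Ω κ H ψ A := by
  obtain ⟨C₁, hC₁, hlamsq⟩ := exists_lam1_le_sq hΩ P.nonempty hb
  obtain ⟨B₀, hB₀, hlam⟩ := P.exists_lam1_le hΩ hb
  obtain ⟨C, hC, hlow⟩ := P.exists_magSq_lower_bound hΩ hb hsc
  obtain ⟨M, hM, hint⟩ := exists_interior_estimate hΩ hb (w := 1 / (200 * C)) (by positivity)
  set B₁ := max B₀ (200 * (M + 2 / 3)) with hB₁
  have hB₁0 : 0 < B₁ := lt_max_of_lt_left hB₀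
  refine ⟨√C₁ * B₁, by positivity, fun κ hκ H hH hl => ?_⟩
  have hκ0 : 0 < κ := lt_trans (by positivity) hκ
  have hB : 0 < κ * H := by positivity
  have hBB : B₁ ≤ κ * H := by
    have h1 : κ ^ 2 ≤ (√C₁ * (κ * H)) ^ 2 := by
      rw [mul_pow, Real.sq_sqrt hC₁.le]
      exact hl.trans (hlamsq _)
    have h2 := (pow_le_pow_iff_left₀ hκ0.le (by positivity) two_ne_zero).1 h1
    exact le_of_mul_le_mul_left (hκ.le.trans h2) (Real.sqrt_pos.2 hC₁)
  have hl9 := hlam (κ * H) ((le_max_left _ _).trans hBB)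
  have hMB : M + 2 / 3 ≤ κ * H / 200 := by linarith [(le_max_right _ _).trans hBB]
  intro ψ A hψA
  refine le_GLenergy_of_smooth hΩ hb (fun ψ A hψ hA => ?_) hψA
  have hψ1 : ContDiff ℝ 1 ψ := hψ.of_le (by exact_mod_cast le_top)
  have hψ2 : ContDiff ℝ 2 ψ := contDiff_infty.1 hψ 2
  have hA2 : ContDiff ℝ 2 A := contDiff_infty.1 hA 2
  have hsq4 : √(∫ x in Ω, ‖ψ x‖ ^ 4) ^ 2 = ∫ x in Ω, ‖ψ x‖ ^ 4 :=
    Real.sq_sqrt (integral_nonneg fun x => by positivity)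
  have hsqb : √(∫ x in Ω, (curl2 A x - 1) ^ 2) ^ 2 = ∫ x in Ω, (curl2 A x - 1) ^ 2 :=
    Real.sq_sqrt (integral_nonneg fun x => sq_nonneg _)
  have i1 : IntegrableOn (magSq (κ * H) A ψ) Ω :=
    integrableOn_of_continuous hb (continuous_magSq hψ1 hA2.continuous)
  have i2 : IntegrableOn (fun x => κ ^ 2 * ‖ψ x‖ ^ 2) Ω :=
    integrableOn_of_continuous hb (continuous_const.mul (hψ.continuous.norm.pow 2))
  have i3 : IntegrableOn (fun x => κ ^ 2 / 2 * ‖ψ x‖ ^ 4) Ω :=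
    integrableOn_of_continuous hb (continuous_const.mul (hψ.continuous.norm.pow 4))
  have i4 : IntegrableOn (fun x => κ ^ 2 * H ^ 2 * (curl2 A x - 1) ^ 2) Ω :=
    integrableOn_of_continuous hb (continuous_const.mul
      (((contDiff_curl2 hA2).continuous.sub continuous_const).pow 2))
  have i12 : IntegrableOn (fun x => magSq (κ * H) A ψ x - κ ^ 2 * ‖ψ x‖ ^ 2) Ω := i1.sub i2
  have i123 : IntegrableOn
      (fun x => magSq (κ * H) A ψ x - κ ^ 2 * ‖ψ x‖ ^ 2 + κ ^ 2 / 2 * ‖ψ x‖ ^ 4) Ω := i12.add i3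
  have hE : GLenergy Ω κ H ψ A = (∫ x in Ω, magSq (κ * H) A ψ x) - κ ^ 2 * (∫ x in Ω, ‖ψ x‖ ^ 2)
      + κ ^ 2 / 2 * √(∫ x in Ω, ‖ψ x‖ ^ 4) ^ 2
      + (κ * H) ^ 2 * √(∫ x in Ω, (curl2 A x - 1) ^ 2) ^ 2 := by
    rw [GLenergy, integral_add i123 i4, integral_add i12 i3, integral_sub i1 i2,
      integral_const_mul, integral_const_mul, integral_const_mul, hsq4, hsqb, mul_pow]
  rw [hE]
  nth_rw 1 [← hsq4]
  refine quartic_le_of_estimates hκ0 hB (integral_nonneg fun x => sq_nonneg _)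
    (Real.sqrt_nonneg _) hC (integral_nonneg fun x => magSq_nonneg _ _ _ x) hl hl9 hMB
    (fun h => integral_sq_eq_zero_of_quartic hb hψ.continuous ?_)
    (hint _ hB.le ψ A hψ2 hA2) fun ε h0 h1 => ?_
  · rw [← hsq4, h, zero_pow two_ne_zero]
  · rw [hsqb]
    exact hlow _ ε h0 h1 ψ A hψ1 hA

/-- For large `κ`, uniqueness of the normal state is a linear spectral condition. -/
theorem BoundaryParam.exists_normalUnique_iff {Ω : Set Plane} (P : BoundaryParam Ω)
    (hΩ : IsOpen Ω) (hb : Bornology.IsBounded Ω) (hsc : SimplyConnectedSpace Ω) :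
    ∃ κ₀ > 0, ∀ κ > κ₀, ∀ H > 0, (NormalUnique Ω κ H ↔ κ ^ 2 ≤ lam1 Ω (κ * H)) := by
  obtain ⟨κ₀, hκ₀, h⟩ := P.exists_GLenergy_coercive hΩ hb hsc
  refine ⟨κ₀, hκ₀, fun κ hκ H hH => ⟨fun hN => hN.1.le_lam1 hΩ P.nonempty hb, fun hl => ?_⟩⟩
  have hκ0 : 0 < κ := hκ₀.trans hκ
  have h4 : ∀ ψ : Plane → ℂ, 0 ≤ ∫ x in Ω, ‖ψ x‖ ^ 4 := fun ψ =>
    integral_nonneg fun x => by positivity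
  refine ⟨fun ψ A hψA => ?_, fun ψ A hψA hne => ?_⟩
  · have := h4 ψ
    exact le_trans (by positivity) (h κ hκ H hH hl ψ A hψA)
  · refine lt_of_lt_of_le (mul_pos (by positivity) (lt_of_le_of_ne (h4 ψ) fun h0 => hne ?_))
      (h κ hκ H hH hl ψ A hψA)
    obtain ⟨g, hg, -, hgψ⟩ := hψA.1.exists_extension hb
    have hval : ∀ x ∈ Ω, g x = ψ x := fun x hx => (hgψ x (subset_closure hx)).eq_of_nhds
    rw [← setIntegral_congr_fun hΩ.measurableSet
      (g := fun x => ‖ψ x‖ ^ 4) fun x hx => congrArg (‖·‖ ^ 4) (hval x hx)] at h0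
    rw [← setIntegral_congr_fun hΩ.measurableSet
      (g := fun x => ‖ψ x‖ ^ 2) fun x hx => congrArg (‖·‖ ^ 2) (hval x hx)]
    exact integral_sq_eq_zero_of_quartic hb hg.continuous h0.symm

end SC


/-- For large `κ`, the upper global critical field equals the upper local one. -/
theorem upper_fields_coincide
    (Ω : Set SC.Plane) (hΩ_open : IsOpen Ω) (hΩ_bdd : Bornology.IsBounded Ω)
    (hΩ_sc : SimplyConnectedSpace ↥Ω) (P : SC.BoundaryParam Ω) :
    ∃ κ₀ > 0, ∀ κ > κ₀, SC.HC3up Ω κ = SC.HlocUp Ω κ := by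
  obtain ⟨κ₀, hκ₀, h⟩ := P.exists_normalUnique_iff hΩ_open hΩ_bdd hΩ_sc
  refine ⟨κ₀, hκ₀, fun κ hκ => ?_⟩
  unfold SC.HC3up SC.HlocUp
  congr 1
  ext H
  exact and_congr_right fun hH => forall₂_congr fun H' hH' => h κ hκ H' (hH.trans hH')
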